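/- Let k be an algebraically closed field and let S = V(f) ⊆ P³ be a smooth surface of degree d ≥ 3 containing exactly d²(d²−3d+3) lines. Then there exist a prime p and an integer e ≥ 1 with d = pᵉ+1, and a bijection φ from the set of lines on S to the set of lines on the Fermat surface X = V(x^{pᵉ+1}+y^{pᵉ+1}+z^{pᵉ+1}+w^{pᵉ+1}) ⊆ P³ over the algebraic closure of 𝔽_p, such that for any two distinct lines W, W′ on S, W and W′ meet if and only if φ(W) and φ(W′) meet. -/

import Mathlib

open MvPolynomial

/-- `W` is a line (2-dimensional linear subspace of `k⁴`) lying on the surface `V(f) ⊆ P³`. -/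
def IsLineOn {k : Type*} [Field k] (f : MvPolynomial (Fin 4) k)
    (W : Submodule k (Fin 4 → k)) : Prop :=
  Module.finrank k W = 2 ∧ ∀ v ∈ W, MvPolynomial.eval v f = 0

/-- `f` is a nonzero homogeneous polynomial of degree `d` in `k[x,y,z,w]` such that `f` and its
four partial derivatives have no common zero in `k⁴ ∖ {0}`; i.e. `V(f) ⊆ P³` is a smooth
surface of degree `d`. -/
def IsSmoothSurface {k : Type*} [Field k] (f : MvPolynomial (Fin 4) k) (d : ℕ) : Prop :=
  f ≠ 0 ∧ f.IsHomogeneous d ∧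
    ∀ v : Fin 4 → k, v ≠ 0 →
      ¬ (MvPolynomial.eval v f = 0 ∧
         ∀ i : Fin 4, MvPolynomial.eval v (MvPolynomial.pderiv i f) = 0)

namespace FermatLines

section Restriction

variable {k R S : Type*} [Field k] [CommRing R] [Algebra k R] [CommRing S] [Algebra k S]

/-- The polynomial `f(P + X • D)` in one variable `X`. -/
noncomputable def restr (f : MvPolynomial (Fin 4) k) (P D : Fin 4 → R) : Polynomial R :=
  aeval (fun a => Polynomial.C (P a) + Polynomial.X * Polynomial.C (D a)) f

/-- The `j`-th polar form of `f`: the coefficient of `X ^ j` in `f(P + X • D)`. -/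
noncomputable def polar (f : MvPolynomial (Fin 4) k) (j : ℕ) (P D : Fin 4 → R) : R :=
  (restr f P D).coeff j

lemma aeval_smul_of_isHomogeneous {σ : Type*} [Fintype σ] {f : MvPolynomial σ k} {d : ℕ}
    (hf : f.IsHomogeneous d) (c : R) (v : σ → R) : aeval (c • v) f = c ^ d * aeval v f := by
  rw [aeval_def, aeval_def, eval₂_eq', eval₂_eq', Finset.mul_sum]
  refine Finset.sum_congr rfl fun m hm => ?_
  have hm' := hf (mem_support_iff.mp hm)
  have : ∑ i, m i = d := by
    rw [← hm', Finsupp.weight_apply, Finsupp.sum_fintype] <;> simp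
  simp only [Pi.smul_apply, smul_eq_mul, mul_pow, Finset.prod_mul_distrib,
    Finset.prod_pow_eq_pow_sum, this]
  ring

lemma restr_map (f : MvPolynomial (Fin 4) k) (φ : R →ₐ[k] S) (P D : Fin 4 → R) :
    (restr f P D).map (φ : R →+* S) = restr f (φ ∘ P) (φ ∘ D) := by
  have h : ((Polynomial.mapAlgHom φ).comp (aeval (fun a => Polynomial.C (P a) +
      Polynomial.X * Polynomial.C (D a)))) = aeval (fun a => Polynomial.C ((φ ∘ P) a) +
      Polynomial.X * Polynomial.C ((φ ∘ D) a)) (R := k) := by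
    apply MvPolynomial.algHom_ext
    intro i
    simp
  exact DFunLike.congr_fun h f

lemma map_polar (f : MvPolynomial (Fin 4) k) (φ : R →ₐ[k] S) (j : ℕ) (P D : Fin 4 → R) :
    φ (polar f j P D) = polar f j (φ ∘ P) (φ ∘ D) := by
  rw [polar, polar, ← restr_map, Polynomial.coeff_map]
  rfl

lemma eval_restr (f : MvPolynomial (Fin 4) k) (b : R) (P D : Fin 4 → R) :
    (restr f P D).eval b = aeval (P + b • D) f := by
  have h : (((Polynomial.aeval b).restrictScalars k).comp (aeval (fun a => Polynomial.C (P a) +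
      Polynomial.X * Polynomial.C (D a)))) = aeval (P + b • D) (R := k) := by
    apply MvPolynomial.algHom_ext
    intro i
    simp
    exact mul_comm _ _
  rw [← h]
  simp [restr]

lemma polar_zero (f : MvPolynomial (Fin 4) k) (P D : Fin 4 → R) :
    polar f 0 P D = aeval P f := by
  rw [polar, Polynomial.coeff_zero_eq_eval_zero, eval_restr]
  simp

lemma polar_one (f : MvPolynomial (Fin 4) k) (P D : Fin 4 → R) :
    polar f 1 P D = ∑ a, aeval P (pderiv a f) * D a := by
  induction f using MvPolynomial.induction_on with
  | C c =>
    simp [polar, restr, IsScalarTower.algebraMap_apply k R (Polynomial R)]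
  | add p q hp hq =>
    simp only [polar, restr, map_add, Polynomial.coeff_add, add_mul, Finset.sum_add_distrib] at *
    rw [hp, hq]
  | mul_X p i hp =>
    have h0 := polar_zero p P D
    simp only [polar] at *
    have e : restr (p * X i) P D = restr p P D * Polynomial.C (P i)
        + restr p P D * Polynomial.C (D i) * Polynomial.X := by
      simp only [restr, map_mul, aeval_X]; ring
    rw [e, Polynomial.coeff_add, Polynomial.coeff_mul_C, Polynomial.coeff_mul_X,
      Polynomial.coeff_mul_C, h0, hp]
    simp only [Derivation.leibniz, pderiv_X, smul_eq_mul, map_add, map_mul, aeval_X, add_mul,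
      Finset.sum_add_distrib, Finset.sum_mul]
    rw [add_comm]
    congr 1
    · rw [Finset.sum_eq_single i]
      · simp
      · intro b _ hb; simp [hb.symm]
      · simp
    · exact Finset.sum_congr rfl fun _ _ => by ring

lemma polar_smul_right (f : MvPolynomial (Fin 4) k) (j : ℕ) (P D : Fin 4 → R) (b : R) :
    polar f j P (b • D) = b ^ j * polar f j P D := by
  have : restr f P (b • D) = (restr f P D).comp (Polynomial.C b * Polynomial.X) := by
    have h : (((Polynomial.aeval (Polynomial.C b * Polynomial.X)).restrictScalars k).comp
        (aeval (fun a => Polynomial.C (P a) + Polynomial.X * Polynomial.C (D a)))) =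
        aeval (fun a => Polynomial.C (P a) + Polynomial.X * Polynomial.C ((b • D) a))
          (R := k) := by
      apply MvPolynomial.algHom_ext
      intro i
      simp [Polynomial.algebraMap_eq]
      ring
    rw [restr, ← h]
    simp [restr, Polynomial.comp, Polynomial.aeval_def, Polynomial.algebraMap_eq]
  rw [polar, this, Polynomial.comp_C_mul_X_coeff, polar, mul_comm]

lemma polar_smul_smul {f : MvPolynomial (Fin 4) k} {d : ℕ} (hf : f.IsHomogeneous d)
    (j : ℕ) (P D : Fin 4 → R) (a : R) :
    polar f j (a • P) (a • D) = a ^ d * polar f j P D := by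
  have : restr f (a • P) (a • D) = Polynomial.C (a ^ d) * restr f P D := by
    rw [restr, restr, Polynomial.C_pow, ← aeval_smul_of_isHomogeneous hf]
    congr 2
    funext i
    simp [mul_add]
    ring
  rw [polar, this, Polynomial.coeff_C_mul, polar]

lemma natDegree_restr_le {f : MvPolynomial (Fin 4) k} {d : ℕ} (hf : f.IsHomogeneous d)
    (P D : Fin 4 → R) : (restr f P D).natDegree ≤ d := by
  rw [restr, aeval_def, eval₂_eq']
  refine Polynomial.natDegree_sum_le_of_forall_le _ _ fun m hm => ?_
  have hm' := hf (mem_support_iff.mp hm)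
  have hs : ∑ i, m i = d := by
    rw [← hm', Finsupp.weight_apply, Finsupp.sum_fintype] <;> simp
  rw [IsScalarTower.algebraMap_apply k R (Polynomial R), Polynomial.algebraMap_eq]
  refine (Polynomial.natDegree_C_mul_le _ _).trans ((Polynomial.natDegree_prod_le _ _).trans ?_)
  rw [← hs]
  refine Finset.sum_le_sum fun i _ => ?_
  refine Polynomial.natDegree_pow_le.trans ?_
  have h1 : (Polynomial.C (P i) + Polynomial.X * Polynomial.C (D i)).natDegree ≤ 1 := by
    compute_degree
  nlinarith

lemma polar_smul_left {f : MvPolynomial (Fin 4) k} {d : ℕ} (hf : f.IsHomogeneous d)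
    {j : ℕ} (hj : j ≤ d) (P D : Fin 4 → R) (a : R) :
    polar f j (a • P) D = a ^ (d - j) * polar f j P D := by
  have gen : polar f j ((Polynomial.X : Polynomial R) • (Polynomial.C ∘ P)) (Polynomial.C ∘ D) =
      Polynomial.X ^ (d - j) * polar f j (Polynomial.C ∘ P) (Polynomial.C ∘ D) := by
    have h1 := polar_smul_smul hf j (Polynomial.C ∘ P) (Polynomial.C ∘ D)
      (Polynomial.X : Polynomial R)
    rw [polar_smul_right, ← Nat.add_sub_cancel' hj, pow_add, mul_assoc] at h1
    have := (Polynomial.isRegular_X_pow (R := R) j).left h1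
    simpa using this
  have := congrArg ((Polynomial.aeval a).restrictScalars k) gen
  rw [map_mul, map_polar, map_polar] at this
  convert this using 2
  · funext i
    simp
    exact mul_comm _ _
  · funext i; simp
  · simp
  · congr 1
    · funext i; simp
    · funext i; simp

lemma aeval_smul_add_smul {f : MvPolynomial (Fin 4) k} {d : ℕ} (hf : f.IsHomogeneous d)
    (P D : Fin 4 → R) (a b : R) :
    aeval (a • P + b • D) f = ∑ j ∈ Finset.range (d + 1), a ^ (d - j) * b ^ j * polar f j P D := by
  rw [← eval_restr, Polynomial.eval_eq_sum_range' (Nat.lt_succ_of_le (natDegree_restr_le hf _ _))]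
  refine Finset.sum_congr rfl fun j hj => ?_
  rw [← polar, polar_smul_left hf (Nat.lt_succ_iff.mp (Finset.mem_range.mp hj))]
  ring

lemma polar_swap {f : MvPolynomial (Fin 4) k} {d : ℕ} (hf : f.IsHomogeneous d) {j : ℕ}
    (hj : j ≤ d) (P D : Fin 4 → R) : polar f j P D = polar f (d - j) D P := by
  have h := aeval_smul_add_smul hf (Polynomial.C ∘ P) (Polynomial.C ∘ D) (Polynomial.X) 1
  have e : aeval ((Polynomial.X : Polynomial R) • (Polynomial.C ∘ P) +
      (1 : Polynomial R) • (Polynomial.C ∘ D)) f = restr f D P := by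
    rw [restr]
    congr 2
    funext i
    simp
    ring
  rw [e] at h
  have h2 : ∀ i, polar f i (Polynomial.C ∘ P) (Polynomial.C ∘ D) =
      Polynomial.C (polar f i P D) := fun i =>
    (map_polar f (Algebra.ofId R (Polynomial R) |>.restrictScalars k) i P D).symm
  rw [polar.eq_1 f (d - j), h, Polynomial.finsetSum_coeff]
  simp only [h2, one_pow, mul_one, Polynomial.coeff_mul_C, Polynomial.coeff_X_pow]
  rw [Finset.sum_eq_single j]
  · rw [if_pos rfl, one_mul]
  · intro b hb hbj
    rw [if_neg, zero_mul]
    have := Finset.mem_range.mp hb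
    omega
  · intro h; exact absurd (Finset.mem_range.mpr (by omega)) h

/-- Taylor expansion of the polar forms along `P`. -/
lemma polar_add_smul_self {f : MvPolynomial (Fin 4) k} {d : ℕ} (hf : f.IsHomogeneous d) {j : ℕ}
    (hj : j ≤ d) (P D : Fin 4 → R) (c : R) :
    polar f j P (D + c • P) =
      ∑ l ∈ Finset.range (j + 1), (d - l).choose (j - l) * c ^ (j - l) * polar f l P D := by
  have h := aeval_smul_add_smul hf (Polynomial.C ∘ P) (Polynomial.C ∘ D)
    (1 + Polynomial.X * Polynomial.C c) (Polynomial.X : Polynomial R)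
  have e : aeval ((1 + Polynomial.X * Polynomial.C c : Polynomial R) • (Polynomial.C ∘ P) +
      (Polynomial.X : Polynomial R) • (Polynomial.C ∘ D)) f = restr f P (D + c • P) := by
    rw [restr]
    congr 2
    funext i
    simp
    ring
  rw [e] at h
  have h2 : ∀ i, polar f i (Polynomial.C ∘ P) (Polynomial.C ∘ D) =
      Polynomial.C (polar f i P D) := fun i =>
    (map_polar f (Algebra.ofId R (Polynomial R) |>.restrictScalars k) i P D).symm
  rw [polar, h, Polynomial.finsetSum_coeff]
  have key : ∀ l ∈ Finset.range (d + 1), ((1 + Polynomial.X * Polynomial.C c) ^ (d - l) *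
      Polynomial.X ^ l * polar f l (Polynomial.C ∘ P) (Polynomial.C ∘ D)).coeff j =
      if l ≤ j then (d - l).choose (j - l) * c ^ (j - l) * polar f l P D else 0 := by
    intro l hl
    rw [h2, Polynomial.coeff_mul_C, Polynomial.coeff_mul_X_pow']
    split_ifs with hlj
    · have : (1 + Polynomial.X * Polynomial.C c : Polynomial R) ^ (d - l) =
          ((1 + Polynomial.X : Polynomial R) ^ (d - l)).comp (Polynomial.C c * Polynomial.X) := by
        simp
      rw [this, Polynomial.comp_C_mul_X_coeff, Polynomial.coeff_one_add_X_pow]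
    · simp
  rw [Finset.sum_congr rfl key, ← Finset.sum_filter]
  refine Finset.sum_congr ?_ fun _ _ => rfl
  ext l
  simp only [Finset.mem_filter, Finset.mem_range]
  omega

end Restriction

section Prime

variable {k : Type*} [Field k]

lemma three_le_height_ker_eval_zero :
    3 ≤ (RingHom.ker (eval (0 : Fin 4 → k))).height := by
  let φ : ℕ → MvPolynomial (Fin 4) k →ₐ[k] MvPolynomial (Fin 4) k := fun n =>
    aeval (fun i => if (i : ℕ) < n then 0 else X i)
  let Q : ℕ → Ideal (MvPolynomial (Fin 4) k) := fun n => RingHom.ker (φ n)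
  have hp : ∀ n, (Q n).IsPrime := fun n => RingHom.ker_isPrime _
  have hm : (RingHom.ker (eval (0 : Fin 4 → k))).IsPrime := RingHom.ker_isPrime _
  have hle : ∀ m n, m ≤ n → Q m ≤ Q n := by
    intro m n hmn g hg
    have : φ n = (φ n).comp (φ m) := by
      apply MvPolynomial.algHom_ext
      intro i
      simp only [φ, AlgHom.comp_apply, aeval_X]
      split_ifs with h1 h2
      · simp
      · simp [h1]
      · omega
      · simp [h1]
    change φ n g = 0
    have hg' : φ m g = 0 := hg
    rw [this, AlgHom.comp_apply, hg', map_zero]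
  have hlt : ∀ n : Fin 4, Q n < Q (n + 1) := by
    intro n
    refine lt_of_le_of_ne (hle _ _ (Nat.le_succ _)) fun h => ?_
    have h1 : (X n : MvPolynomial (Fin 4) k) ∈ Q (n + 1) := by
      change φ _ _ = 0
      simp [φ]
    rw [← h] at h1
    have h2 : φ n (X n) = 0 := h1
    simp [φ] at h2
  have hlast : Q 3 ≤ RingHom.ker (eval (0 : Fin 4 → k)) := by
    intro g hg
    have : (aeval (0 : Fin 4 → k) : _ →ₐ[k] k) = (aeval (0 : Fin 4 → k) : _ →ₐ[k] k).comp
        (φ 3) := by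
      apply MvPolynomial.algHom_ext
      intro i
      simp only [φ, AlgHom.comp_apply, aeval_X]
      split_ifs <;> simp
    have hg' : φ 3 g = 0 := hg
    change aeval (0 : Fin 4 → k) g = 0
    rw [this, AlgHom.comp_apply, hg', map_zero]
  have h1 := Ideal.height_add_one_le_of_lt_of_isPrime (hlt 0)
  have h2 := Ideal.height_add_one_le_of_lt_of_isPrime (hlt 1)
  have h3 := Ideal.height_add_one_le_of_lt_of_isPrime (hlt 2)
  have h4 : (Q 3).height ≤ (RingHom.ker (eval (0 : Fin 4 → k))).height :=
    Ideal.height_mono hlast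
  simp only [Fin.val_zero, Fin.val_one, Fin.val_two, zero_add, one_add_one_eq_two] at h1 h2 h3
  calc (3 : ℕ∞) = 0 + 1 + 1 + 1 := by norm_num
    _ ≤ (Q 0).height + 1 + 1 + 1 := by gcongr; exact zero_le
    _ ≤ _ := by
      refine le_trans ?_ h4
      refine le_trans ?_ h3
      gcongr
      refine le_trans ?_ h2
      gcongr

variable [IsAlgClosed k]

lemma exists_eval_eq_zero_of_not_isUnit {g : MvPolynomial (Fin 4) k} (hg : ¬ IsUnit g) :
    ∃ v, eval v g = 0 := by
  obtain ⟨M, hM, hgM⟩ := Ideal.exists_le_maximal (Ideal.span {g})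
    (by rwa [Ne, Ideal.span_singleton_eq_top])
  obtain ⟨v, hv⟩ := isMaximal_iff_eq_vanishingIdeal_singleton.mp hM
  refine ⟨v, ?_⟩
  have : g ∈ M := hgM (Ideal.mem_span_singleton_self g)
  rw [hv, mem_vanishingIdeal_singleton_iff] at this
  simpa [aeval_eq_eval] using this

lemma exists_common_zero {g h : MvPolynomial (Fin 4) k} (hg : eval 0 g = 0)
    (hh : eval 0 h = 0) : ∃ v, v ≠ 0 ∧ eval v g = 0 ∧ eval v h = 0 := by
  classical
  by_contra! hcon
  have hm : (RingHom.ker (eval (0 : Fin 4 → k))).IsPrime := RingHom.ker_isPrime _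
  have hle : Ideal.span (({g, h} : Finset (MvPolynomial (Fin 4) k)) : Set _) ≤
      RingHom.ker (eval (0 : Fin 4 → k)) := by
    rw [Ideal.span_le]
    intro x hx
    simp only [Finset.coe_insert, Finset.coe_singleton, Set.mem_insert_iff,
      Set.mem_singleton_iff] at hx
    rcases hx with rfl | rfl <;> assumption
  obtain ⟨Q, hQ, hQm⟩ := Ideal.exists_minimalPrimes_le hle
  have hht := Ideal.height_le_card_of_mem_minimalPrimes_span_finset hQ
  have hQp : Q.IsPrime := hQ.1.1
  have hgQ : ∀ x ∈ ({g, h} : Finset (MvPolynomial (Fin 4) k)), x ∈ Q := fun x hx =>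
    hQ.1.2 (Ideal.subset_span hx)
  have hQeq : RingHom.ker (eval (0 : Fin 4 → k)) ≤ Q := by
    rw [← IsPrime.vanishingIdeal_zeroLocus (K := k) Q]
    intro x hx
    rw [mem_vanishingIdeal_iff]
    intro v hv
    rw [mem_zeroLocus_iff] at hv
    by_cases hv0 : v = 0
    · subst hv0; simpa [aeval_eq_eval] using hx
    · exact absurd (by simpa [aeval_eq_eval] using hv h (hgQ h (by simp)))
        (hcon v hv0 (by simpa [aeval_eq_eval] using hv g (hgQ g (by simp))))
  have h3 := three_le_height_ker_eval_zero (k := k)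
  rw [le_antisymm hQeq hQm] at h3
  have h2 : (({g, h} : Finset (MvPolynomial (Fin 4) k)).card : ℕ∞) ≤ 2 := by
    exact_mod_cast Finset.card_le_two
  have := h3.trans (hht.trans h2)
  norm_num at this

variable {f : MvPolynomial (Fin 4) k} {d : ℕ}

omit [IsAlgClosed k] in
lemma IsSmooth.eval_zero (hf : IsSmoothSurface f d) (hd : d ≠ 0) : eval 0 f = 0 := by
  have := aeval_smul_of_isHomogeneous hf.2.1 (0 : k) (0 : Fin 4 → k)
  simpa [hd, aeval_eq_eval] using this

lemma eval_eq_zero_of_mul {g h : MvPolynomial (Fin 4) k} (hgh : (g * h).IsHomogeneous d)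
    (hg0 : eval 0 g ≠ 0) {v : Fin 4 → k} (hv : eval v g = 0) : eval v h = 0 := by
  have hz : restr g 0 v * restr h 0 v = 0 := by
    have : restr (g * h) 0 v = 0 := by
      apply Polynomial.funext
      intro t
      rw [eval_restr, zero_add, aeval_smul_of_isHomogeneous hgh]
      simp [aeval_eq_eval, hv]
    rw [← this, restr, restr, restr, map_mul]
  rcases mul_eq_zero.mp hz with h1 | h1
  · exfalso
    have := eval_restr g 0 (0 : Fin 4 → k) v
    rw [h1, aeval_eq_eval, zero_smul, add_zero, Polynomial.eval_zero] at this
    exact hg0 this.symm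
  · have := eval_restr h 1 (0 : Fin 4 → k) v
    rw [h1] at this
    simpa [aeval_eq_eval] using this.symm

lemma IsSmooth.prime (hf : IsSmoothSurface f d) (hd : d ≠ 0) : Prime f := by
  rw [← UniqueFactorizationMonoid.irreducible_iff_prime]
  refine ⟨fun hu => ?_, fun g h hgh => ?_⟩
  · have := hu.map (eval (0 : Fin 4 → k))
    rw [IsSmooth.eval_zero hf hd] at this
    exact not_isUnit_zero this
  · by_contra! hcon
    have hsing : ∃ v, v ≠ 0 ∧ eval v g = 0 ∧ eval v h = 0 := by
      have hhom : (g * h).IsHomogeneous d := hgh ▸ hf.2.1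
      by_cases hg0 : eval (0 : Fin 4 → k) g = 0
      · by_cases hh0 : eval (0 : Fin 4 → k) h = 0
        · exact exists_common_zero hg0 hh0
        · obtain ⟨v, hv⟩ := exists_eval_eq_zero_of_not_isUnit hcon.2
          refine ⟨v, ?_, eval_eq_zero_of_mul (mul_comm g h ▸ hhom) hh0 hv, hv⟩
          rintro rfl; exact hh0 hv
      · obtain ⟨v, hv⟩ := exists_eval_eq_zero_of_not_isUnit hcon.1
        refine ⟨v, ?_, hv, eval_eq_zero_of_mul hhom hg0 hv⟩
        rintro rfl; exact hg0 hv
    obtain ⟨v, hv0, hg, hh⟩ := hsing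
    refine hf.2.2 v hv0 ⟨by rw [hgh]; simp [hg], fun i => ?_⟩
    rw [hgh, Derivation.leibniz]
    simp [hg, hh]

lemma IsSmooth.dvd_of_forall_eval (hf : IsSmoothSurface f d) (hd : d ≠ 0)
    {g : MvPolynomial (Fin 4) k} (hg : ∀ v, eval v f = 0 → eval v g = 0) : f ∣ g := by
  have hp : (Ideal.span {f}).IsPrime :=
    (Ideal.span_singleton_prime hf.1).mpr (IsSmooth.prime hf hd)
  rw [← Ideal.mem_span_singleton, ← IsPrime.vanishingIdeal_zeroLocus (K := k) (Ideal.span {f}),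
    mem_vanishingIdeal_iff]
  intro v hv
  rw [mem_zeroLocus_iff] at hv
  have := hg v (by simpa [aeval_eq_eval] using hv f (Ideal.mem_span_singleton_self f))
  simpa [aeval_eq_eval] using this

end Prime

section Lines

variable {k : Type*} [Field k] {f : MvPolynomial (Fin 4) k} {d : ℕ}

lemma polar_one' (P D : Fin 4 → k) : polar f 1 P D = ∑ a, eval P (pderiv a f) * D a := by
  simp [polar_one, aeval_eq_eval]

lemma polar_zero' (P D : Fin 4 → k) : polar f 0 P D = eval P f := by
  simp [polar_zero, aeval_eq_eval]

lemma eval_smul' (hf : f.IsHomogeneous d) (c : k) (v : Fin 4 → k) :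
    eval (c • v) f = c ^ d * eval v f := by
  simpa [aeval_eq_eval] using aeval_smul_of_isHomogeneous hf c v

lemma eval_smul_add_smul (hf : f.IsHomogeneous d) (P D : Fin 4 → k) (a b : k) :
    eval (a • P + b • D) f =
      ∑ j ∈ Finset.range (d + 1), a ^ (d - j) * b ^ j * polar f j P D := by
  simpa [aeval_eq_eval] using aeval_smul_add_smul hf P D a b

lemma polar_one_self (hf : f.IsHomogeneous d) (P : Fin 4 → k) :
    polar f 1 P P = d * eval P f := by
  have := congrArg (eval P) hf.sum_X_mul_pderiv
  rw [polar_one']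
  simp only [map_sum, map_mul, eval_X, nsmul_eq_mul, map_natCast] at this
  rw [← this]
  exact Finset.sum_congr rfl fun _ _ => mul_comm _ _

lemma polar_one_add (P D E : Fin 4 → k) :
    polar f 1 P (D + E) = polar f 1 P D + polar f 1 P E := by
  simp [polar_one', mul_add, Finset.sum_add_distrib]

lemma polar_one_smul (P D : Fin 4 → k) (c : k) :
    polar f 1 P (c • D) = c * polar f 1 P D := by
  rw [polar_smul_right, pow_one]

lemma polar_one_sub (P D E : Fin 4 → k) :
    polar f 1 P (D - E) = polar f 1 P D - polar f 1 P E := by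
  simp [polar_one', mul_sub, Finset.sum_sub_distrib]

lemma restr_eq_zero [Infinite k] {P D : Fin 4 → k} (h : ∀ b : k, eval (P + b • D) f = 0) :
    restr f P D = 0 := by
  apply Polynomial.funext
  intro b
  rw [eval_restr, aeval_eq_eval]
  simp [h]

lemma IsLineOn.polar_eq_zero [Infinite k] {W : Submodule k (Fin 4 → k)} (hW : IsLineOn f W)
    {P D : Fin 4 → k} (hP : P ∈ W) (hD : D ∈ W) (j : ℕ) : polar f j P D = 0 := by
  rw [polar, restr_eq_zero fun b => hW.2 _ (W.add_mem hP (W.smul_mem b hD)), Polynomial.coeff_zero]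

lemma IsSmooth.exists_grad_ne (hf : IsSmoothSurface f d) {P : Fin 4 → k} (hP : P ≠ 0)
    (hfP : eval P f = 0) : ∃ a, eval P (pderiv a f) ≠ 0 := by
  by_contra! h
  exact hf.2.2 P hP ⟨hfP, h⟩

end Lines

section BinaryForms

variable {k : Type*} [Field k]

/-- The value at `(b, c)` of the binary form of degree `n` whose dehomogenization is `g`. -/
noncomputable def binEval (g : Polynomial k) (n : ℕ) (b c : k) : k :=
  ∑ j ∈ Finset.range (n + 1), g.coeff j * b ^ j * c ^ (n - j)

lemma binEval_of_ne_zero {g : Polynomial k} {n : ℕ} (hg : g.natDegree ≤ n) (b : k) {c : k}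
    (hc : c ≠ 0) : binEval g n b c = c ^ n * g.eval (b / c) := by
  rw [binEval, Polynomial.eval_eq_sum_range' (Nat.lt_succ_of_le hg), Finset.mul_sum]
  refine Finset.sum_congr rfl fun j hj => ?_
  have hj' : j ≤ n := Nat.lt_succ_iff.mp (Finset.mem_range.mp hj)
  rw [div_pow, ← Nat.sub_add_cancel hj', pow_add, Nat.sub_add_cancel hj']
  field_simp

lemma binEval_zero_right (g : Polynomial k) (n : ℕ) (b : k) :
    binEval g n b 0 = g.coeff n * b ^ n := by
  rw [binEval, Finset.sum_eq_single n]
  · simp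
  · intro j hj hjn
    have := Finset.mem_range.mp hj
    rw [zero_pow (by omega), mul_zero]
  · simp

lemma binEval_one_right {g : Polynomial k} {n : ℕ} (hg : g.natDegree ≤ n) (b : k) :
    binEval g n b 1 = g.eval b := by
  rw [binEval_of_ne_zero hg b one_ne_zero]; simp

lemma binEval_smul (g : Polynomial k) (n : ℕ) (t b c : k) :
    binEval g n (t * b) (t * c) = t ^ n * binEval g n b c := by
  rw [binEval, binEval, Finset.mul_sum]
  refine Finset.sum_congr rfl fun j hj => ?_
  have hj' : j ≤ n := Nat.lt_succ_iff.mp (Finset.mem_range.mp hj)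
  rw [mul_pow, mul_pow]
  have : t ^ n = t ^ j * t ^ (n - j) := by rw [← pow_add, Nat.add_sub_cancel' hj']
  rw [this]; ring

lemma natDegree_linear_mul_le (p q : k) {h : Polynomial k} {n : ℕ} (hh : h.natDegree ≤ n) :
    ((Polynomial.C p * Polynomial.X + Polynomial.C q) * h).natDegree ≤ n + 1 := by
  refine Polynomial.natDegree_mul_le.trans ?_
  have : (Polynomial.C p * Polynomial.X + Polynomial.C q).natDegree ≤ 1 := by compute_degree
  omega

lemma binEval_linear_mul (p q : k) {h : Polynomial k} {n : ℕ} (hh : h.natDegree ≤ n) (b c : k) :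
    binEval ((Polynomial.C p * Polynomial.X + Polynomial.C q) * h) (n + 1) b c =
      (b * p + c * q) * binEval h n b c := by
  by_cases hc : c = 0
  · subst hc
    rw [binEval_zero_right, binEval_zero_right, add_mul, mul_assoc, Polynomial.coeff_add,
      Polynomial.coeff_C_mul, Polynomial.coeff_X_mul, Polynomial.coeff_C_mul,
      Polynomial.coeff_eq_zero_of_natDegree_lt (Nat.lt_succ_of_le hh)]
    ring
  · rw [binEval_of_ne_zero (natDegree_linear_mul_le p q hh) b hc, binEval_of_ne_zero hh b hc]
    simp
    field_simp
    ring

lemma exists_linear_factors [IsAlgClosed k] (n : ℕ) (g : Polynomial k) (hg : g.natDegree ≤ n) :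
    ∃ (κ : k) (p q : Fin n → k), (∀ r, p r ≠ 0 ∨ q r ≠ 0) ∧
      g = Polynomial.C κ * ∏ r, (Polynomial.C (p r) * Polynomial.X + Polynomial.C (q r)) := by
  induction n generalizing g with
  | zero =>
    refine ⟨g.coeff 0, Fin.elim0, Fin.elim0, fun r => r.elim0, ?_⟩
    simpa using Polynomial.eq_C_of_natDegree_le_zero hg
  | succ n ih =>
    suffices h : ∃ (p₀ q₀ : k) (g' : Polynomial k), (p₀ ≠ 0 ∨ q₀ ≠ 0) ∧ g'.natDegree ≤ n ∧
        g = (Polynomial.C p₀ * Polynomial.X + Polynomial.C q₀) * g' by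
      obtain ⟨p₀, q₀, g', h0, hdeg, rfl⟩ := h
      obtain ⟨κ, p, q, hpq, rfl⟩ := ih g' hdeg
      refine ⟨κ, Fin.cons p₀ p, Fin.cons q₀ q, Fin.cases (by simpa using h0)
        (by simpa using hpq), ?_⟩
      simp only [Fin.prod_univ_succ, Fin.cons_zero, Fin.cons_succ]
      ring
    by_cases hdeg : g.natDegree ≤ n
    · exact ⟨0, 1, g, Or.inr one_ne_zero, hdeg, by simp⟩
    · have hne : g.degree ≠ 0 := by
        intro h
        have : g.natDegree = 0 := Polynomial.natDegree_eq_of_degree_eq_some h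
        omega
      obtain ⟨r, hr⟩ := IsAlgClosed.exists_root g hne
      obtain ⟨g', rfl⟩ := Polynomial.dvd_iff_isRoot.mpr hr
      have hg' : g' ≠ 0 := by rintro rfl; simp at hdeg
      refine ⟨1, -r, g', Or.inl one_ne_zero, ?_, by simp [sub_eq_add_neg]⟩
      rw [Polynomial.natDegree_mul (Polynomial.X_sub_C_ne_zero r) hg',
        Polynomial.natDegree_X_sub_C] at hg
      omega

lemma natDegree_prod_linear_le {n : ℕ} (κ : k) (p q : Fin n → k) :
    (Polynomial.C κ * ∏ r, (Polynomial.C (p r) * Polynomial.X + Polynomial.C (q r))).natDegree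
      ≤ n := by
  refine (Polynomial.natDegree_C_mul_le _ _).trans ((Polynomial.natDegree_prod_le _ _).trans ?_)
  refine (Finset.sum_le_sum (g := fun _ => 1) fun r _ => ?_).trans (by simp)
  compute_degree

lemma binEval_prod_linear {n : ℕ} (κ : k) (p q : Fin n → k) (b c : k) :
    binEval (Polynomial.C κ *
      ∏ r, (Polynomial.C (p r) * Polynomial.X + Polynomial.C (q r))) n b c =
      κ * ∏ r, (b * p r + c * q r) := by
  induction n with
  | zero => simp [binEval]
  | succ n ih =>
    rw [Fin.prod_univ_succ, mul_left_comm,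
      binEval_linear_mul _ _ (natDegree_prod_linear_le κ _ _), ih, Fin.prod_univ_succ]
    ring

lemma resultant_X_sub_C_mul (r : k) {F g : Polynomial k} {n m : ℕ} (hF : F.natDegree ≤ n)
    (hg : g.natDegree ≤ m) :
    Polynomial.resultant ((Polynomial.X - Polynomial.C r) * F) g (n + 1) m =
      g.eval r * Polynomial.resultant F g n m := by
  by_cases hF0 : F = 0
  · subst hF0
    rw [mul_zero, Polynomial.resultant_zero_left, Polynomial.resultant_zero_left]
    rcases Nat.eq_zero_or_pos m with rfl | hm
    · rw [Polynomial.eq_C_of_natDegree_le_zero hg]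
      simp [pow_succ']
    · simp [hm.ne']
  · obtain ⟨s, rfl⟩ := Nat.exists_eq_add_of_le hF
    have hdeg : ((Polynomial.X - Polynomial.C r) * F).natDegree = 1 + F.natDegree := by
      rw [Polynomial.natDegree_mul (Polynomial.X_sub_C_ne_zero r) hF0,
        Polynomial.natDegree_X_sub_C]
    rw [show F.natDegree + s + 1 = (1 + F.natDegree) + s by ring,
      Polynomial.resultant_add_left_deg _ _ _ _ _ hdeg.le,
      Polynomial.resultant_add_left_deg _ _ _ _ _ le_rfl]
    have := Polynomial.resultant_mul_left (Polynomial.X - Polynomial.C r) F g m hg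
    rw [Polynomial.natDegree_X_sub_C, Polynomial.resultant_X_sub_C_left _ _ _ hg] at this
    rw [this]; ring

lemma resultant_linear_mul (a b : k) {F g : Polynomial k} {n m : ℕ} (hF : F.natDegree ≤ n)
    (hg : g.natDegree ≤ m) :
    Polynomial.resultant ((Polynomial.C a * Polynomial.X + Polynomial.C b) * F) g (n + 1) m =
      binEval g m (-b) a * Polynomial.resultant F g n m := by
  by_cases ha : a = 0
  · subst ha
    rw [binEval_zero_right, map_zero, zero_mul, zero_add, Polynomial.resultant_C_mul_left,
      Polynomial.resultant_succ_left_deg _ _ _ _ hF, neg_pow]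
    ring
  · have : (Polynomial.C a * Polynomial.X + Polynomial.C b) * F =
        Polynomial.C a * ((Polynomial.X - Polynomial.C (-b / a)) * F) := by
      have : Polynomial.C b = Polynomial.C a * Polynomial.C (b / a) := by
        rw [← Polynomial.C_mul]; congr 1; field_simp
      rw [this, neg_div, Polynomial.C_neg]; ring
    rw [this, Polynomial.resultant_C_mul_left, resultant_X_sub_C_mul _ hF hg,
      binEval_of_ne_zero hg _ ha]
    ring

lemma resultant_prod_linear {n m : ℕ} (κ : k) (p q : Fin n → k) {g : Polynomial k}
    (hg : g.natDegree ≤ m) :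
    Polynomial.resultant (Polynomial.C κ *
      ∏ r, (Polynomial.C (p r) * Polynomial.X + Polynomial.C (q r))) g n m =
      κ ^ m * ∏ r, binEval g m (-q r) (p r) := by
  induction n with
  | zero => simp
  | succ n ih =>
    rw [Fin.prod_univ_succ, mul_left_comm,
      resultant_linear_mul _ _ (natDegree_prod_linear_le κ _ _) hg, ih, Fin.prod_univ_succ]
    ring

/-- Two binary forms with a common nontrivial zero have vanishing resultant. -/
lemma resultant_eq_zero_of_binEval [IsAlgClosed k] {F g : Polynomial k} {n m : ℕ} (hm : m ≠ 0)
    (hF : F.natDegree ≤ n) (hg : g.natDegree ≤ m) {b c : k} (hbc : b ≠ 0 ∨ c ≠ 0)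
    (h1 : binEval F n b c = 0) (h2 : binEval g m b c = 0) :
    Polynomial.resultant F g n m = 0 := by
  obtain ⟨κ, p, q, hpq, rfl⟩ := exists_linear_factors n F hF
  rw [resultant_prod_linear κ p q hg]
  rw [binEval_prod_linear, mul_eq_zero, Finset.prod_eq_zero_iff] at h1
  rcases h1 with h1 | ⟨r, -, hr⟩
  · simp [h1, hm]
  · refine mul_eq_zero_of_right _ (Finset.prod_eq_zero (Finset.mem_univ r) ?_)
    obtain ⟨t, ht1, ht2⟩ : ∃ t, -q r = t * b ∧ p r = t * c := by
      by_cases hb : b = 0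
      · have hc := hbc.resolve_left (not_not.mpr hb)
        refine ⟨p r / c, ?_, by field_simp⟩
        have : q r = 0 := by simpa [hb, hc] using hr
        simp [this, hb]
      · refine ⟨-q r / b, by field_simp, ?_⟩
        field_simp
        linear_combination hr
    rw [ht1, ht2, binEval_smul, h2, mul_zero]

end BinaryForms

section Planes

variable {k V : Type*} [Field k] [AddCommGroup V] [Module k V]

lemma exists_basis_of_finrank_eq_two {W : Submodule k V} (hW : Module.finrank k W = 2) :
    ∃ e₁ e₂ : V, LinearIndependent k ![e₁, e₂] ∧ W = Submodule.span k {e₁, e₂} := by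
  have : FiniteDimensional k W := Module.finite_of_finrank_eq_succ hW
  let b := Module.finBasisOfFinrankEq k W hW
  have hb : (W.subtype ∘ b) = ![(b 0 : V), (b 1 : V)] := by
    ext i; fin_cases i <;> rfl
  refine ⟨b 0, b 1, ?_, ?_⟩
  · rw [← hb]
    exact b.linearIndependent.map' _ (Submodule.ker_subtype W)
  · have := congrArg (Submodule.map W.subtype) b.span_eq
    rw [Submodule.map_span, ← Set.range_comp, hb, Submodule.map_top,
      Submodule.range_subtype] at this
    rw [Matrix.range_cons_cons_empty] at this
    exact this.symm

lemma finrank_span_pair {e₁ e₂ : V} (h : LinearIndependent k ![e₁, e₂]) :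
    Module.finrank k (Submodule.span k {e₁, e₂}) = 2 := by
  have := finrank_span_eq_card h
  rwa [Matrix.range_cons_cons_empty, Fintype.card_fin] at this

lemma eq_span_pair {W : Submodule k V} (hW : Module.finrank k W = 2) {e₁ e₂ : V}
    (h : LinearIndependent k ![e₁, e₂]) (h₁ : e₁ ∈ W) (h₂ : e₂ ∈ W) :
    W = Submodule.span k {e₁, e₂} := by
  have : FiniteDimensional k W := Module.finite_of_finrank_eq_succ hW
  refine (Submodule.eq_of_le_of_finrank_eq ?_ ?_).symm
  · rw [Submodule.span_le]
    rintro _ (rfl | rfl) <;> assumption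
  · rw [hW, finrank_span_pair h]

lemma eq_of_mem_of_mem {W W' : Submodule k V} (hW : Module.finrank k W = 2)
    (hW' : Module.finrank k W' = 2) {e₁ e₂ : V} (h : LinearIndependent k ![e₁, e₂])
    (h₁ : e₁ ∈ W) (h₂ : e₂ ∈ W) (h₁' : e₁ ∈ W') (h₂' : e₂ ∈ W') : W = W' := by
  rw [eq_span_pair hW h h₁ h₂, eq_span_pair hW' h h₁' h₂']

lemma linearIndependent_pair_of_det {e₁ e₂ : V} (h : LinearIndependent k ![e₁, e₂])
    {a b c d : k} (hdet : a * d - b * c ≠ 0) :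
    LinearIndependent k ![a • e₁ + b • e₂, c • e₁ + d • e₂] := by
  rw [LinearIndependent.pair_iff] at h ⊢
  intro s t hst
  obtain ⟨h1, h2⟩ := h (s * a + t * c) (s * b + t * d) (by rw [← hst]; module)
  constructor
  · refine (mul_eq_zero.mp ?_).resolve_right hdet
    linear_combination d * h1 - c * h2
  · refine (mul_eq_zero.mp ?_).resolve_right hdet
    linear_combination a * h2 - b * h1

end Planes

section Counting

variable {k : Type*} [Field k]

lemma finrank_homogeneousSubmodule (m : ℕ) :
    Module.finrank k (homogeneousSubmodule (Fin 4) k m) = (m + 3).choose 3 := by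
  classical
  let A := (Finset.univ : Finset (Fin 4)).finsuppAntidiag m
  have hA : ∀ s, s ∈ A ↔ s.degree = m := by
    intro s
    simp [A, Finsupp.degree_eq_sum]
  have hli : LinearIndependent k fun s : A => (monomial (s : Fin 4 →₀ ℕ) (1 : k)) := by
    have := (basisMonomials (Fin 4) k).linearIndependent.comp
      (fun s : A => (s : Fin 4 →₀ ℕ)) Subtype.val_injective
    simpa [Function.comp_def] using this
  have hspan : Submodule.span k (Set.range fun s : A => (monomial (s : Fin 4 →₀ ℕ) (1 : k))) =
      homogeneousSubmodule (Fin 4) k m := by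
    apply le_antisymm
    · rw [Submodule.span_le]
      rintro _ ⟨s, rfl⟩
      exact isHomogeneous_monomial 1 ((hA s).mp s.2)
    · intro p hp
      rw [p.as_sum]
      refine Submodule.sum_mem _ fun s hs => ?_
      have hs' : s ∈ A := by
        rw [hA]
        by_contra h
        exact mem_support_iff.mp hs (IsHomogeneous.coeff_eq_zero hp h)
      rw [show monomial s (coeff s p) = coeff s p • monomial s (1 : k) by
        rw [smul_monomial, smul_eq_mul, mul_one]]
      exact Submodule.smul_mem _ _ (Submodule.subset_span ⟨⟨s, hs'⟩, rfl⟩)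
  rw [← hspan, finrank_span_eq_card hli, Fintype.card_coe,
    Finset.card_finsuppAntidiag_nat_eq_choose, Finset.card_univ, Fintype.card_fin,
    show 4 + m - 1 = m + 3 by omega, ← Nat.choose_symm (by omega)]
  congr 1; omega

instance (m : ℕ) : FiniteDimensional k (homogeneousSubmodule (Fin 4) k m) :=
  Module.Finite.iff_fg.mpr (homogeneousSubmodule_fg (Fin 4) k m)

lemma homogeneousComponent_mul_of_isHomogeneous {f : MvPolynomial (Fin 4) k} {d : ℕ}
    (hf : f.IsHomogeneous d) (p : MvPolynomial (Fin 4) k) (j : ℕ) :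
    homogeneousComponent (d + j) (f * p) = f * homogeneousComponent j p := by
  conv_lhs => rw [← sum_homogeneousComponent p, Finset.mul_sum, map_sum]
  by_cases hj : j ∈ Finset.range (p.totalDegree + 1)
  · rw [Finset.sum_eq_single j]
    · exact homogeneousComponent_eq_self (hf.mul (homogeneousComponent_isHomogeneous j p))
    · intro i hi hij
      rw [homogeneousComponent_of_mem (m := d + j) (n := d + i)
        (hf.mul (homogeneousComponent_isHomogeneous i p)), if_neg (by omega)]
    · intro h; exact absurd hj h
  · rw [homogeneousComponent_eq_zero _ p (by simpa using hj), mul_zero]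
    refine Finset.sum_eq_zero fun i hi => ?_
    rw [homogeneousComponent_of_mem (m := d + j) (n := d + i)
        (hf.mul (homogeneousComponent_isHomogeneous i p)), if_neg]
    rintro h
    exact hj (by rwa [show j = i by omega])

lemma exists_isHomogeneous_of_dvd {f g : MvPolynomial (Fin 4) k} {d m : ℕ}
    (hf : f.IsHomogeneous d) (hg : g.IsHomogeneous (d + m)) (h : f ∣ g) :
    ∃ c : MvPolynomial (Fin 4) k, c.IsHomogeneous m ∧ g = f * c := by
  obtain ⟨c, rfl⟩ := h
  refine ⟨homogeneousComponent m c, homogeneousComponent_isHomogeneous m c, ?_⟩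
  rw [← homogeneousComponent_mul_of_isHomogeneous hf, homogeneousComponent_eq_self hg]

lemma dvd_homogeneousComponent {f g : MvPolynomial (Fin 4) k} {d : ℕ}
    (hf : f.IsHomogeneous d) (h : f ∣ g) (j : ℕ) : f ∣ homogeneousComponent j g := by
  obtain ⟨c, rfl⟩ := h
  by_cases hj : d ≤ j
  · obtain ⟨i, rfl⟩ := Nat.exists_eq_add_of_le hj
    rw [homogeneousComponent_mul_of_isHomogeneous hf]
    exact dvd_mul_right _ _
  · convert dvd_zero f
    conv_lhs => rw [← sum_homogeneousComponent c, Finset.mul_sum, map_sum]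
    refine Finset.sum_eq_zero fun i hi => ?_
    rw [homogeneousComponent_of_mem (m := j) (n := d + i)
        (hf.mul (homogeneousComponent_isHomogeneous i c)), if_neg (by omega)]

/-- An ideal whose only possible zero is the origin contains all forms of large degree. -/
lemma exists_forall_isHomogeneous_mem [IsAlgClosed k] (J : Ideal (MvPolynomial (Fin 4) k))
    (hJ : ∀ v ≠ 0, ∃ g ∈ J, eval v g ≠ 0) :
    ∃ M : ℕ, ∀ m ≥ M, ∀ g : MvPolynomial (Fin 4) k, g.IsHomogeneous m → g ∈ J := by
  have hle : idealOfVars (Fin 4) k ≤ J.radical := by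
    rw [← vanishingIdeal_zeroLocus_eq_radical (K := k) J, idealOfVars, Ideal.span_le]
    rintro _ ⟨a, rfl⟩
    rw [SetLike.mem_coe, mem_vanishingIdeal_iff]
    intro v hv
    by_cases h0 : v = 0
    · simp [h0]
    · obtain ⟨g, hg, hgv⟩ := hJ v h0
      rw [mem_zeroLocus_iff] at hv
      exact absurd (by simpa [aeval_eq_eval] using hv g hg) hgv
  obtain ⟨M, hM⟩ := Ideal.exists_pow_le_of_le_radical_of_fg hle (idealOfVars_fg _ _)
  refine ⟨M, fun m hm g hg => hM ?_⟩
  rw [mem_pow_idealOfVars_iff]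
  intro s hs
  by_contra h
  exact mem_support_iff.mp hs (hg.coeff_eq_zero (by omega))

lemma exists_linear_form {U : Submodule k (Fin 4 → k)} {v : Fin 4 → k} (hv : v ∉ U) :
    ∃ l : MvPolynomial (Fin 4) k, l.IsHomogeneous 1 ∧ eval v l ≠ 0 ∧ ∀ u ∈ U, eval u l = 0 := by
  obtain ⟨φ, hφ, hU⟩ := Submodule.exists_le_ker_of_notMem hv
  have key : ∀ u, eval u (∑ i, C (φ (Pi.single i 1)) * X i : MvPolynomial (Fin 4) k) = φ u := by
    intro u
    conv_rhs => rw [← Finset.univ_sum_single u, map_sum]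
    rw [map_sum]
    refine Finset.sum_congr rfl fun i _ => ?_
    rw [map_mul, eval_C, eval_X, mul_comm, ← smul_eq_mul, ← map_smul]
    congr 1
    ext j
    by_cases h : j = i
    · subst h; simp
    · simp [h]
  refine ⟨∑ i, C (φ (Pi.single i 1)) * X i,
    IsHomogeneous.sum _ _ _ fun i _ => isHomogeneous_C_mul_X _ i, ?_, ?_⟩
  · rwa [key]
  · intro u hu
    rw [key]
    exact hU hu

/-- Enough points in general position on each member of a finite set of lines. -/
lemma exists_points [Infinite k] (L : Finset (Submodule k (Fin 4 → k)))
    (hL : ∀ W ∈ L, Module.finrank k W = 2) (t : ℕ) (W : L) :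
    ∃ pt : Fin t → (Fin 4 → k), (∀ r, pt r ∈ W.1) ∧ (∀ r, ∀ W' ∈ L, W' ≠ W.1 → pt r ∉ W') ∧
      ∀ r r', r ≠ r' → pt r ∉ k ∙ pt r' := by
  obtain ⟨e₁, e₂, hli, hW⟩ := exists_basis_of_finrank_eq_two (hL W.1 W.2)
  have hind : ∀ z z' : k, z ≠ z' → LinearIndependent k ![e₁ + z • e₂, e₁ + z' • e₂] := by
    intro z z' hne
    simpa using linearIndependent_pair_of_det hli (a := 1) (b := z) (c := 1) (d := z')
      (by simpa [sub_eq_zero] using hne.symm)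
  have hmem : ∀ z : k, e₁ + z • e₂ ∈ W.1 := by
    intro z
    rw [hW]
    exact Submodule.add_mem _ (Submodule.subset_span (by simp))
      (Submodule.smul_mem _ _ (Submodule.subset_span (by simp)))
  let bad : Set k := ⋃ W' ∈ (L.erase W.1 : Finset _), {z | e₁ + z • e₂ ∈ W'}
  have hbad : bad.Finite := by
    refine Set.Finite.biUnion (Finset.finite_toSet _) fun W' hW' => ?_
    refine Set.Subsingleton.finite fun z hz z' hz' => ?_
    by_contra hne
    obtain ⟨h1, h2⟩ := Finset.mem_erase.mp hW'
    exact h1 (eq_of_mem_of_mem (hL _ h2) (hL _ W.2) (hind z z' hne) hz hz' (hmem z) (hmem z'))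
  obtain ⟨S, hS⟩ := Set.Infinite.exists_subset_card_eq hbad.infinite_compl t
  let z : Fin t → k := fun r => (S.equivFinOfCardEq hS.2).symm r
  have hz : ∀ r, z r ∉ bad := fun r => hS.1 (Subtype.coe_prop _)
  have hz_inj : Function.Injective z :=
    Subtype.val_injective.comp (Equiv.injective _)
  refine ⟨fun r => e₁ + z r • e₂, fun r => hmem _, fun r W' hW' hne hmem => hz r ?_, ?_⟩
  · simp only [bad, Set.mem_iUnion]
    exact ⟨W', Finset.mem_erase.mpr ⟨hne, hW'⟩, hmem⟩
  · intro r r' hrr hmem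
    obtain ⟨c, hc⟩ := Submodule.mem_span_singleton.mp hmem
    have := LinearIndependent.pair_iff.mp (hind _ _ fun h => hrr (hz_inj h)) 1 (-c)
      (by rw [← show _ = e₁ + z r • e₂ from hc]; module)
    exact one_ne_zero this.1

lemma finrank_vanishing [Infinite k] (L : Finset (Submodule k (Fin 4 → k)))
    (hL : ∀ W ∈ L, Module.finrank k W = 2) (t m : ℕ) (ht : m + 2 = L.card + t) (ht0 : t ≠ 0)
    (I : Submodule k (homogeneousSubmodule (Fin 4) k m))
    (hI : ∀ g ∈ I, ∀ W ∈ L, ∀ v ∈ W, eval v g.1 = 0) :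
    Module.finrank k I + L.card * t ≤ (m + 3).choose 3 := by
  classical
  choose pt hpt1 hpt2 hpt3 using exists_points L hL t
  let ev : homogeneousSubmodule (Fin 4) k m →ₗ[k] (L × Fin t → k) :=
    LinearMap.pi fun p => ((MvPolynomial.aeval (pt p.1 p.2)).toLinearMap).comp
      (Submodule.subtype _)
  have hev : ∀ g p, ev g p = eval (pt p.1 p.2) g.1 := by
    intro g p; simp [ev, aeval_eq_eval]
  have hsep : ∀ p : L × Fin t, ∃ g, ev g p ≠ 0 ∧ ∀ p', p' ≠ p → ev g p' = 0 := by
    rintro ⟨W, r⟩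
    choose! l hl1 hl2 hl3 using fun (W' : Submodule k (Fin 4 → k))
      (h : W' ∈ L.erase W.1) => exists_linear_form
        (hpt2 W r W' (Finset.mem_of_mem_erase h) (Finset.ne_of_mem_erase h))
    choose! l' hl1' hl2' hl3' using fun (r' : Fin t)
      (h : r' ∈ Finset.univ.erase r) => exists_linear_form
        (hpt3 W r r' (Finset.ne_of_mem_erase h).symm)
    have hhom : ((∏ W' ∈ L.erase W.1, l W') * ∏ r' ∈ Finset.univ.erase r, l' r').IsHomogeneous m := by
      have h1 := IsHomogeneous.prod (L.erase W.1) l (fun _ => 1) hl1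
      have h2 := IsHomogeneous.prod (Finset.univ.erase r) l' (fun _ => 1) hl1'
      convert h1.mul h2 using 1
      have := Finset.card_pos.mpr ⟨W.1, W.2⟩
      simp only [Finset.sum_const, smul_eq_mul, mul_one]
      rw [Finset.card_erase_of_mem W.2, Finset.card_erase_of_mem (Finset.mem_univ _),
        Finset.card_univ, Fintype.card_fin]
      omega
    refine ⟨⟨_, hhom⟩, ?_, ?_⟩
    · rw [hev]
      simp only [map_mul, map_prod]
      refine mul_ne_zero (Finset.prod_ne_zero_iff.mpr hl2) (Finset.prod_ne_zero_iff.mpr hl2')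
    · rintro ⟨W', r'⟩ hne
      rw [hev]
      simp only [map_mul, map_prod]
      by_cases hW : W' = W
      · subst hW
        have hr : r' ∈ Finset.univ.erase r :=
          Finset.mem_erase.mpr ⟨fun h => hne (by rw [h]), Finset.mem_univ _⟩
        exact mul_eq_zero_of_right _ (Finset.prod_eq_zero hr
          (hl3' r' hr _ (Submodule.mem_span_singleton_self _)))
      · have hW' : W'.1 ∈ L.erase W.1 :=
          Finset.mem_erase.mpr ⟨fun h => hW (Subtype.ext h), W'.2⟩
        exact mul_eq_zero_of_left (Finset.prod_eq_zero hW' (hl3 _ hW' _ (hpt1 _ _))) _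
  have hrange : LinearMap.range ev = ⊤ := by
    rw [eq_top_iff, ← (Pi.basisFun k (L × Fin t)).span_eq, Submodule.span_le]
    rintro _ ⟨p, rfl⟩
    obtain ⟨g, hg, hg'⟩ := hsep p
    refine ⟨(ev g p)⁻¹ • g, ?_⟩
    ext p'
    by_cases h : p' = p
    · subst h; simp [hg]
    · simp [h, hg' p' h]
  have h1 := LinearMap.finrank_range_add_finrank_ker ev
  rw [hrange, finrank_top, Module.finrank_fintype_fun_eq_card, Fintype.card_prod,
    Fintype.card_coe, Fintype.card_fin, finrank_homogeneousSubmodule] at h1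
  have h2 : I ≤ LinearMap.ker ev := by
    intro g hg
    rw [LinearMap.mem_ker]
    ext p
    rw [hev]
    exact hI g hg _ p.1.2 _ (hpt1 _ _)
  have := Submodule.finrank_mono h2
  omega

/-- The forms of degree `m` divisible by `f`. -/
def divisibleForms (f : MvPolynomial (Fin 4) k) (m : ℕ) :
    Submodule k (homogeneousSubmodule (Fin 4) k m) where
  carrier := {g | f ∣ g.1}
  add_mem' := fun ha hb => dvd_add ha hb
  zero_mem' := dvd_zero f
  smul_mem' := fun c g hg => by
    obtain ⟨q, hq⟩ := hg
    exact ⟨c • q, by simp [hq]⟩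

lemma finrank_divisibleForms {f : MvPolynomial (Fin 4) k} {d : ℕ} (hf : f.IsHomogeneous d)
    (hf0 : f ≠ 0) (j : ℕ) :
    Module.finrank k (divisibleForms f (d + j)) = (j + 3).choose 3 := by
  let φ : homogeneousSubmodule (Fin 4) k j →ₗ[k] divisibleForms f (d + j) :=
    { toFun := fun g => ⟨⟨f * g.1, hf.mul g.2⟩, dvd_mul_right _ _⟩
      map_add' := fun g h => by
        apply Subtype.ext; apply Subtype.ext
        exact mul_add _ _ _
      map_smul' := fun c g => by
        apply Subtype.ext; apply Subtype.ext
        exact mul_smul_comm _ _ _ }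
  have hφ : Function.Bijective φ := by
    constructor
    · intro g h hgh
      have := congrArg (fun x : divisibleForms f (d + j) => x.1.1) hgh
      exact Subtype.ext (mul_left_cancel₀ hf0 this)
    · rintro ⟨⟨g, hg⟩, hdvd⟩
      obtain ⟨c, hc, rfl⟩ := exists_isHomogeneous_of_dvd hf hg hdvd
      exact ⟨⟨c, hc⟩, rfl⟩
  rw [← (LinearEquiv.ofBijective φ hφ).finrank_eq, finrank_homogeneousSubmodule]

lemma six_mul_choose (j : ℕ) :
    (6 : ℤ) * ((j + 3).choose 3 : ℕ) = (j + 1) * (j + 2) * (j + 3) := by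
  have := Nat.ascFactorial_eq_factorial_mul_choose j 3
  simp [Nat.ascFactorial, Nat.factorial] at this
  zify at this
  rw [← this]; ring

lemma le_mul_of_forall_choose {N d n M : ℕ}
    (h : ∀ j t, M ≤ j → j + d + n + 2 = N + t → t ≠ 0 →
      (j + d + 3).choose 3 + (j + n + 3).choose 3 + N * t ≤
        (j + d + n + 3).choose 3 + (j + 3).choose 3) : N ≤ d * n := by
  by_contra! hlt
  let Q : ℕ := M + N + 6 * N * N + d * n * (d + n + 4)
  have hNQ : N ≤ Q := by
    rw [show Q = N + (M + 6 * N * N + d * n * (d + n + 4)) by simp only [Q]; ring]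
    exact Nat.le_add_right _ _
  have hMQ : M ≤ Q := by
    rw [show Q = M + (N + 6 * N * N + d * n * (d + n + 4)) by simp only [Q]; ring]
    exact Nat.le_add_right _ _
  have := h Q (Q + d + n + 2 - N) hMQ (by omega) (by omega)
  zify [show N ≤ Q + d + n + 2 by omega] at this
  have h1 := six_mul_choose (Q + d)
  have h2 := six_mul_choose (Q + n)
  have h3 := six_mul_choose (Q + d + n)
  have h4 := six_mul_choose Q
  push_cast at h1 h2 h3 h4
  have h5 : (N : ℤ) * (Q + d + n + 2 - N) * 6 ≤ 3 * d * n * (2 * Q + d + n + 4) := by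
    nlinarith
  have hQ : (Q : ℤ) = M + N + 6 * N * N + d * n * (d + n + 4) := by
    simp [Q]
  have h6 : (d : ℤ) * n + 1 ≤ N := by exact_mod_cast hlt
  have h7 : ((d : ℤ) * n + 1) * (6 * Q) ≤ N * (6 * Q) := by gcongr
  have h8 : (0 : ℤ) ≤ N * (d + n + 2) := by positivity
  have h9 : (0 : ℤ) ≤ d * n * (d + n + 4) := by positivity
  nlinarith

/-- If a section of degree `n` of a surface of degree `d`, given by the local quotients
`G t / U t`, vanishes on a finite set of lines of the surface, there are at most `d * n` lines. -/
theorem card_lines_le_of_section [IsAlgClosed k] {f : MvPolynomial (Fin 4) k} {d : ℕ}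
    (hd : d ≠ 0) (hf : Prime f) (hfd : f.IsHomogeneous d) {ι : Type*}
    (U G : ι → MvPolynomial (Fin 4) k)
    {a n : ℕ} (hU : ∀ t, (U t).IsHomogeneous a) (hG : ∀ t, (G t).IsHomogeneous (a + n))
    (hcomp : ∀ s t, f ∣ G t * U s - U t * G s)
    (hU0 : ∀ v ≠ 0, eval v f = 0 → ∃ t, eval v (U t) ≠ 0) {t₀ : ι} (hG0 : ¬ f ∣ G t₀)
    (L : Finset (Submodule k (Fin 4 → k))) (hL : ∀ W ∈ L, IsLineOn f W)
    (hvan : ∀ W ∈ L, ∀ v ∈ W, ∀ t, eval v (U t) ≠ 0 → eval v (G t) = 0) :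
    L.card ≤ d * n := by
  classical
  obtain rfl | ⟨W₀, hW₀⟩ := L.eq_empty_or_nonempty
  · simp
  obtain ⟨t₁, ht₁⟩ : ∃ t, ¬ f ∣ U t := by
    obtain ⟨e₁, e₂, hli, hW⟩ := exists_basis_of_finrank_eq_two (hL W₀ hW₀).1
    have he : e₁ ∈ W₀ := by rw [hW]; exact Submodule.subset_span (by simp)
    have hz := (hL W₀ hW₀).2 e₁ he
    obtain ⟨t, ht⟩ := hU0 e₁ (by simpa using hli.ne_zero 0) hz
    refine ⟨t, fun ⟨c, hc⟩ => ht ?_⟩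
    rw [hc, map_mul, hz, zero_mul]
  let J : Ideal (MvPolynomial (Fin 4) k) :=
    { carrier := {g | ∃ h, ∀ s, f ∣ h * U s - g * G s}
      add_mem' := fun {x y} ⟨h, hh⟩ ⟨h', hh'⟩ =>
        ⟨h + h', fun s => by convert dvd_add (hh s) (hh' s) using 1; ring⟩
      zero_mem' := ⟨0, fun s => by simp⟩
      smul_mem' := fun c x ⟨h, hh⟩ =>
        ⟨c * h, fun s => by convert dvd_mul_of_dvd_right (hh s) c using 1; simp; ring⟩ }
  have hUJ : ∀ t, U t ∈ J := fun t => ⟨G t, fun s => hcomp s t⟩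
  have hfJ : f ∈ J := ⟨0, fun s => ⟨-G s, by ring⟩⟩
  obtain ⟨M, hM⟩ := exists_forall_isHomogeneous_mem J fun v hv => by
    by_cases h : eval v f = 0
    · obtain ⟨t, ht⟩ := hU0 v hv h
      exact ⟨_, hUJ t, ht⟩
    · exact ⟨f, hfJ, h⟩
  refine le_mul_of_forall_choose (M := M) fun j t hj ht ht0 => ?_
  let V : Submodule k (homogeneousSubmodule (Fin 4) k (d + j) ×
      homogeneousSubmodule (Fin 4) k (d + (j + n))) :=
    { carrier := {p | ∀ s, f ∣ p.2.1 * U s - p.1.1 * G s}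
      add_mem' := fun {x y} hx hy s => by
        convert dvd_add (hx s) (hy s) using 1; simp; ring
      zero_mem' := fun s => by simp
      smul_mem' := fun c x hx s => by
        convert dvd_mul_of_dvd_right (hx s) (C c) using 1; simp [smul_eq_C_mul]; ring }
  let p₁ : V →ₗ[k] homogeneousSubmodule (Fin 4) k (d + j) := (LinearMap.fst k _ _).comp V.subtype
  let p₂ : V →ₗ[k] homogeneousSubmodule (Fin 4) k (d + (j + n)) :=
    (LinearMap.snd k _ _).comp V.subtype
  have h1 := LinearMap.finrank_range_add_finrank_ker (K := k) (V := V) p₁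
  have h2 := LinearMap.finrank_range_add_finrank_ker (K := k) (V := V) p₂
  have hr1 : LinearMap.range p₁ = ⊤ := by
    rw [LinearMap.range_eq_top]
    intro g
    obtain ⟨h, hh⟩ := hM (d + j) (by omega) g.1 g.2
    refine ⟨⟨(g, ⟨homogeneousComponent (d + (j + n)) h,
      homogeneousComponent_isHomogeneous _ _⟩), fun s => ?_⟩, rfl⟩
    have := dvd_homogeneousComponent hfd (hh s) (a + (d + (j + n)))
    rw [map_sub, mul_comm h, homogeneousComponent_mul_of_isHomogeneous (hU s),
      homogeneousComponent_eq_self (p := g.1 * G s)] at this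
    · convert this using 1
      simp only; ring
    · convert IsHomogeneous.mul g.2 (hG s) using 1
      ring
  have hr2 : Module.finrank k (LinearMap.range p₂) + L.card * t ≤ (d + (j + n) + 3).choose 3 := by
    refine finrank_vanishing L (fun W hW => (hL W hW).1) t _ (by omega) ht0 _ ?_
    rintro _ ⟨⟨⟨g, h⟩, hgh⟩, rfl⟩ W hW v hv
    change eval v h.1 = 0
    by_cases hv0 : v = 0
    · rw [hv0]
      have := eval_smul' h.2 (0 : k) v
      rw [zero_smul, zero_pow (by omega), zero_mul] at this
      exact this
    have hfv := (hL W hW).2 v hv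
    obtain ⟨s, hs⟩ := hU0 v hv0 hfv
    obtain ⟨c, hc⟩ := hgh s
    have := congrArg (eval v) hc
    simp only [map_sub, map_mul, hfv, hvan W hW v hv s hs, zero_mul, mul_zero, sub_zero] at this
    exact (mul_eq_zero.mp this).resolve_right hs
  have hk1 : ((j + n) + 3).choose 3 ≤ Module.finrank k (LinearMap.ker p₁) := by
    rw [← finrank_divisibleForms hfd hf.ne_zero]
    let φ : divisibleForms f (d + (j + n)) →ₗ[k] LinearMap.ker p₁ :=
      { toFun := fun h => ⟨⟨(0, h.1), fun s => by
            simpa using dvd_mul_of_dvd_left h.2 (U s)⟩, rfl⟩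
        map_add' := fun x y => by
          apply Subtype.ext; apply Subtype.ext; simp
        map_smul' := fun c x => by
          apply Subtype.ext; apply Subtype.ext; simp }
    refine LinearMap.finrank_le_finrank_of_injective (f := φ) fun x y hxy => ?_
    exact Subtype.ext (congrArg (fun z : LinearMap.ker p₁ => z.1.1.2) hxy)
  have hk2 : Module.finrank k (LinearMap.ker p₂) ≤ (j + 3).choose 3 := by
    rw [← finrank_divisibleForms hfd hf.ne_zero]
    have hz : ∀ x : LinearMap.ker p₂, f ∣ x.1.1.1.1 := by
      rintro ⟨⟨⟨g, h⟩, hgh⟩, hx⟩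
      have hh : h = 0 := hx
      subst hh
      have := hgh t₀
      simp only [ZeroMemClass.coe_zero, zero_mul, zero_sub, dvd_neg] at this
      exact (hf.dvd_or_dvd this).resolve_right hG0
    let φ : LinearMap.ker p₂ →ₗ[k] divisibleForms f (d + j) :=
      LinearMap.codRestrict _ (p₁.comp (LinearMap.ker p₂).subtype) hz
    refine LinearMap.finrank_le_finrank_of_injective (f := φ) fun x y hxy => ?_
    apply Subtype.ext; apply Subtype.ext
    refine Prod.ext (congrArg Subtype.val hxy) ?_
    exact (show x.1.1.2 = 0 from x.2).trans (show y.1.1.2 = 0 from y.2).symm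
  rw [hr1, finrank_top, finrank_homogeneousSubmodule] at h1
  rw [show j + d + 3 = d + j + 3 by ring, show j + d + n + 3 = d + (j + n) + 3 by ring]
  omega

end Counting

section Scaling

variable {k σ : Type*} [Field k] [Infinite k] [Fintype σ]

lemma isHomogeneous_of_eval_smul {p : MvPolynomial σ k} {n : ℕ}
    (h : ∀ (c : k) (v : σ → k), eval (c • v) p = c ^ n * eval v p) : p.IsHomogeneous n := by
  have hcomp : ∀ j, j ≠ n → homogeneousComponent j p = 0 := by
    intro j hj
    apply MvPolynomial.funext
    intro v
    rw [map_zero]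
    have hpoly : ∑ l ∈ Finset.range (p.totalDegree + 1),
        Polynomial.C (eval v (homogeneousComponent l p)) * Polynomial.X ^ l =
        Polynomial.C (eval v p) * Polynomial.X ^ n := by
      apply Polynomial.funext
      intro c
      have h1 := h c v
      conv_lhs at h1 => rw [← sum_homogeneousComponent p, map_sum]
      simp only [Polynomial.eval_finsetSum, Polynomial.eval_mul, Polynomial.eval_C,
        Polynomial.eval_pow, Polynomial.eval_X]
      rw [mul_comm, ← h1]
      refine Finset.sum_congr rfl fun l _ => ?_
      have h2 := aeval_smul_of_isHomogeneous (homogeneousComponent_isHomogeneous l p) c v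
      simp only [aeval_eq_eval] at h2
      rw [h2, mul_comm]
    by_cases hlt : p.totalDegree < j
    · rw [homogeneousComponent_eq_zero _ _ hlt, map_zero]
    have := congrArg (fun q => Polynomial.coeff q j) hpoly
    simpa [Polynomial.finsetSum_coeff, Polynomial.coeff_C_mul, Polynomial.coeff_X_pow, hj,
      Nat.lt_succ_iff, not_lt.mp hlt] using this
  rw [← sum_homogeneousComponent p]
  refine IsHomogeneous.sum _ _ _ fun j _ => ?_
  by_cases hj : j = n
  · exact hj ▸ homogeneousComponent_isHomogeneous j p
  · rw [hcomp j hj]; exact isHomogeneous_zero _ _ _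

end Scaling

section Pencils

variable {k : Type*} [Field k]

lemma binary_form {w : MvPolynomial (Fin 2) k} {n : ℕ} (hw : w.IsHomogeneous n) :
    (aeval ![Polynomial.X, 1] w : Polynomial k).natDegree ≤ n ∧
      ∀ b c, binEval (aeval ![Polynomial.X, 1] w) n b c = eval ![b, c] w := by
  have hmon : ∀ s ∈ w.support, s 0 + s 1 = n := by
    intro s hs
    have := hw (mem_support_iff.mp hs)
    rw [Finsupp.weight_apply, Finsupp.sum_fintype] at this <;> simp_all [Fin.sum_univ_two]
  have hexp : (aeval ![Polynomial.X, 1] w : Polynomial k) =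
      ∑ s ∈ w.support, Polynomial.C (coeff s w) * Polynomial.X ^ (s 0) := by
    rw [aeval_def, eval₂_eq']
    simp [Fin.prod_univ_two, Polynomial.algebraMap_eq]
  refine ⟨?_, fun b c => ?_⟩
  · rw [hexp]
    refine Polynomial.natDegree_sum_le_of_forall_le _ _ fun s hs => ?_
    refine (Polynomial.natDegree_C_mul_X_pow_le _ _).trans ?_
    have := hmon s hs
    omega
  · rw [hexp, binEval, eval_eq']
    simp only [Polynomial.finsetSum_coeff, Finset.sum_mul]
    rw [Finset.sum_comm]
    refine Finset.sum_congr rfl fun s hs => ?_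
    have := hmon s hs
    rw [Finset.sum_eq_single (s 0)]
    · rw [Polynomial.coeff_C_mul_X_pow, if_pos rfl, Fin.prod_univ_two, ← this]
      simp [mul_assoc]
    · intro j _ hj
      rw [Polynomial.coeff_C_mul_X_pow, if_neg hj, zero_mul, zero_mul]
    · intro h
      exact absurd (Finset.mem_range.mpr (by omega)) h

variable {R S : Type*} [CommRing R] [Algebra k R] [CommRing S] [Algebra k S]

/-- The value at `(P, D)` of a polynomial in two groups of four variables. -/
noncomputable def biEval (H : MvPolynomial (Fin 4 ⊕ Fin 4) k) (P D : Fin 4 → R) : R :=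
  aeval (Sum.elim P D) H

lemma map_biEval (H : MvPolynomial (Fin 4 ⊕ Fin 4) k) (φ : R →ₐ[k] S) (P D : Fin 4 → R) :
    φ (biEval H P D) = biEval H (φ ∘ P) (φ ∘ D) := by
  rw [biEval, biEval, ← AlgHom.comp_apply, comp_aeval, ← Sum.comp_elim]
  rfl

/-- The restriction of `H(P, ·)` to the pencil `X • A + B`. -/
noncomputable def pencil (H : MvPolynomial (Fin 4 ⊕ Fin 4) k) (P A B : Fin 4 → R) :
    Polynomial R :=
  biEval H (fun a => Polynomial.C (P a))
    (fun a => Polynomial.X * Polynomial.C (A a) + Polynomial.C (B a))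

lemma pencil_map (H : MvPolynomial (Fin 4 ⊕ Fin 4) k) (φ : R →ₐ[k] S) (P A B : Fin 4 → R) :
    (pencil H P A B).map (φ : R →+* S) = pencil H (φ ∘ P) (φ ∘ A) (φ ∘ B) := by
  have := map_biEval H (Polynomial.mapAlgHom φ) (fun a => Polynomial.C (P a))
    (fun a => Polynomial.X * Polynomial.C (A a) + Polynomial.C (B a))
  rw [Polynomial.coe_mapAlgHom] at this
  rw [pencil, this, pencil]
  congr 1 <;> funext a <;> simp

lemma eval_pencil (H : MvPolynomial (Fin 4 ⊕ Fin 4) k) (P A B : Fin 4 → R) (b : R) :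
    (pencil H P A B).eval b = biEval H P (b • A + B) := by
  have := map_biEval H ((Polynomial.aeval b).restrictScalars k : Polynomial R →ₐ[k] R)
    (fun a => Polynomial.C (P a))
    (fun a => Polynomial.X * Polynomial.C (A a) + Polynomial.C (B a))
  rw [AlgHom.coe_restrictScalars', Polynomial.coe_aeval_eq_eval] at this
  rw [pencil, this]
  · congr 1 <;> funext a <;> simp
    exact mul_comm _ _

lemma pencil_form [Infinite k] {H : MvPolynomial (Fin 4 ⊕ Fin 4) k} {n : ℕ}
    (hH : ∀ (c : k) (P D : Fin 4 → k), biEval H P (c • D) = c ^ n * biEval H P D)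
    (P A B : Fin 4 → k) : (pencil H P A B).natDegree ≤ n ∧
      ∀ b c, binEval (pencil H P A B) n b c = biEval H P (b • A + c • B) := by
  let w : MvPolynomial (Fin 2) k := biEval H (fun a => C (P a))
    (fun a => X 0 * C (A a) + X 1 * C (B a))
  have hw : ∀ v, eval v w = biEval H P (v 0 • A + v 1 • B) := by
    intro v
    have := map_biEval H (aeval v : MvPolynomial (Fin 2) k →ₐ[k] k) (fun a => C (P a))
      (fun a => X 0 * C (A a) + X 1 * C (B a))
    simp only [aeval_eq_eval] at this
    refine this.trans ?_
    congr 1 <;> funext a <;> simp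
  have hw' : (aeval ![Polynomial.X, 1] w : Polynomial k) = pencil H P A B := by
    refine (map_biEval H (aeval ![Polynomial.X, 1] : MvPolynomial (Fin 2) k →ₐ[k] Polynomial k)
      (fun a => C (P a)) (fun a => X 0 * C (A a) + X 1 * C (B a))).trans ?_
    rw [pencil]
    congr 1 <;> funext a <;> simp [Polynomial.algebraMap_eq]
  have hom : w.IsHomogeneous n := isHomogeneous_of_eval_smul fun c v => by
    rw [hw, hw, ← hH]
    congr 1
    simp [smul_smul]
  have := binary_form hom
  rw [hw'] at this
  refine ⟨this.1, fun b c => ?_⟩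
  rw [this.2, hw]
  simp

end Pencils

section Residual

variable {k : Type*} [Field k] {f : MvPolynomial (Fin 4) k} {d i : ℕ}

/-- The linear form with coefficient vector `μ`. -/
def lin (μ D : Fin 4 → k) : k := ∑ a, μ a * D a

lemma lin_add (μ D E : Fin 4 → k) : lin μ (D + E) = lin μ D + lin μ E := by
  simp [lin, mul_add, Finset.sum_add_distrib]

lemma lin_smul (μ D : Fin 4 → k) (c : k) : lin μ (c • D) = c * lin μ D := by
  simp only [lin, Finset.mul_sum, Pi.smul_apply, smul_eq_mul]
  exact Finset.sum_congr rfl fun _ _ => by ring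

/-- The `i`-th polar form as a polynomial in both arguments. -/
noncomputable def polarPoly (f : MvPolynomial (Fin 4) k) (i : ℕ) :
    MvPolynomial (Fin 4 ⊕ Fin 4) k :=
  polar f i (fun a => X (Sum.inl a)) (fun a => X (Sum.inr a))

/-- What remains of `f(μ(P) • D - μ(D) • P)` after the terms of order at most `i` in `D` have been
removed and the power of `μ(P)` has been divided out. -/
noncomputable def residualPoly (f : MvPolynomial (Fin 4) k) (d i : ℕ) (μ : Fin 4 → k) :
    MvPolynomial (Fin 4 ⊕ Fin 4) k :=
  ∑ j ∈ Finset.range (d - i), (∑ a, C (μ a) * X (Sum.inl a)) ^ j *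
    (-∑ a, C (μ a) * X (Sum.inr a)) ^ (d - (i + 1 + j)) * polarPoly f (i + 1 + j)

lemma biEval_polarPoly (P D : Fin 4 → k) : biEval (polarPoly f i) P D = polar f i P D := by
  rw [biEval, polarPoly, map_polar]
  congr 1 <;> funext a <;> simp

lemma biEval_residualPoly (μ P D : Fin 4 → k) : biEval (residualPoly f d i μ) P D =
    ∑ j ∈ Finset.range (d - i), lin μ P ^ j * (-lin μ D) ^ (d - (i + 1 + j)) *
      polar f (i + 1 + j) P D := by
  have h := fun j => biEval_polarPoly (f := f) (i := j) P D
  simp only [biEval, aeval_eq_eval] at h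
  simp [biEval, residualPoly, h, lin]

lemma biEval_polarPoly_smul_right (c : k) (P D : Fin 4 → k) :
    biEval (polarPoly f i) P (c • D) = c ^ i * biEval (polarPoly f i) P D := by
  simp only [biEval_polarPoly, polar_smul_right]

lemma biEval_polarPoly_smul_left (hf : f.IsHomogeneous d) (hi : i ≤ d) (c : k) (P D : Fin 4 → k) :
    biEval (polarPoly f i) (c • P) D = c ^ (d - i) * biEval (polarPoly f i) P D := by
  simp only [biEval_polarPoly, polar_smul_left hf hi]

lemma biEval_residualPoly_smul_right (c : k) (μ P D : Fin 4 → k) :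
    biEval (residualPoly f d i μ) P (c • D) = c ^ d * biEval (residualPoly f d i μ) P D := by
  simp only [biEval_residualPoly, polar_smul_right, lin_smul, Finset.mul_sum]
  refine Finset.sum_congr rfl fun j hj => ?_
  have hj := Finset.mem_range.mp hj
  have : c ^ d = c ^ (d - (i + 1 + j)) * c ^ (i + 1 + j) := by
    rw [← pow_add]; congr 1; omega
  rw [this, ← mul_neg, mul_pow]
  ring

lemma biEval_residualPoly_smul_left (hf : f.IsHomogeneous d) (c : k) (μ P D : Fin 4 → k) :
    biEval (residualPoly f d i μ) (c • P) D =
      c ^ (d - i - 1) * biEval (residualPoly f d i μ) P D := by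
  simp only [biEval_residualPoly, lin_smul, Finset.mul_sum]
  refine Finset.sum_congr rfl fun j hj => ?_
  have hj := Finset.mem_range.mp hj
  have : c ^ (d - i - 1) = c ^ j * c ^ (d - (i + 1 + j)) := by
    rw [← pow_add]; congr 1; omega
  rw [this, polar_smul_left hf (by omega), mul_pow]
  ring

/-- The point `P` lies on the surface and the polar forms of order between `2` and `i - 1` vanish
on the tangent plane at `P`. -/
def Osculates (f : MvPolynomial (Fin 4) k) (i : ℕ) (P : Fin 4 → k) : Prop :=
  eval P f = 0 ∧ ∀ D, polar f 1 P D = 0 → ∀ j, 2 ≤ j → j < i → polar f j P D = 0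

lemma Osculates.polar_lt {P D : Fin 4 → k} (hP : Osculates f i P) (hD : polar f 1 P D = 0)
    {j : ℕ} (hj : j < i) : polar f j P D = 0 := by
  obtain rfl | rfl | h : j = 0 ∨ j = 1 ∨ 2 ≤ j := by omega
  · rw [polar_zero', hP.1]
  · exact hD
  · exact hP.2 D hD j h hj

lemma Osculates.polar_add_smul (hf : f.IsHomogeneous d) (hi : i ≤ d) {P D : Fin 4 → k}
    (hP : Osculates f i P) (hD : polar f 1 P D = 0) (c : k) :
    polar f i P (D + c • P) = polar f i P D := by
  rw [polar_add_smul_self hf hi, Finset.sum_range_succ, Finset.sum_eq_zero]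
  · simp
  · intro l hl
    rw [hP.polar_lt hD (Finset.mem_range.mp hl), mul_zero]

lemma Osculates.eval_projection (hf : f.IsHomogeneous d) (hi : i ≤ d) {P D : Fin 4 → k}
    (hP : Osculates f i P) (hD : polar f 1 P D = 0) (μ : Fin 4 → k) :
    eval ((-lin μ D) • P + lin μ P • D) f = lin μ P ^ i *
      ((-lin μ D) ^ (d - i) * polar f i P D + lin μ P * biEval (residualPoly f d i μ) P D) := by
  rw [eval_smul_add_smul hf, show d + 1 = i + (1 + (d - i)) by omega, Finset.sum_range_add,
    Finset.sum_range_add, Finset.sum_eq_zero, biEval_residualPoly]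
  · simp only [Finset.range_one, Finset.sum_singleton, mul_add, Finset.mul_sum, zero_add, add_zero]
    congr 1
    · ring
    · refine Finset.sum_congr rfl fun j _ => ?_
      rw [← add_assoc, pow_add, pow_add]
      ring
  · intro j hj
    rw [hP.polar_lt hD (Finset.mem_range.mp hj), mul_zero]

lemma Osculates.residual_add_smul (hf : f.IsHomogeneous d) (hi : i ≤ d) {P D : Fin 4 → k}
    (hP : Osculates f i P) (hD : polar f 1 P D = 0) (h0 : polar f i P D = 0) {μ : Fin 4 → k}
    (hμ : lin μ P ≠ 0) (c : k) : biEval (residualPoly f d i μ) P (D + c • P) =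
      biEval (residualPoly f d i μ) P D := by
  have hD' : polar f 1 P (D + c • P) = 0 := by
    rw [polar_one_add, polar_one_smul, polar_one_self hf, hD, hP.1]
    simp
  have h1 := hP.eval_projection hf hi hD μ
  have h2 := hP.eval_projection hf hi hD' μ
  rw [hP.polar_add_smul hf hi hD, h0, mul_zero, zero_add] at h2
  rw [h0, mul_zero, zero_add] at h1
  have e : (-lin μ (D + c • P)) • P + lin μ P • (D + c • P) =
      (-lin μ D) • P + lin μ P • D := by
    rw [lin_add, lin_smul]
    module
  rw [e, h1] at h2
  have := mul_left_cancel₀ (pow_ne_zero i hμ) h2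
  exact (mul_left_cancel₀ hμ this).symm

end Residual

section ChangeOfFrame

variable {k : Type*} [Field k] [IsAlgClosed k]

lemma resultant_change {gF gF' gH gH' : Polynomial k} {n m : ℕ} (hF : gF.natDegree ≤ n)
    (hF' : gF'.natDegree ≤ n) (hH : gH.natDegree ≤ m) (hH' : gH'.natDegree ≤ m) (a b a' b' : k)
    (h1 : ∀ s t, binEval gF' n s t = binEval gF n (s * a + t * a') (s * b + t * b'))
    (h2 : ∀ s t, binEval gF' n s t = 0 →
      binEval gH' m s t = binEval gH m (s * a + t * a') (s * b + t * b')) :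
    Polynomial.resultant gF' gH' n m = (a * b' - b * a') ^ (m * n) *
      Polynomial.resultant gF gH n m := by
  obtain ⟨κ, p, q, -, rfl⟩ := exists_linear_factors n gF hF
  have e : gF' = Polynomial.C κ * ∏ r, (Polynomial.C (a * p r + b * q r) * Polynomial.X +
      Polynomial.C (a' * p r + b' * q r)) := by
    apply Polynomial.funext
    intro s
    rw [← binEval_one_right hF', ← binEval_one_right (natDegree_prod_linear_le _ _ _), h1,
      binEval_prod_linear, binEval_prod_linear]
    congr 1
    exact Finset.prod_congr rfl fun _ _ => by ring
  rw [resultant_prod_linear κ p q hH, e, resultant_prod_linear _ _ _ hH']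
  have key : ∀ r, binEval gH' m (-(a' * p r + b' * q r)) (a * p r + b * q r) =
      (a * b' - b * a') ^ m * binEval gH m (-q r) (p r) := by
    intro r
    rw [h2, ← binEval_smul]
    · congr 1 <;> ring
    · rw [e, binEval_prod_linear, Finset.prod_eq_zero (Finset.mem_univ r), mul_zero]
      ring
  rw [Finset.prod_congr rfl fun r _ => key r, Finset.prod_mul_distrib, Finset.prod_const,
    Finset.card_univ, Fintype.card_fin, pow_mul]
  ring

end ChangeOfFrame

section Frames

variable {R : Type*} [CommRing R]

/-- The determinant of four vectors in `R⁴`. -/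
def det4 (a b c e : Fin 4 → R) : R := (Matrix.of ![a, b, c, e]).det

lemma det4_eq (a b c e : Fin 4 → R) : det4 a b c e =
    (a 0 * b 1 - a 1 * b 0) * (c 2 * e 3 - c 3 * e 2) -
    (a 0 * b 2 - a 2 * b 0) * (c 1 * e 3 - c 3 * e 1) +
    (a 0 * b 3 - a 3 * b 0) * (c 1 * e 2 - c 2 * e 1) +
    (a 1 * b 2 - a 2 * b 1) * (c 0 * e 3 - c 3 * e 0) -
    (a 1 * b 3 - a 3 * b 1) * (c 0 * e 2 - c 2 * e 0) +
    (a 2 * b 3 - a 3 * b 2) * (c 0 * e 1 - c 1 * e 0) := by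
  simp [det4, Matrix.det_succ_row_zero, Fin.sum_univ_succ, Fin.succAbove, Matrix.submatrix,
    Fin.ext_iff]
  ring

set_option maxRecDepth 4000 in
lemma det4_tangent (g N P v₀ v₁ v₂ : Fin 4 → R) (hP : ∑ a, g a * P a = 0) :
    det4 N P ((∑ a, g a * v₀ a) • v₁ - (∑ a, g a * v₁ a) • v₀)
      ((∑ a, g a * v₀ a) • v₂ - (∑ a, g a * v₂ a) • v₀) =
    (∑ a, g a * v₀ a) * det4 v₀ P v₁ v₂ * ∑ a, g a * N a := by
  rw [det4_eq, det4_eq]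
  simp only [Pi.sub_apply, Pi.smul_apply, smul_eq_mul, Fin.sum_univ_four] at hP ⊢
  linear_combination ((g 0 * v₀ 0 + g 1 * v₀ 1 + g 2 * v₀ 2 + g 3 * v₀ 3) * (
    (N 0 * v₀ 1 - N 1 * v₀ 0) * (v₁ 2 * v₂ 3 - v₁ 3 * v₂ 2) -
    (N 0 * v₀ 2 - N 2 * v₀ 0) * (v₁ 1 * v₂ 3 - v₁ 3 * v₂ 1) +
    (N 0 * v₀ 3 - N 3 * v₀ 0) * (v₁ 1 * v₂ 2 - v₁ 2 * v₂ 1) +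
    (N 1 * v₀ 2 - N 2 * v₀ 1) * (v₁ 0 * v₂ 3 - v₁ 3 * v₂ 0) -
    (N 1 * v₀ 3 - N 3 * v₀ 1) * (v₁ 0 * v₂ 2 - v₁ 2 * v₂ 0) +
    (N 2 * v₀ 3 - N 3 * v₀ 2) * (v₁ 0 * v₂ 1 - v₁ 1 * v₂ 0))) * hP

lemma det4_combination (N P E F : Fin 4 → R) (x x' a b a' b' : R) :
    det4 N P (x • P + a • E + b • F) (x' • P + a' • E + b' • F) =
      (a * b' - b * a') * det4 N P E F := by
  rw [det4_eq, det4_eq]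
  simp only [Pi.add_apply, Pi.smul_apply, smul_eq_mul]
  ring

lemma exists_coordinates {k : Type*} [Field k] {a b c e : Fin 4 → k} (h : det4 a b c e ≠ 0)
    (D : Fin 4 → k) : ∃ x y z w : k, D = x • a + y • b + z • c + w • e := by
  let M : Matrix (Fin 4) (Fin 4) k := Matrix.of ![a, b, c, e]
  have hM : IsUnit M.det := isUnit_iff_ne_zero.mpr h
  let v := Matrix.vecMul D M⁻¹
  have hv : Matrix.vecMul v M = D := by
    rw [Matrix.vecMul_vecMul, Matrix.nonsing_inv_mul _ hM, Matrix.vecMul_one]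
  refine ⟨v 0, v 1, v 2, v 3, ?_⟩
  rw [← hv, Matrix.vecMul_eq_sum, Fin.sum_univ_four]
  rfl

end Frames

section FrameResultant

variable {k R S : Type*} [Field k] [CommRing R] [Algebra k R] [CommRing S] [Algebra k S]

/-- The combination of `u` and `v` annihilated by the differential of `f` at `P`. -/
noncomputable def tangentVec (f : MvPolynomial (Fin 4) k) (P u v : Fin 4 → R) : Fin 4 → R :=
  polar f 1 P u • v - polar f 1 P v • u

/-- The factor comparing the tangent frame at `P` obtained from `t` with an intrinsic area form. -/
noncomputable def frameDenom (f : MvPolynomial (Fin 4) k) (P : Fin 4 → R)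
    (t : Fin 3 → Fin 4 → R) : R :=
  polar f 1 P (t 0) * det4 (t 0) P (t 1) (t 2)

/-- The resultant of the `i`-th polar form and of the residual form at `P`, computed in the tangent
frame obtained from `t`. -/
noncomputable def frameResultant (f : MvPolynomial (Fin 4) k) (d i : ℕ) (μ : Fin 4 → k)
    (P : Fin 4 → R) (t : Fin 3 → Fin 4 → R) : R :=
  Polynomial.resultant
    (pencil (polarPoly f i) P (tangentVec f P (t 0) (t 1)) (tangentVec f P (t 0) (t 2)))
    (pencil (residualPoly f d i μ) P (tangentVec f P (t 0) (t 1)) (tangentVec f P (t 0) (t 2)))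
    i d

lemma map_tangentVec (f : MvPolynomial (Fin 4) k) (φ : R →ₐ[k] S) (P u v : Fin 4 → R) :
    φ ∘ tangentVec f P u v = tangentVec f (φ ∘ P) (φ ∘ u) (φ ∘ v) := by
  funext a
  simp [tangentVec, map_polar]

lemma map_frameDenom (f : MvPolynomial (Fin 4) k) (φ : R →ₐ[k] S) (P : Fin 4 → R)
    (t : Fin 3 → Fin 4 → R) :
    φ (frameDenom f P t) = frameDenom f (φ ∘ P) (fun j => φ ∘ t j) := by
  simp [frameDenom, map_polar, det4_eq]

lemma map_frameResultant (f : MvPolynomial (Fin 4) k) (d i : ℕ) (μ : Fin 4 → k) (φ : R →ₐ[k] S)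
    (P : Fin 4 → R) (t : Fin 3 → Fin 4 → R) :
    φ (frameResultant f d i μ P t) = frameResultant f d i μ (φ ∘ P) (fun j => φ ∘ t j) := by
  rw [frameResultant, frameResultant, ← map_tangentVec, ← map_tangentVec, ← pencil_map,
    ← pencil_map, Polynomial.resultant_map_map]
  rfl

end FrameResultant

section FramesAtPoint

variable {k : Type*} [Field k] {f : MvPolynomial (Fin 4) k} {d i : ℕ}

lemma polar_tangentVec (P u v : Fin 4 → k) : polar f 1 P (tangentVec f P u v) = 0 := by
  rw [tangentVec, polar_one_sub, polar_one_smul, polar_one_smul]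
  ring

lemma exists_tangent_coordinates {P : Fin 4 → k} {t : Fin 3 → Fin 4 → k}
    (ht : frameDenom f P t ≠ 0) (hP : polar f 1 P P = 0) {D : Fin 4 → k}
    (hD : polar f 1 P D = 0) : ∃ x b c : k,
      D = x • P + b • tangentVec f P (t 0) (t 1) + c • tangentVec f P (t 0) (t 2) := by
  obtain ⟨h0, h1⟩ := mul_ne_zero_iff.mp ht
  obtain ⟨x, y, z, w, rfl⟩ := exists_coordinates h1 D
  refine ⟨y, z / polar f 1 P (t 0), w / polar f 1 P (t 0), ?_⟩
  rw [polar_one_add, polar_one_add, polar_one_add, polar_one_smul, polar_one_smul, polar_one_smul,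
    polar_one_smul, hP] at hD
  have hx : x = -(z * polar f 1 P (t 1) + w * polar f 1 P (t 2)) / polar f 1 P (t 0) := by
    field_simp
    linear_combination hD
  rw [hx, tangentVec, tangentVec]
  ext a
  simp only [Pi.add_apply, Pi.smul_apply, Pi.sub_apply, smul_eq_mul]
  field_simp
  ring

lemma det4_tangentVec (N : Fin 4 → k) {P : Fin 4 → k} (hP : polar f 1 P P = 0)
    (t : Fin 3 → Fin 4 → k) :
    det4 N P (tangentVec f P (t 0) (t 1)) (tangentVec f P (t 0) (t 2)) =
      frameDenom f P t * polar f 1 P N := by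
  simp only [frameDenom, tangentVec, polar_one'] at hP ⊢
  exact det4_tangent _ _ _ _ _ _ hP

lemma pencil_polarPoly [Infinite k] (P A B : Fin 4 → k) :
    (pencil (polarPoly f i) P A B).natDegree ≤ i ∧
      ∀ b c, binEval (pencil (polarPoly f i) P A B) i b c = polar f i P (b • A + c • B) := by
  have := pencil_form (fun c P D => biEval_polarPoly_smul_right (f := f) (i := i) c P D) P A B
  simpa only [biEval_polarPoly] using this

lemma pencil_residualPoly [Infinite k] (μ P A B : Fin 4 → k) :
    (pencil (residualPoly f d i μ) P A B).natDegree ≤ d ∧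
      ∀ b c, binEval (pencil (residualPoly f d i μ) P A B) d b c =
        biEval (residualPoly f d i μ) P (b • A + c • B) :=
  pencil_form (fun c P D => biEval_residualPoly_smul_right (f := f) (i := i) (d := d) c μ P D) P A B

lemma polar_one_self_eq_zero (hf : f.IsHomogeneous d) {P : Fin 4 → k} (hP : eval P f = 0) :
    polar f 1 P P = 0 := by
  rw [polar_one_self hf, hP, mul_zero]

lemma frameResultant_change_aux [IsAlgClosed k] (hf : IsSmoothSurface f d) (hi : i ≤ d)
    {P : Fin 4 → k} (hP0 : P ≠ 0) (hP : Osculates f i P) {μ : Fin 4 → k} (hμ : lin μ P ≠ 0)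
    (s t : Fin 3 → Fin 4 → k) (hs : frameDenom f P s ≠ 0) :
    frameResultant f d i μ P t * frameDenom f P s ^ (d * i) =
      frameResultant f d i μ P s * frameDenom f P t ^ (d * i) := by
  have hPP := polar_one_self_eq_zero hf.2.1 hP.1
  obtain ⟨x, a, b, h1⟩ := exists_tangent_coordinates hs hPP (polar_tangentVec P (t 0) (t 1))
  obtain ⟨x', a', b', h2⟩ := exists_tangent_coordinates hs hPP (polar_tangentVec P (t 0) (t 2))
  set E := tangentVec f P (s 0) (s 1) with hE
  set F := tangentVec f P (s 0) (s 2) with hF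
  obtain ⟨j, hj⟩ := IsSmooth.exists_grad_ne hf hP0 hP.1
  have hN : polar f 1 P (Pi.single j 1) ≠ 0 := by
    rw [polar_one']
    simpa [Pi.single_apply] using hj
  have hdet := det4_tangentVec (Pi.single j 1) hPP t
  rw [h1, h2, det4_combination, hE, hF, det4_tangentVec _ hPP, ← mul_assoc] at hdet
  have hdet' := mul_right_cancel₀ hN hdet
  have htan : ∀ b c : k, polar f 1 P (b • E + c • F) = 0 := by
    intro b c
    rw [polar_one_add, polar_one_smul, polar_one_smul, hE, hF, polar_tangentVec, polar_tangentVec]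
    ring
  have hcomb : ∀ u v : k, u • tangentVec f P (t 0) (t 1) + v • tangentVec f P (t 0) (t 2) =
      ((u * a + v * a') • E + (u * b + v * b') • F) + (u * x + v * x') • P := by
    intro u v
    rw [h1, h2]
    module
  have hpol : ∀ u v : k,
      polar f i P (u • tangentVec f P (t 0) (t 1) + v • tangentVec f P (t 0) (t 2)) =
      polar f i P ((u * a + v * a') • E + (u * b + v * b') • F) := by
    intro u v
    rw [hcomb, hP.polar_add_smul hf.2.1 hi (htan _ _)]
  have key := resultant_change (pencil_polarPoly (f := f) (i := i) P E F).1
    (pencil_polarPoly (f := f) (i := i) P (tangentVec f P (t 0) (t 1))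
      (tangentVec f P (t 0) (t 2))).1
    (pencil_residualPoly (f := f) (d := d) (i := i) μ P E F).1
    (pencil_residualPoly (f := f) (d := d) (i := i) μ P (tangentVec f P (t 0) (t 1))
      (tangentVec f P (t 0) (t 2))).1 a b a' b'
    (fun u v => by rw [(pencil_polarPoly _ _ _).2, (pencil_polarPoly _ _ _).2, hpol])
    (fun u v h0 => by
      rw [(pencil_polarPoly _ _ _).2, hpol] at h0
      rw [(pencil_residualPoly _ _ _ _).2, (pencil_residualPoly _ _ _ _).2, hcomb,
        hP.residual_add_smul hf.2.1 hi (htan _ _) h0 hμ])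
  rw [frameResultant, key, frameResultant, ← hdet', mul_pow]
  ring

lemma frameResultant_change [IsAlgClosed k] (hf : IsSmoothSurface f d) (hi : i ≤ d) (hi0 : i ≠ 0)
    {P : Fin 4 → k} (hP0 : P ≠ 0) (hP : Osculates f i P) {μ : Fin 4 → k} (hμ : lin μ P ≠ 0)
    (s t : Fin 3 → Fin 4 → k) :
    frameResultant f d i μ P t * frameDenom f P s ^ (d * i) =
      frameDenom f P t ^ (d * i) * frameResultant f d i μ P s := by
  by_cases hs : frameDenom f P s = 0
  · by_cases ht : frameDenom f P t = 0
    · have : d * i ≠ 0 := mul_ne_zero (by omega) hi0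
      simp [hs, ht, this]
    · rw [mul_comm, mul_comm _ (frameResultant f d i μ P s),
        mul_comm _ (frameResultant f d i μ P t)]
      exact (frameResultant_change_aux hf hi hP0 hP hμ t s ht).symm
  · rw [frameResultant_change_aux hf hi hP0 hP hμ s t hs, mul_comm]

end FramesAtPoint

section Genericity

variable {k : Type*} [Field k] {f : MvPolynomial (Fin 4) k} {d i : ℕ}

lemma exists_lin_ne_zero [Infinite k] {ι : Type*} (s : Finset ι) (w : ι → Fin 4 → k)
    (hw : ∀ r ∈ s, w r ≠ 0) : ∃ μ, ∀ r ∈ s, lin μ (w r) ≠ 0 := by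
  let p : ι → MvPolynomial (Fin 4) k := fun r => ∑ a, C (w r a) * X a
  have hp : ∀ r μ, eval μ (p r) = lin μ (w r) := by
    intro r μ
    simp only [p, lin, map_sum, map_mul, eval_C, eval_X]
    exact Finset.sum_congr rfl fun _ _ => mul_comm _ _
  have hne : ∏ r ∈ s, p r ≠ 0 := by
    refine Finset.prod_ne_zero_iff.mpr fun r hr h0 => hw r hr ?_
    funext a
    have := hp r (Pi.single a 1)
    rw [h0, map_zero] at this
    simpa [lin, Pi.single_apply] using this.symm
  obtain ⟨μ, hμ⟩ : ∃ μ, eval μ (∏ r ∈ s, p r) ≠ 0 := by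
    by_contra! h
    exact hne (MvPolynomial.funext fun v => by rw [h, map_zero])
  refine ⟨μ, fun r hr => ?_⟩
  rw [← hp]
  rw [map_prod] at hμ
  exact Finset.prod_ne_zero_iff.mp hμ r hr

lemma linearIndependent_of_det4 {a b c e : Fin 4 → k} (h : det4 a b c e ≠ 0) :
    LinearIndependent k ![a, b, c, e] :=
  Matrix.linearIndependent_rows_of_det_ne_zero h

lemma det4_ne_zero {a b c e : Fin 4 → k} (h : LinearIndependent k ![a, b, c, e]) :
    det4 a b c e ≠ 0 := by
  have := (Matrix.linearIndependent_rows_iff_isUnit (A := Matrix.of ![a, b, c, e])).mp h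
  exact ((Matrix.isUnit_iff_isUnit_det _).mp this).ne_zero

lemma exists_det4_ne_zero {a b : Fin 4 → k} (h : LinearIndependent k ![a, b]) :
    ∃ c e, det4 a b c e ≠ 0 := by
  obtain ⟨e, he⟩ := exists_linearIndependent_snoc_of_lt_finrank (n := 2) h (by simp)
  obtain ⟨g, hg⟩ := exists_linearIndependent_snoc_of_lt_finrank (n := 3) he (by simp)
  refine ⟨e, g, det4_ne_zero ?_⟩
  have : Fin.snoc (Fin.snoc ![a, b] e : Fin 3 → Fin 4 → k) g = ![a, b, e, g] := by
    funext j
    fin_cases j <;> rfl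
  rw [← this]
  exact hg

lemma exists_frameDenom_ne_zero (hf : IsSmoothSurface f d) {P : Fin 4 → k} (hP0 : P ≠ 0)
    (hP : eval P f = 0) : ∃ t : Fin 3 → Fin 4 → k, frameDenom f P t ≠ 0 := by
  obtain ⟨j, hj⟩ := IsSmooth.exists_grad_ne hf hP0 hP
  have hN : polar f 1 P (Pi.single j 1) ≠ 0 := by
    rw [polar_one']
    simpa [Pi.single_apply] using hj
  have hli : LinearIndependent k ![Pi.single j 1, P] := by
    rw [LinearIndependent.pair_iff]
    intro s t hst
    have h1 := congrArg (polar f 1 P) hst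
    rw [polar_one_add, polar_one_smul, polar_one_smul, polar_one_self_eq_zero hf.2.1 hP,
      mul_zero, add_zero] at h1
    have h0 : polar f 1 P 0 = 0 := by simp [polar_one']
    rw [h0] at h1
    obtain rfl := (mul_eq_zero.mp h1).resolve_right hN
    rw [zero_smul, zero_add] at hst
    exact ⟨rfl, (smul_eq_zero.mp hst).resolve_right hP0⟩
  obtain ⟨c, e, h⟩ := exists_det4_ne_zero hli
  exact ⟨![Pi.single j 1, c, e], mul_ne_zero hN h⟩

lemma not_dvd_of_isHomogeneous_one (hf : IsSmoothSurface f d) (hd : 2 ≤ d)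
    {l : MvPolynomial (Fin 4) k} (hl : l.IsHomogeneous 1) (hl0 : l ≠ 0) : ¬ f ∣ l := by
  intro h
  have h1 := totalDegree_le_of_dvd_of_isDomain h hl0
  rw [hf.2.1.totalDegree hf.1, hl.totalDegree hl0] at h1
  omega

lemma exists_notMem_of_finrank_eq_two {W : Submodule k (Fin 4 → k)}
    (hW : Module.finrank k W = 2) : ∃ v, v ∉ W := by
  by_contra! h
  have : W = ⊤ := by
    ext v; simp [h v]
  rw [this, finrank_top] at hW
  simp at hW

lemma exists_point_off_lines [IsAlgClosed k] (hf : IsSmoothSurface f d) (hd : 2 ≤ d)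
    (hfin : {W | IsLineOn f W}.Finite) {h : MvPolynomial (Fin 4) k} (hh : ¬ f ∣ h) :
    ∃ P, eval P f = 0 ∧ eval P h ≠ 0 ∧ ∀ W, IsLineOn f W → P ∉ W := by
  have hl : ∀ W : Submodule k (Fin 4 → k), ∃ l : MvPolynomial (Fin 4) k, IsLineOn f W →
      ¬ f ∣ l ∧ ∀ u ∈ W, eval u l = 0 := by
    intro W
    by_cases hW : IsLineOn f W
    · obtain ⟨v, hv⟩ := exists_notMem_of_finrank_eq_two hW.1
      obtain ⟨l, h1, h2, h3⟩ := exists_linear_form hv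
      refine ⟨l, fun _ => ⟨not_dvd_of_isHomogeneous_one hf hd h1 ?_, h3⟩⟩
      rintro rfl
      exact h2 (map_zero _)
    · exact ⟨0, fun h => absurd h hW⟩
  choose l hl using hl
  have hnd : ¬ f ∣ h * ∏ W ∈ hfin.toFinset, l W := by
    have hp := IsSmooth.prime hf (by omega)
    rw [hp.dvd_mul, not_or]
    refine ⟨hh, fun h => ?_⟩
    obtain ⟨W, hW, hdvd⟩ := (hp.dvd_finsetProd_iff _).mp h
    exact (hl W (by simpa using hW)).1 hdvd
  obtain ⟨P, hP, hne⟩ : ∃ P, eval P f = 0 ∧ eval P (h * ∏ W ∈ hfin.toFinset, l W) ≠ 0 := by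
    by_contra! hcon
    exact hnd (IsSmooth.dvd_of_forall_eval hf (by omega) hcon)
  rw [map_mul, map_prod] at hne
  obtain ⟨h1, h2⟩ := mul_ne_zero_iff.mp hne
  refine ⟨P, hP, h1, fun W hW hPW => ?_⟩
  exact Finset.prod_ne_zero_iff.mp h2 W (by simpa using hW) ((hl W hW).2 P hPW)

lemma eval_smul_add_smul_eq_binEval (hf : f.IsHomogeneous d) (P D : Fin 4 → k) (b c : k) :
    eval (c • P + b • D) f = binEval (restr f P D) d b c := by
  rw [eval_smul_add_smul hf, binEval]
  refine Finset.sum_congr rfl fun j _ => ?_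
  rw [polar]
  ring

lemma exists_generic_frame [IsAlgClosed k] (hf : IsSmoothSurface f d)
    (hid : i + 2 ≤ d) (hosc : ∀ P, eval P f = 0 → Osculates f i P)
    (hne : ∃ P D, eval P f = 0 ∧ polar f 1 P D = 0 ∧ polar f i P D ≠ 0)
    (hfin : {W | IsLineOn f W}.Finite) :
    ∃ (P : Fin 4 → k) (t : Fin 3 → Fin 4 → k) (b c : k), P ≠ 0 ∧ eval P f = 0 ∧
      (∀ W, IsLineOn f W → P ∉ W) ∧ frameDenom f P t ≠ 0 ∧
      polar f i P (b • tangentVec f P (t 0) (t 1) + c • tangentVec f P (t 0) (t 2)) ≠ 0 := by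
  have hvan : ∀ D : Fin 4 → k, polar f i 0 D = 0 := by
    intro D
    have := polar_smul_left hf.2.1 (by omega : i ≤ d) (0 : Fin 4 → k) D (0 : k)
    rwa [smul_zero, zero_pow (by omega), zero_mul] at this
  obtain ⟨P', D', hP', hD', hT⟩ := hne
  have hP'0 : P' ≠ 0 := by
    rintro rfl
    exact hT (hvan _)
  obtain ⟨t, ht⟩ := exists_frameDenom_ne_zero hf hP'0 hP'
  obtain ⟨x, b, c, rfl⟩ := exists_tangent_coordinates ht (polar_one_self_eq_zero hf.2.1 hP') hD'
  have htan : polar f 1 P' (b • tangentVec f P' (t 0) (t 1) + c • tangentVec f P' (t 0) (t 2)) =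
      0 := by
    rw [polar_one_add, polar_one_smul, polar_one_smul, polar_tangentVec, polar_tangentVec]
    ring
  rw [add_assoc, add_comm, (hosc P' hP').polar_add_smul hf.2.1 (by omega) htan] at hT
  let t' : Fin 3 → Fin 4 → MvPolynomial (Fin 4) k := fun j a => C (t j a)
  have hev : ∀ P : Fin 4 → k, (aeval P : MvPolynomial (Fin 4) k →ₐ[k] k) ∘ X = P := by
    intro P; funext a; simp
  have hev' : ∀ (P : Fin 4 → k) j, (aeval P : MvPolynomial (Fin 4) k →ₐ[k] k) ∘ t' j = t j := by
    intro P j; funext a; simp [t']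
  let h1 : MvPolynomial (Fin 4) k := frameDenom f X t'
  let h2 : MvPolynomial (Fin 4) k := polar f i X
    ((C b : MvPolynomial (Fin 4) k) • tangentVec f X (t' 0) (t' 1) +
      (C c : MvPolynomial (Fin 4) k) • tangentVec f X (t' 0) (t' 2))
  have e1 : ∀ P, eval P h1 = frameDenom f P t := by
    intro P
    have := map_frameDenom f (aeval P : MvPolynomial (Fin 4) k →ₐ[k] k) X t'
    simp only [hev, hev'] at this
    simpa only [aeval_eq_eval] using this
  have e2 : ∀ P, eval P h2 =
      polar f i P (b • tangentVec f P (t 0) (t 1) + c • tangentVec f P (t 0) (t 2)) := by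
    intro P
    have hm : (aeval P : MvPolynomial (Fin 4) k →ₐ[k] k) ∘
        ((C b : MvPolynomial (Fin 4) k) • tangentVec f X (t' 0) (t' 1) +
      (C c : MvPolynomial (Fin 4) k) • tangentVec f X (t' 0) (t' 2)) =
        b • tangentVec f P (t 0) (t 1) + c • tangentVec f P (t 0) (t 2) := by
      have g1 := map_tangentVec f (aeval P : MvPolynomial (Fin 4) k →ₐ[k] k) X (t' 0) (t' 1)
      have g2 := map_tangentVec f (aeval P : MvPolynomial (Fin 4) k →ₐ[k] k) X (t' 0) (t' 2)
      simp only [hev, hev'] at g1 g2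
      rw [← g1, ← g2]
      funext a
      simp
    have := map_polar f (aeval P : MvPolynomial (Fin 4) k →ₐ[k] k) i X
      ((C b : MvPolynomial (Fin 4) k) • tangentVec f X (t' 0) (t' 1) +
      (C c : MvPolynomial (Fin 4) k) • tangentVec f X (t' 0) (t' 2))
    rw [hm, hev] at this
    simpa only [aeval_eq_eval] using this
  have hnd : ¬ f ∣ h1 * h2 := by
    rw [(IsSmooth.prime hf (by omega)).dvd_mul]
    rintro (⟨q, hq⟩ | ⟨q, hq⟩)
    · exact ht (by rw [← e1, hq, map_mul, hP', zero_mul])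
    · exact hT (by rw [← e2, hq, map_mul, hP', zero_mul])
  obtain ⟨P, hP, hne, hoff⟩ := exists_point_off_lines hf (by omega) hfin hnd
  rw [map_mul, e1, e2] at hne
  obtain ⟨hne1, hne2⟩ := mul_ne_zero_iff.mp hne
  have hP0 : P ≠ 0 := by
    rintro rfl
    exact hne2 (hvan _)
  exact ⟨P, t, b, c, hP0, hP, hoff, hne1, hne2⟩

lemma exists_restriction_factors [IsAlgClosed k] (hf : f.IsHomogeneous d) {P D : Fin 4 → k}
    (hli : LinearIndependent k ![P, D]) (hoff : ∀ W, IsLineOn f W → P ∉ W) :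
    ∃ (κ : k) (p q : Fin d → k), κ ≠ 0 ∧ (∀ s, p s ≠ 0 ∨ q s ≠ 0) ∧
      ∀ b c, eval (c • P + b • D) f = κ * ∏ s, (b * p s + c * q s) := by
  obtain ⟨κ, p, q, hpq, hfac⟩ := exists_linear_factors d (restr f P D) (natDegree_restr_le hf _ _)
  have hval : ∀ b c, eval (c • P + b • D) f = κ * ∏ s, (b * p s + c * q s) := by
    intro b c
    rw [eval_smul_add_smul_eq_binEval hf, hfac, binEval_prod_linear]
  refine ⟨κ, p, q, ?_, hpq, hval⟩
  rintro rfl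
  have hline : IsLineOn f (Submodule.span k {P, D}) := by
    refine ⟨finrank_span_pair hli, fun v hv => ?_⟩
    obtain ⟨c, b, rfl⟩ := Submodule.mem_span_pair.mp hv
    rw [hval, zero_mul]
  exact hoff _ hline (Submodule.subset_span (by simp))

lemma linearIndependent_tangent_combination (hf : IsSmoothSurface f d) {P : Fin 4 → k}
    (hP0 : P ≠ 0) (hP : eval P f = 0) {t : Fin 3 → Fin 4 → k} (ht : frameDenom f P t ≠ 0)
    {b c : k} (hbc : b ≠ 0 ∨ c ≠ 0) : LinearIndependent k
      ![P, b • tangentVec f P (t 0) (t 1) + c • tangentVec f P (t 0) (t 2)] := by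
  obtain ⟨j, hj⟩ := IsSmooth.exists_grad_ne hf hP0 hP
  have hN : polar f 1 P (Pi.single j 1) ≠ 0 := by
    rw [polar_one']
    simpa [Pi.single_apply] using hj
  have hdet := det4_tangentVec (Pi.single j 1) (polar_one_self_eq_zero hf.2.1 hP) t
  have hdet' := linearIndependent_of_det4 (hdet.trans_ne (mul_ne_zero ht hN))
  have h4 := Fintype.linearIndependent_iff.mp hdet'
  rw [LinearIndependent.pair_iff]
  intro u v huv
  have hz := h4 ![0, u, v * b, v * c] (by
    rw [Fin.sum_univ_four, ← huv]
    simp [smul_smul, add_assoc])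
  have z1 : u = 0 := hz 1
  have z2 : v * b = 0 := hz 2
  have z3 : v * c = 0 := hz 3
  refine ⟨z1, ?_⟩
  rcases hbc with h | h
  · exact (mul_eq_zero.mp z2).resolve_right h
  · exact (mul_eq_zero.mp z3).resolve_right h

lemma exists_lin_residual_ne_zero [IsAlgClosed k] (hf : f.IsHomogeneous d) (hi : i ≤ d)
    {P : Fin 4 → k} (hP0 : P ≠ 0) (hP : Osculates f i P) (hoff : ∀ W, IsLineOn f W → P ∉ W)
    {n : ℕ} (D : Fin n → Fin 4 → k) (hDt : ∀ r, polar f 1 P (D r) = 0)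
    (hDi : ∀ r, polar f i P (D r) = 0) (hli : ∀ r, LinearIndependent k ![P, D r]) :
    ∃ μ, μ ≠ 0 ∧ ∀ r, biEval (residualPoly f d i μ) P (D r) ≠ 0 := by
  choose κ p q hκ hpq hval using fun r => exists_restriction_factors hf (hli r) hoff
  have hw0 : ∀ r s, p r s • P + (-q r s) • D r ≠ 0 := by
    intro r s h0
    have := LinearIndependent.pair_iff.mp (hli r) _ _ h0
    rcases hpq r s with h | h
    · exact h this.1
    · exact h (by simpa using this.2)
  obtain ⟨μ, hμ⟩ := exists_lin_ne_zero (Finset.univ : Finset (Option (Fin n × Fin d)))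
    (fun o => o.elim P fun rs => p rs.1 rs.2 • P + (-q rs.1 rs.2) • D rs.1)
    (by rintro (_ | ⟨r, s⟩) -; exacts [hP0, hw0 r s])
  have hμP : lin μ P ≠ 0 := hμ none (Finset.mem_univ _)
  have hμD : ∀ r s, lin μ (p r s • P + (-q r s) • D r) ≠ 0 := fun r s =>
    hμ (some (r, s)) (Finset.mem_univ _)
  refine ⟨μ, ?_, fun r h0 => ?_⟩
  · rintro rfl
    simp [lin] at hμP
  · have := hP.eval_projection hf hi (hDt r) μ
    rw [h0, hDi, mul_zero, mul_zero, add_zero, mul_zero, hval] at this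
    refine mul_ne_zero (hκ r) (Finset.prod_ne_zero_iff.mpr fun s _ => ?_) this
    have h1 := hμD r s
    rw [lin_add, lin_smul, lin_smul] at h1
    intro h
    apply h1
    linear_combination h

lemma exists_frameResultant_ne_zero [IsAlgClosed k] (hf : IsSmoothSurface f d)
    (hid : i + 2 ≤ d) (hosc : ∀ P, eval P f = 0 → Osculates f i P)
    (hne : ∃ P D, eval P f = 0 ∧ polar f 1 P D = 0 ∧ polar f i P D ≠ 0)
    (hfin : {W | IsLineOn f W}.Finite) :
    ∃ μ P t, μ ≠ 0 ∧ eval P f = 0 ∧ frameResultant f d i μ P t ≠ 0 := by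
  obtain ⟨P, t, b, c, hP0, hP, hoff, hne1, hne2⟩ := exists_generic_frame hf hid hosc hne hfin
  have hPF := pencil_polarPoly (f := f) (i := i) P (tangentVec f P (t 0) (t 1))
    (tangentVec f P (t 0) (t 2))
  obtain ⟨κ, p, q, hpq, hfac⟩ := exists_linear_factors i _ hPF.1
  have hκ : κ ≠ 0 := by
    rintro rfl
    have := hPF.2 b c
    rw [hfac, binEval_prod_linear, zero_mul] at this
    exact hne2 this.symm
  obtain ⟨μ, hμ, hne⟩ := exists_lin_residual_ne_zero hf.2.1 (by omega) hP0 (hosc P hP) hoff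
    (fun r => (-q r) • tangentVec f P (t 0) (t 1) + p r • tangentVec f P (t 0) (t 2))
    (fun r => by
      rw [polar_one_add, polar_one_smul, polar_one_smul, polar_tangentVec, polar_tangentVec]
      ring)
    (fun r => by
      rw [← hPF.2, hfac, binEval_prod_linear, Finset.prod_eq_zero (Finset.mem_univ r), mul_zero]
      ring)
    (fun r => linearIndependent_tangent_combination hf hP0 hP hne1
      ((hpq r).symm.imp neg_ne_zero.mpr id))
  refine ⟨μ, P, t, hμ, hP, ?_⟩
  rw [frameResultant, hfac, resultant_prod_linear _ _ _ (pencil_residualPoly (f := f) (d := d)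
    (i := i) μ P _ _).1]
  refine mul_ne_zero (pow_ne_zero _ hκ) (Finset.prod_ne_zero_iff.mpr fun r _ => ?_)
  rw [(pencil_residualPoly _ _ _ _).2]
  exact hne r

end Genericity

section Section

variable {k : Type*} [Field k] {f : MvPolynomial (Fin 4) k} {d i : ℕ}

/-- `frameDenom` at the generic point. -/
noncomputable def denomPoly (f : MvPolynomial (Fin 4) k) (t : Fin 3 → Fin 4 → k) :
    MvPolynomial (Fin 4) k :=
  frameDenom f X fun j a => C (t j a)

/-- `frameResultant` at the generic point. -/
noncomputable def resultantPoly (f : MvPolynomial (Fin 4) k) (d i : ℕ) (μ : Fin 4 → k)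
    (t : Fin 3 → Fin 4 → k) : MvPolynomial (Fin 4) k :=
  frameResultant f d i μ X fun j a => C (t j a)

lemma eval_denomPoly (t : Fin 3 → Fin 4 → k) (P : Fin 4 → k) :
    eval P (denomPoly f t) = frameDenom f P t := by
  have h := map_frameDenom f (aeval P : MvPolynomial (Fin 4) k →ₐ[k] k) X fun j a => C (t j a)
  have e1 : (aeval P : MvPolynomial (Fin 4) k →ₐ[k] k) ∘ X = P := by
    funext a; simp
  have e2 : ∀ j, ((aeval P : MvPolynomial (Fin 4) k →ₐ[k] k) ∘ fun a => C (t j a)) = t j := by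
    intro j; funext a; simp
  simp only [e1, e2] at h
  simp only [aeval_eq_eval] at h
  exact h

lemma eval_resultantPoly (μ : Fin 4 → k) (t : Fin 3 → Fin 4 → k) (P : Fin 4 → k) :
    eval P (resultantPoly f d i μ t) = frameResultant f d i μ P t := by
  have h := map_frameResultant f d i μ (aeval P : MvPolynomial (Fin 4) k →ₐ[k] k) X
    fun j a => C (t j a)
  have e1 : (aeval P : MvPolynomial (Fin 4) k →ₐ[k] k) ∘ X = P := by
    funext a; simp
  have e2 : ∀ j, ((aeval P : MvPolynomial (Fin 4) k →ₐ[k] k) ∘ fun a => C (t j a)) = t j := by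
    intro j; funext a; simp
  simp only [e1, e2] at h
  simp only [aeval_eq_eval] at h
  exact h

lemma tangentVec_smul (hf : f.IsHomogeneous d) (hd : 1 ≤ d) (c : k) (P u v : Fin 4 → k) :
    tangentVec f (c • P) u v = c ^ (d - 1) • tangentVec f P u v := by
  rw [tangentVec, tangentVec, polar_smul_left hf hd, polar_smul_left hf hd]
  module

lemma frameDenom_smul (hf : f.IsHomogeneous d) (hd : 1 ≤ d) (c : k) (P : Fin 4 → k)
    (t : Fin 3 → Fin 4 → k) : frameDenom f (c • P) t = c ^ d * frameDenom f P t := by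
  have h : c ^ d = c ^ (d - 1) * c := by
    rw [← pow_succ, Nat.sub_add_cancel hd]
  rw [frameDenom, frameDenom, polar_smul_left hf hd, det4_eq, det4_eq, h]
  simp only [Pi.smul_apply, smul_eq_mul]
  ring

lemma pencil_smul [Infinite k] {H : MvPolynomial (Fin 4 ⊕ Fin 4) k} {m n : ℕ}
    (hl : ∀ (c : k) (P D : Fin 4 → k), biEval H (c • P) D = c ^ m * biEval H P D)
    (hr : ∀ (c : k) (P D : Fin 4 → k), biEval H P (c • D) = c ^ n * biEval H P D)
    (c e : k) (P A B : Fin 4 → k) :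
    pencil H (c • P) (e • A) (e • B) = Polynomial.C (c ^ m * e ^ n) * pencil H P A B := by
  apply Polynomial.funext
  intro b
  rw [Polynomial.eval_mul, Polynomial.eval_C, eval_pencil, eval_pencil, hl, mul_assoc, ← hr]
  congr 2
  module

lemma frameResultant_smul [Infinite k] (hf : f.IsHomogeneous d) (hi : i ≤ d) (hd : 1 ≤ d)
    (μ : Fin 4 → k) (c : k) (P : Fin 4 → k) (t : Fin 3 → Fin 4 → k) :
    frameResultant f d i μ (c • P) t =
      c ^ ((d - i + (d - 1) * i) * d + (d - i - 1 + (d - 1) * d) * i) *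
        frameResultant f d i μ P t := by
  rw [frameResultant, frameResultant, tangentVec_smul hf hd, tangentVec_smul hf hd,
    pencil_smul (biEval_polarPoly_smul_left hf hi) biEval_polarPoly_smul_right,
    pencil_smul (biEval_residualPoly_smul_left hf · μ) (biEval_residualPoly_smul_right · μ),
    Polynomial.resultant_C_mul_left, Polynomial.resultant_C_mul_right]
  ring

lemma card_lines_le_of_polar_ne_zero [IsAlgClosed k] (hf : IsSmoothSurface f d) (hi : 2 ≤ i)
    (hid : i + 2 ≤ d) (hosc : ∀ P, eval P f = 0 → Osculates f i P)
    (hne : ∃ P D, eval P f = 0 ∧ polar f 1 P D = 0 ∧ polar f i P D ≠ 0)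
    (hfin : {W | IsLineOn f W}.Finite) :
    {W | IsLineOn f W}.ncard ≤ d * (d * i * (d - 2) + i * (2 * (d - i) - 1) + (d - i) ^ 2) := by
  obtain ⟨μ, P₀, t₀, hμ, hP₀, hne₀⟩ := exists_frameResultant_ne_zero hf hid hosc hne hfin
  rw [Set.ncard_eq_toFinset_card _ hfin]
  have hp := IsSmooth.prime hf (by omega)
  refine card_lines_le_of_section (ι := Fin 3 → Fin 4 → k) (a := d * (d * i)) (by omega) hp hf.2.1
    (fun t => denomPoly f t ^ (d * i)) (fun t => resultantPoly f d i μ t) ?_ ?_ ?_ ?_ (t₀ := t₀)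
    ?_ _ (fun W hW => by simpa using hW) ?_
  · refine fun t => IsHomogeneous.pow (isHomogeneous_of_eval_smul fun c v => ?_) _
    rw [eval_denomPoly, eval_denomPoly, frameDenom_smul hf.2.1 (by omega)]
  · refine fun t => isHomogeneous_of_eval_smul fun c v => ?_
    rw [eval_resultantPoly, eval_resultantPoly,
      frameResultant_smul hf.2.1 (by omega) (by omega)]
    congr 2
    obtain ⟨s, rfl⟩ := Nat.exists_eq_add_of_le hid
    have e1 : i + 2 + s - i = s + 2 := by omega
    have e2 : i + 2 + s - 1 = i + 1 + s := by omega
    have e3 : i + 2 + s - i - 1 = s + 1 := by omega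
    have e4 : i + 2 + s - 2 = i + s := by omega
    have e5 : 2 * (s + 2) - 1 = 2 * s + 3 := by omega
    rw [e3, e1, e2, e4, e5]
    ring
  · intro s t
    let m : MvPolynomial (Fin 4) k := ∑ a, C (μ a) * X a
    have hm : ∀ v, eval v m = lin μ v := by
      intro v; simp [m, lin]
    have hm1 : m.IsHomogeneous 1 := isHomogeneous_of_eval_smul fun c v => by
      rw [hm, hm, lin_smul, pow_one]
    have hm0 : m ≠ 0 := by
      intro h
      obtain ⟨a, ha⟩ := Function.ne_iff.mp hμ
      have := hm (Pi.single a 1)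
      rw [h, map_zero] at this
      exact ha (by simpa [lin, Pi.single_apply] using this.symm)
    refine (hp.dvd_mul.mp ?_).resolve_left (not_dvd_of_isHomogeneous_one hf (by omega) hm1 hm0)
    refine IsSmooth.dvd_of_forall_eval hf (by omega) fun P hP => ?_
    rw [map_mul, hm]
    by_cases hμP : lin μ P = 0
    · rw [hμP, zero_mul]
    have hP0 : P ≠ 0 := by
      rintro rfl
      simp [lin] at hμP
    rw [map_sub, map_mul, map_mul, map_pow, map_pow, eval_denomPoly, eval_denomPoly,
      eval_resultantPoly, eval_resultantPoly,
      frameResultant_change hf (by omega) (by omega) hP0 (hosc P hP) hμP, sub_self, mul_zero]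
  · intro v hv hfv
    obtain ⟨t, ht⟩ := exists_frameDenom_ne_zero hf hv hfv
    refine ⟨t, ?_⟩
    rw [map_pow, eval_denomPoly]
    exact pow_ne_zero _ ht
  · rintro ⟨q, hq⟩
    apply hne₀
    rw [← eval_resultantPoly, hq, map_mul, hP₀, zero_mul]
  · intro W hW P hP t ht
    have hW : IsLineOn f W := by simpa using hW
    rw [map_pow, eval_denomPoly] at ht
    have ht' := pow_ne_zero_iff (n := d * i) (mul_ne_zero (by omega) (by omega)) |>.mp ht
    rw [eval_resultantPoly]
    have hfP := hW.2 P hP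
    obtain ⟨D, hD, hDP⟩ : ∃ D ∈ W, D ∉ k ∙ P := by
      by_contra! h
      have h1 : W ≤ k ∙ P := h
      have h2 := Submodule.finrank_mono h1
      have h3 := finrank_span_le_card (R := k) ({P} : Set (Fin 4 → k))
      rw [hW.1] at h2
      simp at h3
      omega
    have htan : polar f 1 P D = 0 := IsLineOn.polar_eq_zero hW hP hD 1
    obtain ⟨x, b, c, rfl⟩ :=
      exists_tangent_coordinates ht' (polar_one_self_eq_zero hf.2.1 hfP) htan
    set V := b • tangentVec f P (t 0) (t 1) + c • tangentVec f P (t 0) (t 2) with hV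
    have hVW : V ∈ W := by
      have := W.sub_mem hD (W.smul_mem x hP)
      rwa [add_assoc, add_sub_cancel_left] at this
    have hbc : b ≠ 0 ∨ c ≠ 0 := by
      by_contra! h
      apply hDP
      rw [h.1, h.2]
      simpa using Submodule.smul_mem _ x (Submodule.mem_span_singleton_self P)
    refine resultant_eq_zero_of_binEval (by omega) (pencil_polarPoly P _ _).1
      (pencil_residualPoly μ P _ _).1 hbc ?_ ?_
    · rw [(pencil_polarPoly P _ _).2]
      exact IsLineOn.polar_eq_zero hW hP hVW i
    · rw [(pencil_residualPoly μ P _ _).2, biEval_residualPoly]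
      exact Finset.sum_eq_zero fun j _ => by
        rw [IsLineOn.polar_eq_zero hW hP hVW, mul_zero]

lemma bound_lt {d i : ℕ} (hi : 2 ≤ i) (hid : i + 2 ≤ d) :
    d * (d * i * (d - 2) + i * (2 * (d - i) - 1) + (d - i) ^ 2) <
      d ^ 2 * (d ^ 2 - 3 * d + 3) := by
  obtain ⟨s, rfl⟩ := Nat.exists_eq_add_of_le hid
  obtain ⟨r, rfl⟩ := Nat.exists_eq_add_of_le hi
  have e1 : 2 + r + 2 + s - (2 + r) = s + 2 := by omega
  have e2 : 2 + r + 2 + s - 2 = r + s + 2 := by omega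
  have e3 : 2 * (s + 2) - 1 = 2 * s + 3 := by omega
  have e4 : (2 + r + 2 + s) ^ 2 - 3 * (2 + r + 2 + s) + 3 = (r + s + 4) * (r + s + 1) + 3 := by
    have : (2 + r + 2 + s) ^ 2 = 3 * (2 + r + 2 + s) + (r + s + 4) * (r + s + 1) := by ring
    rw [this, Nat.add_sub_cancel_left]
  rw [e1, e2, e3, e4, pow_two (2 + r + 2 + s), mul_assoc (2 + r + 2 + s) (2 + r + 2 + s)]
  refine Nat.mul_lt_mul_of_pos_left (k := 2 + r + 2 + s) ?_ (by omega)
  ring_nf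
  nlinarith [Nat.zero_le (r * s), Nat.zero_le (r*s*s), Nat.zero_le (r*r*s)]

/-- On a smooth surface with the maximal number of lines all polar forms of intermediate order
vanish on the tangent planes. -/
theorem polar_eq_zero_of_ncard [IsAlgClosed k] (hf : IsSmoothSurface f d)
    (hfin : {W | IsLineOn f W}.Finite)
    (hcard : {W | IsLineOn f W}.ncard = d ^ 2 * (d ^ 2 - 3 * d + 3)) (j : ℕ) :
    2 ≤ j → j + 2 ≤ d → ∀ P D, eval P f = 0 → polar f 1 P D = 0 → polar f j P D = 0 := by
  induction j using Nat.strong_induction_on with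
  | _ j ih =>
    intro hj hjd
    by_contra! hne
    have := card_lines_le_of_polar_ne_zero hf hj hjd
      (fun P hP => ⟨hP, fun D hD l hl hlj => ih l hlj hl (by omega) P D hP hD⟩) hne hfin
    have := bound_lt hj hjd
    omega

end Section

section Meeting

variable {k V : Type*} [Field k] [AddCommGroup V] [Module k V]

lemma inf_ne_bot_iff {W W' : Submodule k V} : W ⊓ W' ≠ ⊥ ↔ ∃ v, v ≠ 0 ∧ v ∈ W ∧ v ∈ W' := by
  rw [Submodule.ne_bot_iff]
  simp only [Submodule.mem_inf]
  exact ⟨fun ⟨v, h, h0⟩ => ⟨v, h0, h⟩, fun ⟨v, h0, h⟩ => ⟨v, h, h0⟩⟩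

lemma linearIndependent_of_notMem {U : Submodule k V} {x y : V} (hx : x ∈ U) (hx0 : x ≠ 0)
    (hy : y ∉ U) : LinearIndependent k ![x, y] := by
  rw [LinearIndependent.pair_iff' hx0]
  rintro a rfl
  exact hy (U.smul_mem a hx)

end Meeting

section Section

variable {k : Type*} [Field k] [IsAlgClosed k] {f : MvPolynomial (Fin 4) k} {d : ℕ}

lemma card_lines_le_of_linear_form (hf : IsSmoothSurface f d) (hd : 2 ≤ d)
    {l : MvPolynomial (Fin 4) k} (hl : l.IsHomogeneous 1) (hl0 : l ≠ 0)
    (L : Finset (Submodule k (Fin 4 → k))) (hL : ∀ W ∈ L, IsLineOn f W)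
    (hvan : ∀ W ∈ L, ∀ v ∈ W, eval v l = 0) : L.card ≤ d := by
  have := card_lines_le_of_section (ι := Unit) (a := 0) (n := 1) (t₀ := ()) (by omega)
    (IsSmooth.prime hf (by omega)) hf.2.1 (fun _ => 1) (fun _ => l)
    (fun _ => isHomogeneous_one _ _) (fun _ => hl) (by simp) (by simp)
    (not_dvd_of_isHomogeneous_one hf hd hl hl0) L hL (fun W hW v hv _ _ => hvan W hW v hv)
  simpa using this

/-- A family of at least two pairwise meeting lines is either concurrent or coplanar. -/
lemma exists_linear_form_of_pairwise_meet (hf : IsSmoothSurface f d)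
    {A B : Submodule k (Fin 4 → k)} (hA : IsLineOn f A) (hB : IsLineOn f B) (hAB : A ≠ B)
    (hmeet : ∀ W W', IsLineOn f W → IsLineOn f W' → W ⊓ W' ≠ ⊥) :
    ∃ l : MvPolynomial (Fin 4) k, l.IsHomogeneous 1 ∧ l ≠ 0 ∧
      ∀ W, IsLineOn f W → ∀ v ∈ W, eval v l = 0 := by
  classical
  obtain ⟨P, hP0, hPA, hPB⟩ := inf_ne_bot_iff.mp (hmeet A B hA hB)
  by_cases hall : ∀ W, IsLineOn f W → P ∈ W
  · obtain ⟨a, ha⟩ := IsSmooth.exists_grad_ne hf hP0 (hA.2 P hPA)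
    have hev : ∀ v, eval v (∑ i, C (eval P (pderiv i f)) * X i : MvPolynomial (Fin 4) k) =
        polar f 1 P v := by
      intro v; simp [polar_one']
    refine ⟨∑ i, C (eval P (pderiv i f)) * X i, ?_, ?_, ?_⟩
    · exact IsHomogeneous.sum _ _ _ fun i _ => isHomogeneous_C_mul_X _ _
    · intro h
      have := hev (Pi.single a 1)
      rw [h, map_zero, polar_one'] at this
      simp [Pi.single_apply] at this
      exact ha this.symm
    · intro W hW v hv
      rw [hev, IsLineOn.polar_eq_zero hW (hall W hW) hv]
  · push Not at hall
    obtain ⟨U, hU, hPU⟩ := hall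
    obtain ⟨Q, hQ0, hQU, hQA⟩ := inf_ne_bot_iff.mp (hmeet U A hU hA)
    obtain ⟨R, hR0, hRU, hRB⟩ := inf_ne_bot_iff.mp (hmeet U B hU hB)
    have hUQ : ∀ x ∈ U, x ≠ 0 → LinearIndependent k ![x, P] := fun x hx hx0 =>
      linearIndependent_of_notMem hx hx0 hPU
    have hAeq := eq_span_pair hA.1 (hUQ Q hQU hQ0) hQA hPA
    have hBeq := eq_span_pair hB.1 (hUQ R hRU hR0) hRB hPB
    have hQB : Q ∉ B := fun h => hAB
      (eq_of_mem_of_mem hA.1 hB.1 (hUQ Q hQU hQ0) hQA hPA h hPB)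
    have hUeq := eq_span_pair hU.1 (linearIndependent_of_notMem hRB hR0 hQB) hRU hQU
    let H : Submodule k (Fin 4 → k) := Submodule.span k {P, Q, R}
    have hAH : A ≤ H := by
      rw [hAeq]; exact Submodule.span_mono (by intro x; simp; tauto)
    have hBH : B ≤ H := by
      rw [hBeq]; exact Submodule.span_mono (by intro x; simp; tauto)
    have hUH : U ≤ H := by
      rw [hUeq]; exact Submodule.span_mono (by intro x; simp; tauto)
    have hpair : ∀ {W x y}, IsLineOn f W → LinearIndependent k ![x, y] → x ∈ W → y ∈ W →
        x ∈ H → y ∈ H → W ≤ H := by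
      intro W x y hW hxy hx hy hx' hy'
      rw [eq_span_pair hW.1 hxy hx hy, Submodule.span_le]
      rintro _ (rfl | rfl) <;> assumption
    have hWH : ∀ W, IsLineOn f W → W ≤ H := by
      intro W hW
      by_cases hPW : P ∈ W
      · obtain ⟨x, hx0, hxW, hxU⟩ := inf_ne_bot_iff.mp (hmeet W U hW hU)
        exact hpair hW (hUQ x hxU hx0) hxW hPW (hUH hxU) (hAH hPA)
      · obtain ⟨x, hx0, hxW, hxA⟩ := inf_ne_bot_iff.mp (hmeet W A hW hA)
        obtain ⟨y, hy0, hyW, hyB⟩ := inf_ne_bot_iff.mp (hmeet W B hW hB)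
        have hxB : x ∉ B := fun h => hAB (eq_of_mem_of_mem hA.1 hB.1
          (linearIndependent_of_notMem hxW hx0 hPW) hxA hPA h hPB)
        exact hpair hW (linearIndependent_of_notMem hyB hy0 hxB) hyW hxW (hBH hyB) (hAH hxA)
    have hH : ∃ v, v ∉ H := by
      by_contra! h
      have h1 : H = ⊤ := by ext v; simp [h v]
      have h2 := finrank_span_finset_le_card (R := k) ({P, Q, R} : Finset (Fin 4 → k))
      have h3 : ((({P, Q, R} : Finset (Fin 4 → k)) : Set (Fin 4 → k))) = {P, Q, R} := by simp
      rw [Set.finrank, h3] at h2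
      change Module.finrank k H ≤ _ at h2
      rw [h1, finrank_top] at h2
      have := Finset.card_le_three (a := P) (b := Q) (c := R)
      simp at h2
      omega
    obtain ⟨v, hv⟩ := hH
    obtain ⟨l, h1, h2, h3⟩ := exists_linear_form hv
    refine ⟨l, h1, ?_, fun W hW v hv => h3 v (hWH W hW hv)⟩
    rintro rfl
    simp at h2

theorem exists_skew_lines (hf : IsSmoothSurface f d) (hd : 2 ≤ d)
    (hfin : {W | IsLineOn f W}.Finite) (hcard : d < {W | IsLineOn f W}.ncard) :
    ∃ A B, IsLineOn f A ∧ IsLineOn f B ∧ A ⊓ B = ⊥ := by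
  by_contra! hmeet
  obtain ⟨A, hA, B, hB, hAB⟩ := (Set.one_lt_ncard_iff_nontrivial_and_finite.mp
    (show 1 < {W | IsLineOn f W}.ncard by omega)).1
  obtain ⟨l, h1, h2, h3⟩ := exists_linear_form_of_pairwise_meet hf hA hB hAB
    fun W W' hW hW' => hmeet W W' hW hW'
  have := card_lines_le_of_linear_form hf hd h1 h2 hfin.toFinset (by simp) (by simpa using h3)
  rw [← Set.ncard_eq_toFinset_card _ hfin] at this
  omega

end Section

section Coprime

variable {k : Type*} [Field k]

lemma eq_zero_of_sum_coprime {R : Type*} [Field R] {a b : Polynomial R} (hab : IsCoprime b a)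
    (hb : 0 < b.natDegree) (n : ℕ) (c : ℕ → Polynomial R)
    (hc : ∀ r, r ≤ n → (c r).natDegree < b.natDegree)
    (h : ∑ r ∈ Finset.range (n + 1), c r * b ^ r * a ^ (n - r) = 0) : ∀ r, r ≤ n → c r = 0 := by
  have hb0 : b ≠ 0 := by rintro rfl; simp at hb
  have hdvd : ∀ p : Polynomial R, p.natDegree < b.natDegree → b ∣ p → p = 0 := fun p hp hd =>
    Polynomial.eq_zero_of_dvd_of_natDegree_lt hd hp
  induction n generalizing c with
  | zero =>
    intro r hr
    obtain rfl : r = 0 := by omega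
    simpa using h
  | succ n ih =>
    rw [Finset.sum_range_succ'] at h
    have hfac : ∑ r ∈ Finset.range (n + 1), c (r + 1) * b ^ (r + 1) * a ^ (n + 1 - (r + 1)) =
        b * ∑ r ∈ Finset.range (n + 1), c (r + 1) * b ^ r * a ^ (n - r) := by
      rw [Finset.mul_sum]
      refine Finset.sum_congr rfl fun r _ => ?_
      rw [Nat.add_sub_add_right]; ring
    rw [hfac] at h
    have h0 : c 0 = 0 := by
      refine hdvd _ (hc 0 (by omega)) ?_
      have h1 : b ∣ c 0 * a ^ (n + 1) := by
        refine ⟨-∑ r ∈ Finset.range (n + 1), c (r + 1) * b ^ r * a ^ (n - r), ?_⟩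
        rw [pow_zero, mul_one, Nat.sub_zero] at h
        linear_combination h
      exact (hab.pow_right).dvd_of_dvd_mul_right h1
    rw [h0, zero_mul, zero_mul, add_zero, mul_eq_zero, or_iff_right hb0] at h
    have := ih (fun r => c (r + 1)) (fun r hr => hc (r + 1) (by omega)) h
    intro r hr
    cases r with
    | zero => exact h0
    | succ r => exact this r (by omega)

end Coprime

section Skew

variable {k : Type*} [Field k] {f : MvPolynomial (Fin 4) k} {d q : ℕ}
  {e₁ e₂ g₁ g₂ : Fin 4 → k}

/-- Two pairs of vectors spanning skew lines of `V(f)`. -/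
structure SkewPair (f : MvPolynomial (Fin 4) k) (e₁ e₂ g₁ g₂ : Fin 4 → k) : Prop where
  det : det4 e₁ e₂ g₁ g₂ ≠ 0
  left : ∀ s t : k, eval (s • e₁ + t • e₂) f = 0
  right : ∀ s t : k, eval (s • g₁ + t • g₂) f = 0

lemma SkewPair.symm (h : SkewPair f e₁ e₂ g₁ g₂) : SkewPair f g₁ g₂ e₁ e₂ where
  det := by
    have : det4 g₁ g₂ e₁ e₂ = det4 e₁ e₂ g₁ g₂ := by
      rw [det4_eq, det4_eq]; ring
    rw [this]; exact h.det
  left := h.right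
  right := h.left

lemma SkewPair.polar_left [Infinite k] (h : SkewPair f e₁ e₂ g₁ g₂) (s t s' t' : k) (j : ℕ) :
    polar f j (s • e₁ + t • e₂) (s' • e₁ + t' • e₂) = 0 := by
  rw [polar, restr_eq_zero, Polynomial.coeff_zero]
  intro b
  have : s • e₁ + t • e₂ + b • (s' • e₁ + t' • e₂) = (s + b * s') • e₁ + (t + b * t') • e₂ := by
    module
  rw [this, h.left]

/-- The dehomogenized partial derivative in the direction `g` along the pencil `X • e₁ + e₂`. -/
noncomputable def derivAlong (f : MvPolynomial (Fin 4) k) (q : ℕ) (e₁ e₂ g : Fin 4 → k) :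
    Polynomial k := pencil (polarPoly f q) g e₁ e₂

lemma derivAlong_spec [Infinite k] (hf : f.IsHomogeneous (q + 1)) (e₁ e₂ g : Fin 4 → k) :
    (derivAlong f q e₁ e₂ g).natDegree ≤ q ∧ ∀ s t,
      binEval (derivAlong f q e₁ e₂ g) q s t = polar f 1 (s • e₁ + t • e₂) g := by
  have := pencil_form (H := polarPoly f q) (n := q)
    (fun c P D => biEval_polarPoly_smul_right c P D) g e₁ e₂
  refine ⟨this.1, fun s t => ?_⟩
  rw [derivAlong, this.2, biEval_polarPoly, polar_swap hf (by omega), Nat.add_sub_cancel_left]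

lemma eval_derivAlong [Infinite k] (hf : f.IsHomogeneous (q + 1)) (e₁ e₂ g : Fin 4 → k) (z : k) :
    (derivAlong f q e₁ e₂ g).eval z = polar f 1 (z • e₁ + e₂) g := by
  have := derivAlong_spec hf e₁ e₂ g
  rw [← binEval_one_right this.1, this.2, one_smul]

lemma coeff_derivAlong [Infinite k] (hf : f.IsHomogeneous (q + 1)) (e₁ e₂ g : Fin 4 → k) :
    (derivAlong f q e₁ e₂ g).coeff q = polar f 1 e₁ g := by
  have := (derivAlong_spec hf e₁ e₂ g).2 1 0
  rw [binEval_zero_right] at this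
  simpa using this

lemma SkewPair.exists_polar_ne_zero [Infinite k] (hf : IsSmoothSurface f d)
    (h : SkewPair f e₁ e₂ g₁ g₂) {s t : k} (hst : s ≠ 0 ∨ t ≠ 0) :
    polar f 1 (s • e₁ + t • e₂) g₁ ≠ 0 ∨ polar f 1 (s • e₁ + t • e₂) g₂ ≠ 0 := by
  by_contra! hcon
  have hli := linearIndependent_of_det4 h.det
  have hP0 : s • e₁ + t • e₂ ≠ 0 := by
    intro h0
    rw [Fintype.linearIndependent_iff] at hli
    have := hli ![s, t, 0, 0] (by simpa [Fin.sum_univ_four] using h0)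
    have h1 := this 0
    have h2 := this 1
    simp at h1 h2
    tauto
  obtain ⟨a, ha⟩ := IsSmooth.exists_grad_ne hf hP0 (h.left s t)
  apply ha
  obtain ⟨x, y, z, w, hD⟩ := exists_coordinates h.det (Pi.single a 1)
  have h1 : polar f 1 (s • e₁ + t • e₂) (Pi.single a 1) = 0 := by
    rw [hD, polar_one_add, polar_one_add, h.polar_left, polar_one_smul, polar_one_smul,
      hcon.1, hcon.2]
    simp
  rw [polar_one'] at h1
  simpa [Pi.single_apply] using h1

lemma SkewPair.isCoprime [IsAlgClosed k] (hf : IsSmoothSurface f (q + 1))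
    (h : SkewPair f e₁ e₂ g₁ g₂) :
    IsCoprime (derivAlong f q e₁ e₂ g₂) (derivAlong f q e₁ e₂ g₁) := by
  rw [Polynomial.isCoprime_iff_aeval_ne_zero_of_isAlgClosed k k]
  intro z
  simp only [Polynomial.coe_aeval_eq_eval, eval_derivAlong hf.2.1]
  have := h.exists_polar_ne_zero hf (s := z) (t := 1) (by simp)
  rw [one_smul] at this
  exact this.symm

/-- Normalization: the polar pairing of `e₁` with the second line is given by the second
coordinate. -/
def SkewPair.IsNormalized (f : MvPolynomial (Fin 4) k) (e₁ g₁ g₂ : Fin 4 → k) : Prop :=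
  polar f 1 e₁ g₁ = 0 ∧ polar f 1 e₁ g₂ ≠ 0

lemma SkewPair.natDegree_derivAlong [Infinite k] (hf : f.IsHomogeneous (q + 1))
    (hn : SkewPair.IsNormalized f e₁ g₁ g₂) : (derivAlong f q e₁ e₂ g₂).natDegree = q := by
  refine le_antisymm (derivAlong_spec hf e₁ e₂ g₂).1 (Polynomial.le_natDegree_of_ne_zero ?_)
  rw [coeff_derivAlong hf]
  exact hn.2

lemma binEval_eq_zero_of_coeff {g : Polynomial k} {n : ℕ} (h : ∀ r, r ≤ n → g.coeff r = 0)
    (b c : k) : binEval g n b c = 0 :=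
  Finset.sum_eq_zero fun r hr => by
    rw [h r (by simpa [Nat.lt_succ_iff] using hr), zero_mul, zero_mul]

/-- The form `f` has only terms of order `1` and `d - 1` along the second line. -/
lemma SkewPair.polar_eq_zero [IsAlgClosed k] (hf : IsSmoothSurface f (q + 1))
    (h : SkewPair f e₁ e₂ g₁ g₂) (hn : SkewPair.IsNormalized f e₁ g₁ g₂)
    {j : ℕ} (hj : 2 ≤ j) (hjq : j < q)
    (hpol : ∀ P D, eval P f = 0 → polar f 1 P D = 0 → polar f j P D = 0) (s t β γ : k) :
    polar f j (s • e₁ + t • e₂) (β • g₁ + γ • g₂) = 0 := by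
  have hhom := hf.2.1
  set a := derivAlong f q e₁ e₂ g₁
  set b := derivAlong f q e₁ e₂ g₂
  have hbdeg : b.natDegree = q := SkewPair.natDegree_derivAlong hhom hn
  have hform := fun P => pencil_form (H := polarPoly f j) (n := j)
    (fun c P D => biEval_polarPoly_smul_right c P D) P g₁ g₂
  have hform' := fun X => pencil_form (H := polarPoly f (q + 1 - j)) (n := q + 1 - j)
    (fun c P D => biEval_polarPoly_smul_right c P D) X e₁ e₂
  have hswap : ∀ X s t, binEval (pencil (polarPoly f (q + 1 - j)) X e₁ e₂) (q + 1 - j) s t =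
      polar f j (s • e₁ + t • e₂) X := by
    intro X s t
    rw [(hform' X).2, biEval_polarPoly, polar_swap hhom (by omega)]
    congr 1
    omega
  let P : Fin 4 → Polynomial k := fun i => Polynomial.X * Polynomial.C (e₁ i) + Polynomial.C (e₂ i)
  let W : Polynomial (Polynomial k) := pencil (polarPoly f j) P (Polynomial.C ∘ g₁)
    (Polynomial.C ∘ g₂)
  have hWmap : ∀ z, W.map (Polynomial.evalRingHom z) =
      pencil (polarPoly f j) (z • e₁ + e₂) g₁ g₂ := by
    intro z
    have := pencil_map (polarPoly f j) ((Polynomial.aeval z : Polynomial k →ₐ[k] k)) P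
      (Polynomial.C ∘ g₁) (Polynomial.C ∘ g₂)
    have e : ((Polynomial.aeval z : Polynomial k →ₐ[k] k) : Polynomial k →+* k) =
        Polynomial.evalRingHom z := by
      ext <;> simp
    rw [e] at this
    rw [this]
    congr 1 <;> funext i <;> (simp [P]; try ring)
  have hcoef : ∀ r z, (W.coeff r).eval z =
      (pencil (polarPoly f j) (z • e₁ + e₂) g₁ g₂).coeff r := by
    intro r z
    rw [← hWmap, Polynomial.coeff_map, Polynomial.coe_evalRingHom]
  have hdeg : ∀ r, (W.coeff r).natDegree ≤ q + 1 - j := by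
    intro r
    rw [Polynomial.natDegree_le_iff_coeff_eq_zero]
    intro m hm
    have h0 : ∑ l ∈ Finset.range (W.natDegree + 1),
        Polynomial.C ((W.coeff l).coeff m) * Polynomial.X ^ l = (0 : Polynomial k) := by
      apply Polynomial.funext
      intro τ
      have h1 : W.eval (Polynomial.C τ) =
          pencil (polarPoly f (q + 1 - j)) (τ • g₁ + g₂) e₁ e₂ := by
        apply Polynomial.funext
        intro z
        have h2 : (W.eval (Polynomial.C τ)).eval z =
            (W.map (Polynomial.evalRingHom z)).eval τ := by
          have := Polynomial.eval_map_apply (Polynomial.evalRingHom z) (Polynomial.C τ) (p := W)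
          simpa using this.symm
        rw [h2, hWmap, eval_pencil, eval_pencil, biEval_polarPoly, biEval_polarPoly,
          polar_swap hhom (by omega)]
      have h3 := congrArg (fun p => Polynomial.coeff p m) h1
      rw [Polynomial.coeff_eq_zero_of_natDegree_lt ((hform' _).1.trans_lt hm),
        Polynomial.eval_eq_sum_range, Polynomial.finsetSum_coeff] at h3
      simp only [Polynomial.eval_finsetSum, Polynomial.eval_mul, Polynomial.eval_C,
        Polynomial.eval_pow, Polynomial.eval_X, Polynomial.eval_zero]
      rw [← h3]
      refine Finset.sum_congr rfl fun l _ => ?_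
      rw [← Polynomial.C_pow, Polynomial.coeff_mul_C]
    by_cases hr : r ≤ W.natDegree
    · have := congrArg (fun p => Polynomial.coeff p r) h0
      simpa [Polynomial.finsetSum_coeff, Polynomial.coeff_C_mul, Polynomial.coeff_X_pow,
        Nat.lt_succ_iff, hr] using this
    · rw [Polynomial.coeff_eq_zero_of_natDegree_lt (not_le.mp hr), Polynomial.coeff_zero]
  have hsum : ∑ r ∈ Finset.range (j + 1), W.coeff r * b ^ r * (-a) ^ (j - r) = 0 := by
    apply Polynomial.funext
    intro z
    have h1 : ∑ r ∈ Finset.range (j + 1), (W.coeff r).eval z * b.eval z ^ r *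
        (-a.eval z) ^ (j - r) = 0 := by
      simp only [hcoef]
      refine ((hform (z • e₁ + e₂)).2 (b.eval z) (-a.eval z)).trans ?_
      rw [biEval_polarPoly]
      apply hpol
      · have := h.left z 1
        rwa [one_smul] at this
      · rw [polar_one_add, polar_one_smul, polar_one_smul, eval_derivAlong hhom,
          eval_derivAlong hhom]
        ring
    simpa [Polynomial.eval_finsetSum] using h1
  have hz := eq_zero_of_sum_coprime (h.isCoprime hf).neg_right (by rw [hbdeg]; omega) j
    (fun r => W.coeff r)
    (fun r _ => (hdeg r).trans_lt (by rw [hbdeg]; omega)) hsum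
  have hzero : ∀ X, (∃ β γ : k, X = β • g₁ + γ • g₂) →
      pencil (polarPoly f (q + 1 - j)) X e₁ e₂ = 0 := by
    rintro _ ⟨β, γ, rfl⟩
    apply Polynomial.funext
    intro z
    rw [← binEval_one_right (hform' _).1, hswap, one_smul, ← biEval_polarPoly, ← (hform _).2,
      Polynomial.eval_zero]
    refine binEval_eq_zero_of_coeff (fun r hr => ?_) _ _
    rw [← hcoef, hz r hr, Polynomial.eval_zero]
  rw [← hswap, hzero _ ⟨β, γ, rfl⟩]
  exact binEval_eq_zero_of_coeff (by simp) _ _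

end Skew

section Frobenius

variable {k : Type*} [Field k] [IsAlgClosed k] {f : MvPolynomial (Fin 4) k} {q : ℕ}
  {e₁ e₂ g₁ g₂ : Fin 4 → k}

lemma SkewPair.eval_add (hf : IsSmoothSurface f (q + 1)) (hq : 3 ≤ q)
    (h : SkewPair f e₁ e₂ g₁ g₂) (hn : SkewPair.IsNormalized f e₁ g₁ g₂)
    (hpol : ∀ j, 2 ≤ j → j < q → ∀ P D, eval P f = 0 → polar f 1 P D = 0 → polar f j P D = 0)
    (s t β γ : k) : eval ((s • e₁ + t • e₂) + (β • g₁ + γ • g₂)) f =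
      polar f 1 (s • e₁ + t • e₂) (β • g₁ + γ • g₂) +
      polar f 1 (β • g₁ + γ • g₂) (s • e₁ + t • e₂) := by
  set P := s • e₁ + t • e₂ with hP
  set D := β • g₁ + γ • g₂ with hD
  have h1 := eval_smul_add_smul hf.2.1 P D 1 1
  simp only [one_smul, one_pow, mul_one, one_mul] at h1
  rw [h1, Finset.sum_range_succ, Finset.sum_range_succ, polar_swap hf.2.1 (le_refl _),
    polar_swap hf.2.1 (Nat.le_succ q), Nat.sub_self, Nat.add_sub_cancel_left, polar_zero', hD,
    h.right, add_zero, ← hD]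
  congr 1
  rw [Finset.sum_eq_single 1]
  · intro j hj hj1
    have := Finset.mem_range.mp hj
    obtain rfl | hj2 : j = 0 ∨ 2 ≤ j := by omega
    · rw [polar_zero', hP, h.left]
    · exact h.polar_eq_zero hf hn hj2 this (hpol j hj2 this) s t β γ
  · intro h1
    exact absurd (Finset.mem_range.mpr (by omega)) h1

lemma SkewPair.hasseDeriv_eq (hf : IsSmoothSurface f (q + 1)) (hq : 3 ≤ q)
    (h : SkewPair f e₁ e₂ g₁ g₂) (hn : SkewPair.IsNormalized f e₁ g₁ g₂)
    (hpol : ∀ j, 2 ≤ j → j < q → ∀ P D, eval P f = 0 → polar f 1 P D = 0 → polar f j P D = 0)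
    {l : ℕ} (hl : 1 ≤ l) (hlq : l + 1 < q) :
    derivAlong f q e₁ e₂ g₂ * Polynomial.hasseDeriv l (derivAlong f q e₁ e₂ g₁) =
    derivAlong f q e₁ e₂ g₁ * Polynomial.hasseDeriv l (derivAlong f q e₁ e₂ g₂) := by
  have hhom := hf.2.1
  have hev := eval_derivAlong (e₁ := e₁) (e₂ := e₂) hhom
  set a := derivAlong f q e₁ e₂ g₁
  set b := derivAlong f q e₁ e₂ g₂
  apply Polynomial.funext
  intro z
  let D : Fin 4 → k := e₁ + (b.eval z • g₁ + (-a.eval z) • g₂)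
  have hP : eval (z • e₁ + e₂) f = 0 := by
    have := h.left z 1
    rwa [one_smul] at this
  have hD1 : polar f 1 (z • e₁ + e₂) D = 0 := by
    have h0 : polar f 1 (z • e₁ + e₂) e₁ = 0 := by
      have := h.polar_left z 1 1 0 1
      simpa using this
    rw [polar_one_add, polar_one_add, polar_one_smul, polar_one_smul, h0, ← hev, ← hev]
    ring
  have hD := hpol (l + 1) (by omega) hlq _ _ hP hD1
  set T : Polynomial k := Polynomial.C (b.eval z) * Polynomial.taylor z a +
    Polynomial.C (-a.eval z) * Polynomial.taylor z b with hT
  have hrestr : ∃ U : Polynomial k, restr f (z • e₁ + e₂) D =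
      Polynomial.X * T + Polynomial.X ^ q * U := by
    set X₀ := b.eval z • g₁ + (-a.eval z) • g₂ with hX₀
    refine ⟨(Polynomial.X + Polynomial.C z) * Polynomial.C (polar f 1 X₀ e₁) +
      Polynomial.C (polar f 1 X₀ e₂), ?_⟩
    apply Polynomial.funext
    intro c
    have e : z • e₁ + e₂ + c • D = ((z + c) • e₁ + (1 : k) • e₂) +
        ((c * b.eval z) • g₁ + (c * -a.eval z) • g₂) := by
      simp only [D]; module
    have e' : (c * b.eval z) • g₁ + (c * -a.eval z) • g₂ = c • X₀ := by
      rw [hX₀]; module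
    rw [eval_restr, aeval_eq_eval, e]
    rw [h.eval_add hf hq hn hpol, e', polar_one_smul,
      polar_smul_left hhom (by omega), Nat.add_sub_cancel, polar_one_add, polar_one_smul, one_smul,
      hX₀, polar_one_add, polar_one_smul, polar_one_smul, ← hev, ← hev]
    rw [show derivAlong f q e₁ e₂ g₁ = a from rfl, show derivAlong f q e₁ e₂ g₂ = b from rfl]
    simp [hT, Polynomial.taylor_eval, add_comm z c]
  obtain ⟨U, hU⟩ := hrestr
  rw [polar, hU, Polynomial.coeff_add, Polynomial.coeff_X_mul, Polynomial.coeff_X_pow_mul',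
    if_neg (by omega), add_zero, hT, Polynomial.coeff_add, Polynomial.coeff_C_mul,
    Polynomial.coeff_C_mul, Polynomial.taylor_coeff, Polynomial.taylor_coeff] at hD
  rw [Polynomial.eval_mul, Polynomial.eval_mul]
  linear_combination hD

lemma SkewPair.coeff_eq_zero (hf : IsSmoothSurface f (q + 1)) (hq : 3 ≤ q)
    (h : SkewPair f e₁ e₂ g₁ g₂) (hn : SkewPair.IsNormalized f e₁ g₁ g₂)
    (hpol : ∀ j, 2 ≤ j → j < q → ∀ P D, eval P f = 0 → polar f 1 P D = 0 → polar f j P D = 0) :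
    (∀ l, 1 ≤ l → l < q → (q.choose l : k) = 0) ∧
    (∀ n, 1 ≤ n → n < q → (derivAlong f q e₁ e₂ g₁).coeff n = 0) ∧
    (∀ n, 1 ≤ n → n < q → (derivAlong f q e₁ e₂ g₂).coeff n = 0) := by
  have hasse := fun l h1 h2 => h.hasseDeriv_eq hf hq hn hpol (l := l) h1 h2
  have hcop := h.isCoprime hf
  have hbdeg := SkewPair.natDegree_derivAlong (e₂ := e₂) hf.2.1 hn
  set a := derivAlong f q e₁ e₂ g₁
  set b := derivAlong f q e₁ e₂ g₂
  have hb0 : b ≠ 0 := by intro h0; rw [h0] at hbdeg; simp at hbdeg; omega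
  have hb : ∀ l, 1 ≤ l → l + 1 < q → Polynomial.hasseDeriv l b = 0 := by
    intro l h1 h2
    refine Polynomial.eq_zero_of_dvd_of_natDegree_lt
      (hcop.dvd_of_dvd_mul_left ⟨_, (hasse l h1 h2).symm⟩) ?_
    have := Polynomial.natDegree_hasseDeriv_le b l
    omega
  have ha : ∀ l, 1 ≤ l → l + 1 < q → Polynomial.hasseDeriv l a = 0 := by
    intro l h1 h2
    have := hasse l h1 h2
    rw [hb l h1 h2, mul_zero] at this
    exact (mul_eq_zero.mp this).resolve_left hb0
  have key : ∀ p : Polynomial k, (∀ l, 1 ≤ l → l + 1 < q → Polynomial.hasseDeriv l p = 0) →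
      ∀ l n, 1 ≤ l → l + 1 < q → l ≤ n → (n.choose l : k) * p.coeff n = 0 := by
    intro p hp l n h1 h2 hln
    have := Polynomial.hasseDeriv_coeff l p (n - l)
    rwa [hp l h1 h2, Polynomial.coeff_zero, Nat.sub_add_cancel hln, eq_comm] at this
  have hbq : b.coeff q ≠ 0 := by rw [← hbdeg]; simpa using hb0
  have hch : ∀ l, 1 ≤ l → l + 1 < q → (q.choose l : k) = 0 := fun l h1 h2 =>
    (mul_eq_zero.mp (key b hb l q h1 h2 (by omega))).resolve_right hbq
  have hq0 : (q : k) = 0 := by simpa using hch 1 le_rfl (by omega)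
  have hcoef : ∀ p : Polynomial k, (∀ l, 1 ≤ l → l + 1 < q → Polynomial.hasseDeriv l p = 0) →
      ∀ n, 1 ≤ n → n < q → p.coeff n = 0 := by
    intro p hp n h1 h2
    by_cases hn : n + 1 < q
    · simpa using key p hp n n h1 hn le_rfl
    · have := key p hp 1 n le_rfl (by omega) h1
      obtain rfl : q = n + 1 := by omega
      push_cast at hq0
      rw [Nat.choose_one_right, eq_neg_of_add_eq_zero_left hq0] at this
      simpa using this
  refine ⟨fun l h1 h2 => ?_, hcoef a ha, hcoef b hb⟩
  by_cases hl : l + 1 < q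
  · exact hch l h1 hl
  · obtain rfl : q = l + 1 := by omega
    rw [Nat.choose_succ_self_right]
    exact hq0

end Frobenius

section PrimePower

lemma exists_prime_pow_of_choose {k : Type*} [Field k] {q : ℕ} (hq : 2 ≤ q)
    (h : ∀ l, 1 ≤ l → l < q → (q.choose l : k) = 0) :
    ∃ p e : ℕ, p.Prime ∧ CharP k p ∧ 1 ≤ e ∧ q = p ^ e := by
  obtain ⟨p, hp⟩ := CharP.exists k
  have hq0 : (q : k) = 0 := by simpa using h 1 le_rfl (by omega)
  have hpq : p ∣ q := (CharP.cast_eq_zero_iff k p q).mp hq0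
  have hprime : p.Prime := by
    refine (CharP.char_is_prime_or_zero k p).resolve_right ?_
    rintro rfl
    rw [Nat.zero_dvd] at hpq
    omega
  have := Fact.mk hprime
  have hpow := Choose.eq_pow_multiplicity_of_choose_modEq_zero_nat (p := p) (n := q) (by omega) (by
    intro i hi
    rw [Finset.mem_Icc] at hi
    rw [Nat.modEq_zero_iff_dvd, ← CharP.cast_eq_zero_iff k p]
    exact h i hi.1 (by omega))
  refine ⟨p, multiplicity p q, hprime, hp, ?_, hpow⟩
  by_contra! he
  rw [Nat.lt_one_iff.mp he, pow_zero] at hpow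
  omega

end PrimePower

section TwoVariables

variable {k : Type*} [Field k] [IsAlgClosed k]

lemma exists_eval_eq_zero_of_natDegree_pos {p : Polynomial k} (hp : 0 < p.natDegree) :
    ∃ s, p.eval s = 0 :=
  IsAlgClosed.exists_root p (by
    rw [Polynomial.degree_eq_natDegree (by rintro rfl; simp at hp)]
    exact_mod_cast hp.ne')

lemma exists_two_zeros {Q : ℕ} (hQ : 2 ≤ Q) (hQ0 : (Q : k) = 0) {m₁ m₂ m₃ m₄ : k}
    (hdet : m₁ * m₄ - m₂ * m₃ ≠ 0) : ∃ s t s' t' : k, s * t' - t * s' ≠ 0 ∧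
      s * (m₁ * s ^ Q + m₂ * t ^ Q) + t * (m₃ * s ^ Q + m₄ * t ^ Q) = 0 ∧
      s' * (m₁ * s' ^ Q + m₂ * t' ^ Q) + t' * (m₃ * s' ^ Q + m₄ * t' ^ Q) = 0 := by
  have hQ1 : 1 < Q := by omega
  by_cases h1 : m₁ = 0
  · subst h1
    have h3 : m₃ ≠ 0 := by rintro rfl; simp at hdet
    let p : Polynomial k := Polynomial.C m₃ * Polynomial.X ^ Q +
      (Polynomial.C m₂ * Polynomial.X + Polynomial.C m₄)
    have hp : p.natDegree = Q := by
      simp only [p]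
      compute_degree!
      all_goals first | omega | simp [show Q ≠ 0 by omega, show Q ≠ 1 by omega, h3]
    obtain ⟨s, hs⟩ := exists_eval_eq_zero_of_natDegree_pos (p := p) (by omega)
    refine ⟨1, 0, s, 1, by simp, by simp [show Q ≠ 0 by omega], ?_⟩
    simp [p] at hs
    simp
    linear_combination hs
  · let p : Polynomial k := Polynomial.C m₁ * Polynomial.X ^ (Q + 1) +
      (Polynomial.C m₃ * Polynomial.X ^ Q + (Polynomial.C m₂ * Polynomial.X + Polynomial.C m₄))
    have hp : p.natDegree = Q + 1 := by
      simp only [p]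
      compute_degree!
      simp [show Q ≠ 0 by omega, h1]
    have heval : ∀ s, p.eval s = 0 →
        s * (m₁ * s ^ Q + m₂ * 1 ^ Q) + 1 * (m₃ * s ^ Q + m₄ * 1 ^ Q) = 0 := by
      intro s hs
      simp [p] at hs
      simp
      linear_combination hs
    obtain ⟨s, hs⟩ := exists_eval_eq_zero_of_natDegree_pos (p := p) (by omega)
    obtain ⟨r, hr⟩ := Polynomial.dvd_iff_isRoot.mpr hs
    have hp0 : p ≠ 0 := by intro h; rw [h] at hp; simp at hp
    have hr0 : r ≠ 0 := by rintro rfl; rw [mul_zero] at hr; exact hp0 hr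
    have hrdeg : r.natDegree = Q := by
      have := Polynomial.natDegree_mul (Polynomial.X_sub_C_ne_zero s) hr0
      rw [← hr, hp, Polynomial.natDegree_X_sub_C] at this
      omega
    obtain ⟨s', hs'⟩ := exists_eval_eq_zero_of_natDegree_pos (p := r) (by omega)
    refine ⟨s, 1, s', 1, ?_, heval s hs, heval s' (by rw [hr, Polynomial.eval_mul, hs', mul_zero])⟩
    intro hss
    obtain rfl : s = s' := by linear_combination hss
    have hder : p.derivative.eval s = 0 := by
      rw [hr, Polynomial.derivative_mul]
      simp [hs']
    simp [p, hQ0, Polynomial.derivative_X_pow] at hder hs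
    apply hdet
    have h4 : m₃ * s ^ Q + m₄ = 0 := by
      linear_combination hs - s * hder
    have h0 : m₁ * s ^ Q + m₂ = 0 := hder
    linear_combination m₁ * h4 - m₃ * h0

lemma det_ne_zero_of_pow {q : ℕ} (hq : 0 < q) {u₁ v₁ u₂ v₂ : k}
    (h : ∀ s t : k, s ≠ 0 ∨ t ≠ 0 →
      s ^ q * u₁ + t ^ q * v₁ ≠ 0 ∨ s ^ q * u₂ + t ^ q * v₂ ≠ 0) : u₁ * v₂ - u₂ * v₁ ≠ 0 := by
  intro hdet
  have key : ∀ x y : k, x * u₁ + y * v₁ = 0 → x * u₂ + y * v₂ = 0 → x = 0 ∧ y = 0 := by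
    intro x y h1 h2
    obtain ⟨s, rfl⟩ := IsAlgClosed.exists_pow_nat_eq x hq
    obtain ⟨t, rfl⟩ := IsAlgClosed.exists_pow_nat_eq y hq
    by_contra hne
    have := h s t (by
      by_contra! h0
      apply hne
      rw [h0.1, h0.2, zero_pow hq.ne']
      simp)
    tauto
  obtain ⟨h1, h2⟩ := key v₁ (-u₁) (by ring) (by linear_combination -hdet)
  obtain ⟨h3, h4⟩ := key v₂ (-u₂) (by linear_combination hdet) (by ring)
  have := key 1 0 (by rw [neg_eq_zero.mp h2, h1]; simp) (by rw [neg_eq_zero.mp h4]; simp)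
  exact one_ne_zero this.1

lemma exists_scaling {q : ℕ} (hq : 2 ≤ q) {a c a' c' : k} (ha : a ≠ 0) (hc : c ≠ 0)
    (ha' : a' ≠ 0) (hc' : c' ≠ 0) : ∃ l m : k, l ≠ 0 ∧ m ≠ 0 ∧
      l ^ q * m * a' = a ∧ m ^ q * l * c' = c := by
  have hqq : 0 < q * q - 1 := by
    have : 2 * 2 ≤ q * q := Nat.mul_le_mul hq hq
    omega
  obtain ⟨l, hl⟩ := IsAlgClosed.exists_pow_nat_eq ((a / a') ^ q * c' / c) hqq
  have hl0 : l ≠ 0 := by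
    rintro rfl
    rw [zero_pow hqq.ne', eq_comm] at hl
    simp [*] at hl
  have hlq : l ^ (q * q) = l * ((a / a') ^ q * c' / c) := by
    rw [← hl, ← pow_succ', Nat.sub_add_cancel (by omega)]
  refine ⟨l, a / a' / l ^ q, hl0, by simp [*], by field_simp, ?_⟩
  rw [div_pow, ← pow_mul, hlq]
  field_simp

end TwoVariables

section Skew

variable {k : Type*} [Field k] {f : MvPolynomial (Fin 4) k} {q : ℕ} {e₁ e₂ g₁ g₂ : Fin 4 → k}

lemma det4_ne_zero_of_disjoint (he : LinearIndependent k ![e₁, e₂])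
    (hg : LinearIndependent k ![g₁, g₂])
    (h : Submodule.span k {e₁, e₂} ⊓ Submodule.span k {g₁, g₂} = ⊥) :
    det4 e₁ e₂ g₁ g₂ ≠ 0 := by
  apply det4_ne_zero
  rw [LinearIndependent.pair_iff] at he hg
  rw [Fintype.linearIndependent_iff]
  intro c hc
  simp [Fin.sum_univ_four] at hc
  have h1 : c 0 • e₁ + c 1 • e₂ = (-c 2) • g₁ + (-c 3) • g₂ := by
    rw [← sub_eq_zero, ← hc]; module
  have h2 : c 0 • e₁ + c 1 • e₂ ∈ Submodule.span k {e₁, e₂} ⊓ Submodule.span k {g₁, g₂} :=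
    ⟨Submodule.mem_span_pair.mpr ⟨_, _, rfl⟩, Submodule.mem_span_pair.mpr ⟨_, _, h1.symm⟩⟩
  rw [h, Submodule.mem_bot] at h2
  have h3 := he _ _ h2
  have h4 := hg _ _ (h1.symm.trans h2)
  intro i
  fin_cases i
  · exact h3.1
  · exact h3.2
  · simpa using h4.1
  · simpa using h4.2

lemma exists_skewPair {A B : Submodule k (Fin 4 → k)} (hA : IsLineOn f A) (hB : IsLineOn f B)
    (hAB : A ⊓ B = ⊥) : ∃ e₁ e₂ g₁ g₂, SkewPair f e₁ e₂ g₁ g₂ := by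
  obtain ⟨e₁, e₂, he, rfl⟩ := exists_basis_of_finrank_eq_two hA.1
  obtain ⟨g₁, g₂, hg, rfl⟩ := exists_basis_of_finrank_eq_two hB.1
  exact ⟨e₁, e₂, g₁, g₂, det4_ne_zero_of_disjoint he hg hAB,
    fun s t => hA.2 _ (Submodule.mem_span_pair.mpr ⟨_, _, rfl⟩),
    fun s t => hB.2 _ (Submodule.mem_span_pair.mpr ⟨_, _, rfl⟩)⟩

lemma binEval_eq_of_coeff {g : Polynomial k} {n : ℕ} (hn : 1 ≤ n)
    (h : ∀ r, 1 ≤ r → r < n → g.coeff r = 0) (b c : k) :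
    binEval g n b c = b ^ n * binEval g n 1 0 + c ^ n * binEval g n 0 1 := by
  obtain ⟨n, rfl⟩ := Nat.exists_eq_add_of_le' hn
  have : ∀ b c, binEval g (n + 1) b c =
      g.coeff (n + 1) * b ^ (n + 1) + g.coeff 0 * c ^ (n + 1) := by
    intro b c
    rw [binEval, Finset.sum_range_succ, Finset.sum_range_succ', Finset.sum_eq_zero]
    · simp; ring
    · intro r hr
      rw [Finset.mem_range] at hr
      rw [h (r + 1) (by omega) (by omega)]; simp
  rw [this, this 1, this 0]
  simp
  ring

variable [IsAlgClosed k]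

lemma SkewPair.exists_isNormalized (hf : IsSmoothSurface f (q + 1))
    (h : SkewPair f e₁ e₂ g₁ g₂) : ∃ g₁' g₂', SkewPair f e₁ e₂ g₁' g₂' ∧
      SkewPair.IsNormalized f e₁ g₁' g₂' ∧
      ∀ β γ : k, ∃ β' γ' : k, β • g₁ + γ • g₂ = β' • g₁' + γ' • g₂' := by
  have h1 := h.exists_polar_ne_zero hf (s := 1) (t := 0) (by simp)
  simp only [one_smul, zero_smul, add_zero] at h1
  by_cases h0 : polar f 1 e₁ g₁ = 0
  · exact ⟨g₁, g₂, h, ⟨h0, by tauto⟩, fun β γ => ⟨β, γ, rfl⟩⟩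
  · refine ⟨polar f 1 e₁ g₂ • g₁ - polar f 1 e₁ g₁ • g₂, g₁, ⟨?_, h.left, ?_⟩, ⟨?_, h0⟩, ?_⟩
    · have : det4 e₁ e₂ (polar f 1 e₁ g₂ • g₁ - polar f 1 e₁ g₁ • g₂) g₁ =
          polar f 1 e₁ g₁ * det4 e₁ e₂ g₁ g₂ := by
        rw [det4_eq, det4_eq]
        simp only [Pi.sub_apply, Pi.smul_apply, smul_eq_mul]
        ring
      rw [this]
      exact mul_ne_zero h0 h.det
    · intro s t
      have : s • (polar f 1 e₁ g₂ • g₁ - polar f 1 e₁ g₁ • g₂) + t • g₁ =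
          (s * polar f 1 e₁ g₂ + t) • g₁ + (- (s * polar f 1 e₁ g₁)) • g₂ := by module
      rw [this, h.right]
    · rw [polar_one_sub, polar_one_smul, polar_one_smul]; ring
    · intro β γ
      refine ⟨-γ / polar f 1 e₁ g₁, β + γ * polar f 1 e₁ g₂ / polar f 1 e₁ g₁, ?_⟩
      ext i
      simp only [Pi.add_apply, Pi.smul_apply, Pi.sub_apply, smul_eq_mul]
      field_simp
      ring

/-- Tangent directions at points of `V(f)` have no intermediate contact. -/
def NoMiddleContact (f : MvPolynomial (Fin 4) k) (q : ℕ) : Prop :=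
  ∀ j, 2 ≤ j → j < q → ∀ P D, eval P f = 0 → polar f 1 P D = 0 → polar f j P D = 0

lemma SkewPair.exists_prime_pow (hf : IsSmoothSurface f (q + 1)) (hq : 3 ≤ q)
    (h : SkewPair f e₁ e₂ g₁ g₂) (hpol : NoMiddleContact f q) :
    ∃ p e : ℕ, p.Prime ∧ CharP k p ∧ 1 ≤ e ∧ q = p ^ e := by
  obtain ⟨g₁', g₂', h', hn, -⟩ := h.exists_isNormalized hf
  exact exists_prime_pow_of_choose (by omega) (h'.coeff_eq_zero hf hq hn hpol).1

lemma SkewPair.eval_add' (hf : IsSmoothSurface f (q + 1)) (hq : 3 ≤ q)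
    (h : SkewPair f e₁ e₂ g₁ g₂) (hpol : NoMiddleContact f q) (s t β γ : k) :
    eval ((s • e₁ + t • e₂) + (β • g₁ + γ • g₂)) f =
      polar f 1 (s • e₁ + t • e₂) (β • g₁ + γ • g₂) +
      polar f 1 (β • g₁ + γ • g₂) (s • e₁ + t • e₂) := by
  obtain ⟨g₁', g₂', h', hn, hc⟩ := h.exists_isNormalized hf
  obtain ⟨β', γ', h1⟩ := hc β γ
  rw [h1]
  exact h'.eval_add hf hq hn hpol s t β' γ'

lemma SkewPair.polar_one_pow (hf : IsSmoothSurface f (q + 1)) (hq : 3 ≤ q)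
    (h : SkewPair f e₁ e₂ g₁ g₂) (hpol : NoMiddleContact f q) (s t β γ : k) :
    polar f 1 (s • e₁ + t • e₂) (β • g₁ + γ • g₂) =
      s ^ q * (β * polar f 1 e₁ g₁ + γ * polar f 1 e₁ g₂) +
      t ^ q * (β * polar f 1 e₂ g₁ + γ * polar f 1 e₂ g₂) := by
  simp only [← polar_one_smul, ← polar_one_add]
  obtain ⟨g₁', g₂', h', hn, hc⟩ := h.exists_isNormalized hf
  obtain ⟨β', γ', h1⟩ := hc β γ
  rw [h1]
  have hz := (h'.coeff_eq_zero hf hq hn hpol).2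
  have h3 : ∀ g, (∀ n, 1 ≤ n → n < q → (derivAlong f q e₁ e₂ g).coeff n = 0) →
      polar f 1 (s • e₁ + t • e₂) g = s ^ q * polar f 1 e₁ g + t ^ q * polar f 1 e₂ g := by
    intro g hg
    have hs := (derivAlong_spec hf.2.1 e₁ e₂ g).2
    have := binEval_eq_of_coeff (by omega) hg s t
    rw [hs, hs, hs] at this
    simpa using this
  simp only [polar_one_smul, polar_one_add]
  rw [h3 _ hz.1, h3 _ hz.2]
  ring

end Skew

section NormalForm

variable {k : Type*} [Field k] {f : MvPolynomial (Fin 4) k} {q : ℕ} {e₁ e₂ g₁ g₂ : Fin 4 → k}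

lemma det4_pairs (e₁ e₂ g₁ g₂ : Fin 4 → k) (a b a' b' c d c' d' : k) :
    det4 (a • e₁ + b • e₂) (a' • e₁ + b' • e₂) (c • g₁ + d • g₂) (c' • g₁ + d' • g₂) =
      (a * b' - b * a') * (c * d' - d * c') * det4 e₁ e₂ g₁ g₂ := by
  rw [det4_eq, det4_eq]
  simp only [Pi.add_apply, Pi.smul_apply, smul_eq_mul]
  ring

lemma SkewPair.combination (h : SkewPair f e₁ e₂ g₁ g₂) {a b a' b' c d c' d' : k}
    (h1 : a * b' - b * a' ≠ 0) (h2 : c * d' - d * c' ≠ 0) :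
    SkewPair f (a • e₁ + b • e₂) (a' • e₁ + b' • e₂) (c • g₁ + d • g₂) (c' • g₁ + d' • g₂) where
  det := by
    rw [det4_pairs]
    exact mul_ne_zero (mul_ne_zero h1 h2) h.det
  left s t := by
    have : s • (a • e₁ + b • e₂) + t • (a' • e₁ + b' • e₂) =
      (s * a + t * a') • e₁ + (s * b + t * b') • e₂ := by module
    rw [this, h.left]
  right s t := by
    have : s • (c • g₁ + d • g₂) + t • (c' • g₁ + d' • g₂) =
      (s * c + t * c') • g₁ + (s * d + t * d') • g₂ := by module
    rw [this, h.right]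

variable [IsAlgClosed k] {p e : ℕ}

/-- Adapted bases of two skew lines: two common transversals join corresponding points. -/
lemma SkewPair.exists_orthogonal [Fact p.Prime] [CharP k p] (hpe : q = p ^ e)
    (hf : IsSmoothSurface f (q + 1)) (hq : 3 ≤ q)
    (h : SkewPair f e₁ e₂ g₁ g₂) (hpol : NoMiddleContact f q) :
    ∃ P₁ P₂ X₁ X₂, SkewPair f P₁ P₂ X₁ X₂ ∧ polar f 1 P₁ X₁ = 0 ∧ polar f 1 P₂ X₂ = 0 ∧
      polar f 1 X₁ P₁ = 0 ∧ polar f 1 X₂ P₂ = 0 := by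
  let φ := iterateFrobenius k p e
  have hφ : ∀ x : k, x ^ q = φ x := fun x => by rw [iterateFrobenius_def, hpe]
  have hq0 : (q : k) = 0 := by
    have : e ≠ 0 := by rintro rfl; simp at hpe; omega
    rw [hpe]; simp [this]
  have hl := h.polar_one_pow hf hq hpol
  have hr := h.symm.polar_one_pow hf hq hpol
  set u₁ := polar f 1 e₁ g₁
  set u₂ := polar f 1 e₁ g₂
  set v₁ := polar f 1 e₂ g₁
  set v₂ := polar f 1 e₂ g₂
  set c₁ := polar f 1 g₁ e₁
  set c₂ := polar f 1 g₂ e₁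
  set d₁ := polar f 1 g₁ e₂
  set d₂ := polar f 1 g₂ e₂
  have huv : u₁ * v₂ - u₂ * v₁ ≠ 0 := by
    refine det_ne_zero_of_pow (q := q) (by omega) fun s t hst => ?_
    have := h.exists_polar_ne_zero hf hst
    have e1 := hl s t 1 0
    have e2 := hl s t 0 1
    simp only [one_smul, zero_smul, add_zero, zero_add, one_mul, zero_mul] at e1 e2
    rwa [e1, e2] at this
  have hcd : c₁ * d₂ - d₁ * c₂ ≠ 0 := by
    refine det_ne_zero_of_pow (q := q) (by omega) fun s t hst => ?_
    have := h.symm.exists_polar_ne_zero hf hst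
    have e1 := hr s t 1 0
    have e2 := hr s t 0 1
    simp only [one_smul, zero_smul, add_zero, zero_add, one_mul, zero_mul] at e1 e2
    rwa [e1, e2] at this
  obtain ⟨s, t, s', t', hst, h1, h2⟩ := exists_two_zeros (k := k) (Q := q * q) (by nlinarith)
    (by simp [hq0]) (m₁ := c₁ * u₂ ^ q - c₂ * u₁ ^ q) (m₂ := c₁ * v₂ ^ q - c₂ * v₁ ^ q)
    (m₃ := d₁ * u₂ ^ q - d₂ * u₁ ^ q) (m₄ := d₁ * v₂ ^ q - d₂ * v₁ ^ q) (by
      have : (c₁ * d₂ - d₁ * c₂) * (u₁ * v₂ - u₂ * v₁) ^ q ≠ 0 :=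
        mul_ne_zero hcd (pow_ne_zero _ huv)
      simp only [hφ, map_sub, map_mul] at this ⊢
      convert this using 1
      ring)
  have key : ∀ s t : k, polar f 1 (s • e₁ + t • e₂)
      ((u₂ * s ^ q + v₂ * t ^ q) • g₁ + (-(u₁ * s ^ q + v₁ * t ^ q)) • g₂) = 0 := by
    intro s t
    rw [hl]; ring
  have key' : ∀ s t : k, polar f 1
      ((u₂ * s ^ q + v₂ * t ^ q) • g₁ + (-(u₁ * s ^ q + v₁ * t ^ q)) • g₂) (s • e₁ + t • e₂) =
      s * ((c₁ * u₂ ^ q - c₂ * u₁ ^ q) * s ^ (q * q) + (c₁ * v₂ ^ q - c₂ * v₁ ^ q) * t ^ (q * q)) +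
      t * ((d₁ * u₂ ^ q - d₂ * u₁ ^ q) * s ^ (q * q) + (d₁ * v₂ ^ q - d₂ * v₁ ^ q) * t ^ (q * q)) := by
    intro s t
    rw [hr]
    simp only [pow_mul, hφ, map_neg, map_add, map_mul]
    ring
  refine ⟨s • e₁ + t • e₂, s' • e₁ + t' • e₂,
    (u₂ * s ^ q + v₂ * t ^ q) • g₁ + (-(u₁ * s ^ q + v₁ * t ^ q)) • g₂,
    (u₂ * s' ^ q + v₂ * t' ^ q) • g₁ + (-(u₁ * s' ^ q + v₁ * t' ^ q)) • g₂,
    h.combination hst ?_, key s t, key s' t', by rw [key', h1], by rw [key', h2]⟩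
  have : (u₁ * v₂ - u₂ * v₁) * (s * t' - t * s') ^ q ≠ 0 := mul_ne_zero huv (pow_ne_zero _ hst)
  simp only [hφ, map_sub, map_mul] at this ⊢
  convert this using 1
  ring

lemma exists_pow_eq_neg_one (hq : 2 ≤ q) (hq0 : (q : k) = 0) :
    ∃ ε ε' : k, ε ^ (q + 1) = -1 ∧ ε' ^ (q + 1) = -1 ∧ ε ≠ ε' := by
  obtain ⟨ε, hε⟩ := IsAlgClosed.exists_pow_nat_eq (-1 : k) (Nat.succ_pos q)
  have hε0 : ε ≠ 0 := by rintro rfl; simp at hε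
  let P : Polynomial k := Polynomial.X ^ q + ∑ i ∈ Finset.range q, Polynomial.X ^ i
  have hP : P.natDegree = q := by
    rw [Polynomial.natDegree_add_eq_left_of_degree_lt, Polynomial.natDegree_X_pow]
    rw [Polynomial.degree_X_pow]
    refine (Polynomial.degree_sum_le _ _).trans_lt ?_
    rw [Finset.sup_lt_iff (by exact_mod_cast WithBot.bot_lt_coe q)]
    intro i hi
    rw [Polynomial.degree_X_pow]
    exact_mod_cast Finset.mem_range.mp hi
  obtain ⟨ζ, hζ⟩ := exists_eval_eq_zero_of_natDegree_pos (p := P) (by omega)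
  have hζ' : ∑ i ∈ Finset.range (q + 1), ζ ^ i = 0 := by
    rw [Finset.sum_range_succ, add_comm]
    simpa [P, Polynomial.eval_finsetSum] using hζ
  refine ⟨ε, ε * ζ, hε, ?_, ?_⟩
  · have := geom_sum_mul ζ (q + 1)
    rw [hζ', zero_mul, eq_comm, sub_eq_zero] at this
    rw [mul_pow, hε, this, mul_one]
  · intro h
    have : ζ = 1 := by
      apply mul_left_cancel₀ hε0; rw [← h, mul_one]
    rw [this] at hζ'
    simp [hq0] at hζ'

lemma exists_pow_add_pow_eq [Fact p.Prime] [CharP k p] (hpe : q = p ^ e) (hq : 2 ≤ q)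
    {a c : k} (ha : a ≠ 0) (hc : c ≠ 0) : ∃ α β γ δ : k, α * δ - β * γ ≠ 0 ∧
      ∀ x y, (α * x + β * y) ^ (q + 1) + (γ * x + δ * y) ^ (q + 1) =
        a * x ^ q * y + c * y ^ q * x := by
  let φ := iterateFrobenius k p e
  have hφ : ∀ x : k, x ^ q = φ x := fun x => by rw [iterateFrobenius_def, hpe]
  have hq0 : (q : k) = 0 := by
    have : e ≠ 0 := by rintro rfl; simp at hpe; omega
    rw [hpe]; simp [this]
  obtain ⟨ε, ε', h1, h2, hne⟩ := exists_pow_eq_neg_one (k := k) hq hq0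
  have hcross : ∀ {x y : k}, x ^ (q + 1) = -1 → x ≠ y → 1 + x ^ q * y ≠ 0 := by
    intro x y hx hxy h0
    have hx0 : x ≠ 0 := by rintro rfl; simp at hx
    apply hxy
    apply mul_left_cancel₀ (pow_ne_zero q hx0)
    rw [← pow_succ]
    linear_combination hx - h0
  obtain ⟨l, m, hl, hm, hla, hmc⟩ := exists_scaling hq ha hc (hcross h1 hne)
    (hcross h2 hne.symm)
  refine ⟨l, m, l * ε, m * ε', ?_, fun x y => ?_⟩
  · have : l * (m * ε') - m * (l * ε) = l * m * (ε' - ε) := by ring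
    rw [this]
    exact mul_ne_zero (mul_ne_zero hl hm) (sub_ne_zero.mpr hne.symm)
  · rw [pow_succ] at h1 h2
    rw [← hla, ← hmc]
    simp only [pow_succ, hφ, map_add, map_mul] at h1 h2 ⊢
    linear_combination (φ l * l * φ x * x) * h1 + (φ m * m * φ y * y) * h2

lemma exists_fermat_form (hf : IsSmoothSurface f (q + 1)) (hq : 3 ≤ q)
    (h : SkewPair f e₁ e₂ g₁ g₂) (hpol : NoMiddleContact f q) :
    ∃ p e : ℕ, p.Prime ∧ CharP k p ∧ 1 ≤ e ∧ q = p ^ e ∧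
      ∃ T : (Fin 4 → k) ≃ₗ[k] (Fin 4 → k), ∀ v, eval v f =
        T v 0 ^ (q + 1) + T v 1 ^ (q + 1) + T v 2 ^ (q + 1) + T v 3 ^ (q + 1) := by
  obtain ⟨p, e, hp, hchar, he, hpe⟩ := h.exists_prime_pow hf hq hpol
  refine ⟨p, e, hp, hchar, he, hpe, ?_⟩
  have : Fact p.Prime := ⟨hp⟩
  obtain ⟨P₁, P₂, X₁, X₂, h', o1, o2, o3, o4⟩ := h.exists_orthogonal hpe hf hq hpol
  have ha : polar f 1 P₁ X₂ ≠ 0 := by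
    simpa [o1] using h'.exists_polar_ne_zero hf (s := 1) (t := 0) (by simp)
  have hb : polar f 1 P₂ X₁ ≠ 0 := by
    simpa [o2] using h'.exists_polar_ne_zero hf (s := 0) (t := 1) (by simp)
  have hc : polar f 1 X₂ P₁ ≠ 0 := by
    simpa [o4] using h'.symm.exists_polar_ne_zero hf (s := 0) (t := 1) (by simp)
  have hd : polar f 1 X₁ P₂ ≠ 0 := by
    simpa [o3] using h'.symm.exists_polar_ne_zero hf (s := 1) (t := 0) (by simp)
  obtain ⟨α, β, γ, δ, hdet, hform⟩ := exists_pow_add_pow_eq hpe (by omega) ha hc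
  obtain ⟨α', β', γ', δ', hdet', hform'⟩ := exists_pow_add_pow_eq hpe (by omega) hb hd
  let b := basisOfLinearIndependentOfCardEqFinrank (linearIndependent_of_det4 h'.det) (by simp)
  let E : (Fin 4 → k) →ₗ[k] (Fin 4 → k) := Matrix.toLin' !![α, 0, 0, β; γ, 0, 0, δ;
    0, α', β', 0; 0, γ', δ', 0]
  have hE : ∀ x, E x = ![α * x 0 + β * x 3, γ * x 0 + δ * x 3, α' * x 1 + β' * x 2,
      γ' * x 1 + δ' * x 2] := by
    intro x
    ext i
    fin_cases i <;> simp [E, Matrix.toLin'_apply, Matrix.mulVec, dotProduct, Fin.sum_univ_four]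
  have hinj : Function.Injective E := by
    rw [← LinearMap.ker_eq_bot, LinearMap.ker_eq_bot']
    intro x hx
    rw [hE] at hx
    have h0 := congrFun hx 0
    have h1 := congrFun hx 1
    have h2 := congrFun hx 2
    have h3 := congrFun hx 3
    simp at h0 h1 h2 h3
    have z0 : (α * δ - β * γ) * x 0 = 0 := by linear_combination δ * h0 - β * h1
    have z1 : (α' * δ' - β' * γ') * x 1 = 0 := by linear_combination δ' * h2 - β' * h3
    have z2 : (α' * δ' - β' * γ') * x 2 = 0 := by linear_combination α' * h3 - γ' * h2
    have z3 : (α * δ - β * γ) * x 3 = 0 := by linear_combination α * h1 - γ * h0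
    simp only [mul_eq_zero, hdet, hdet', false_or] at z0 z1 z2 z3
    ext i
    fin_cases i <;> assumption
  refine ⟨b.equivFun.trans (LinearEquiv.ofInjectiveEndo E hinj), fun v => ?_⟩
  have hv := b.sum_equivFun v
  generalize hx : b.equivFun v = x at hv
  have hv' : (x 0 • P₁ + x 1 • P₂) + (x 2 • X₁ + x 3 • X₂) = v := by
    rw [← hv, Fin.sum_univ_four]
    simp [b]
    module
  rw [← hv', h'.eval_add' hf hq hpol, h'.polar_one_pow hf hq hpol,
    h'.symm.polar_one_pow hf hq hpol, hv', o1, o2, o3, o4]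
  simp only [LinearEquiv.trans_apply, hx, LinearEquiv.coe_ofInjectiveEndo, hE]
  have e1 := hform (x 0) (x 3)
  have e2 := hform' (x 1) (x 2)
  simp
  linear_combination -e1 - e2

end NormalForm

section BaseChange

variable {K k : Type*} [Field K] [Field k] (σ : K →+* k)

/-- Extension of scalars of a subspace of `K⁴`. -/
def baseChange (U : Submodule K (Fin 4 → K)) : Submodule k (Fin 4 → k) :=
  Submodule.span k ((fun u => σ ∘ u) '' (U : Set (Fin 4 → K)))

variable {σ}

lemma comp_mem_baseChange {U : Submodule K (Fin 4 → K)} {u : Fin 4 → K} (hu : u ∈ U) :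
    σ ∘ u ∈ baseChange σ U :=
  Submodule.subset_span ⟨u, hu, rfl⟩

lemma comp_ne_zero {u : Fin 4 → K} (hu : u ≠ 0) : σ ∘ u ≠ 0 := by
  obtain ⟨i, hi⟩ := Function.ne_iff.mp hu
  intro h
  exact hi ((map_eq_zero σ).mp (congrFun h i))

lemma baseChange_span_pair (a b : Fin 4 → K) :
    baseChange σ (Submodule.span K {a, b}) = Submodule.span k {σ ∘ a, σ ∘ b} := by
  apply le_antisymm
  · rw [baseChange, Submodule.span_le]
    rintro - ⟨u, hu, rfl⟩
    obtain ⟨x, y, rfl⟩ := Submodule.mem_span_pair.mp hu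
    refine Submodule.mem_span_pair.mpr ⟨σ x, σ y, ?_⟩
    ext i; simp
  · rw [Submodule.span_le]
    rintro - (rfl | rfl)
    · exact comp_mem_baseChange (Submodule.subset_span (by simp))
    · exact comp_mem_baseChange (Submodule.subset_span (by simp))

lemma det4_comp (a b c e : Fin 4 → K) :
    det4 (σ ∘ a) (σ ∘ b) (σ ∘ c) (σ ∘ e) = σ (det4 a b c e) := by
  rw [det4_eq, det4_eq]; simp

lemma linearIndependent_pair_of_four {a b c e : Fin 4 → k}
    (h : LinearIndependent k ![a, b, c, e]) : LinearIndependent k ![a, b] := by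
  have := h.comp ![0, 1] (by decide)
  convert this using 1
  ext i; fin_cases i <;> rfl

lemma linearIndependent_comp_pair {a b : Fin 4 → K} (h : LinearIndependent K ![a, b]) :
    LinearIndependent k ![σ ∘ a, σ ∘ b] := by
  obtain ⟨c, e, hce⟩ := exists_det4_ne_zero h
  refine linearIndependent_pair_of_four (c := σ ∘ c) (e := σ ∘ e) (linearIndependent_of_det4 ?_)
  rw [det4_comp]
  exact (map_ne_zero σ).mpr hce

lemma comp_mem_baseChange_iff {U : Submodule K (Fin 4 → K)} (hU : Module.finrank K U = 2)
    {u : Fin 4 → K} : σ ∘ u ∈ baseChange σ U ↔ u ∈ U := by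
  refine ⟨fun h => ?_, comp_mem_baseChange⟩
  by_contra hu
  obtain ⟨a, b, hab, rfl⟩ := exists_basis_of_finrank_eq_two hU
  have h3 : LinearIndependent K ![u, a, b] := by
    rw [show (![u, a, b] : Fin 3 → Fin 4 → K) = Fin.cons u ![a, b] from rfl,
      linearIndependent_finCons]
    refine ⟨hab, ?_⟩
    simpa [Set.pair_comm] using hu
  obtain ⟨e, he⟩ := exists_linearIndependent_snoc_of_lt_finrank (n := 3) h3 (by simp)
  have he' : LinearIndependent K ![u, a, b, e] := by
    have : (![u, a, b, e] : Fin 4 → Fin 4 → K) = Fin.snoc ![u, a, b] e := by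
      ext i j; fin_cases i <;> rfl
    rw [this]
    exact he
  have hd : det4 (σ ∘ u) (σ ∘ a) (σ ∘ b) (σ ∘ e) ≠ 0 := by
    rw [det4_comp]; exact (map_ne_zero σ).mpr (det4_ne_zero he')
  have hli := linearIndependent_of_det4 hd
  rw [baseChange_span_pair] at h
  obtain ⟨x, y, hxy⟩ := Submodule.mem_span_pair.mp h
  rw [Fintype.linearIndependent_iff] at hli
  have := hli ![-1, x, y, 0] (by
    simp only [Fin.sum_univ_four]
    simp
    rw [← hxy]; module) 0
  simp at this

lemma finrank_baseChange {U : Submodule K (Fin 4 → K)} (hU : Module.finrank K U = 2) :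
    Module.finrank k (baseChange σ U) = 2 := by
  obtain ⟨a, b, hab, rfl⟩ := exists_basis_of_finrank_eq_two hU
  rw [baseChange_span_pair]
  exact finrank_span_pair (linearIndependent_comp_pair hab)

lemma baseChange_injOn {U V : Submodule K (Fin 4 → K)} (hU : Module.finrank K U = 2)
    (hV : Module.finrank K V = 2) (h : baseChange σ U = baseChange σ V) : U = V := by
  ext u
  rw [← comp_mem_baseChange_iff (σ := σ) hU, h, comp_mem_baseChange_iff hV]

lemma baseChange_inf_ne_bot_iff {U V : Submodule K (Fin 4 → K)} (hU : Module.finrank K U = 2)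
    (hV : Module.finrank K V = 2) : baseChange σ U ⊓ baseChange σ V ≠ ⊥ ↔ U ⊓ V ≠ ⊥ := by
  constructor
  · contrapose
    intro h
    obtain ⟨a, b, hab, rfl⟩ := exists_basis_of_finrank_eq_two hU
    obtain ⟨c, e, hce, rfl⟩ := exists_basis_of_finrank_eq_two hV
    have hd := (map_ne_zero σ).mpr (det4_ne_zero_of_disjoint hab hce h)
    rw [← det4_comp] at hd
    have hli := linearIndependent_of_det4 hd
    rw [baseChange_span_pair, baseChange_span_pair, Submodule.eq_bot_iff]
    rintro v ⟨h1, h2⟩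
    obtain ⟨x, y, rfl⟩ := Submodule.mem_span_pair.mp h1
    obtain ⟨z, w, hzw⟩ := Submodule.mem_span_pair.mp h2
    rw [Fintype.linearIndependent_iff] at hli
    have := hli ![x, y, -z, -w] (by
      simp only [Fin.sum_univ_four]
      simp
      rw [hzw.symm]; module)
    have h0 := this 0
    have h1 := this 1
    simp at h0 h1
    simp [h0, h1]
  · intro h
    obtain ⟨v, hv0, h1, h2⟩ := inf_ne_bot_iff.mp h
    exact inf_ne_bot_iff.mpr ⟨σ ∘ v, comp_ne_zero hv0, comp_mem_baseChange h1,
      comp_mem_baseChange h2⟩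

lemma exists_minor_ne_zero {a b : Fin 4 → k} (h : LinearIndependent k ![a, b]) :
    ∃ i j, a i * b j - a j * b i ≠ 0 := by
  by_contra! hcon
  obtain ⟨c, e, hd⟩ := exists_det4_ne_zero h
  apply hd
  rw [det4_eq]
  simp [hcon]

/-- A reduced echelon basis of a plane in `k⁴`. -/
lemma exists_echelon_basis {W : Submodule k (Fin 4 → k)} (hW : Module.finrank k W = 2) :
    ∃ (i j : Fin 4) (u v : Fin 4 → k), u ∈ W ∧ v ∈ W ∧ u i = 1 ∧ u j = 0 ∧ v i = 0 ∧ v j = 1 ∧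
      ∀ w ∈ W, w = w i • u + w j • v := by
  obtain ⟨a, b, hab, rfl⟩ := exists_basis_of_finrank_eq_two hW
  obtain ⟨i, j, hD⟩ := exists_minor_ne_zero hab
  have ha : a ∈ Submodule.span k {a, b} := Submodule.subset_span (by simp)
  have hb : b ∈ Submodule.span k {a, b} := Submodule.subset_span (by simp)
  refine ⟨i, j, (a i * b j - a j * b i)⁻¹ • (b j • a - a j • b),
    (a i * b j - a j * b i)⁻¹ • (a i • b - b i • a), ?_, ?_, ?_, ?_, ?_, ?_, ?_⟩
  · exact Submodule.smul_mem _ _ (Submodule.sub_mem _ (Submodule.smul_mem _ _ ha)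
      (Submodule.smul_mem _ _ hb))
  · exact Submodule.smul_mem _ _ (Submodule.sub_mem _ (Submodule.smul_mem _ _ hb)
      (Submodule.smul_mem _ _ ha))
  · simp only [Pi.smul_apply, Pi.sub_apply, smul_eq_mul]; field_simp
  · simp only [Pi.smul_apply, Pi.sub_apply, smul_eq_mul]; field_simp; ring
  · simp only [Pi.smul_apply, Pi.sub_apply, smul_eq_mul]; field_simp; ring
  · simp only [Pi.smul_apply, Pi.sub_apply, smul_eq_mul]; field_simp
  · intro w hw
    obtain ⟨x, y, rfl⟩ := Submodule.mem_span_pair.mp hw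
    ext l
    have hinv := mul_inv_cancel₀ hD
    simp only [Pi.smul_apply, Pi.sub_apply, Pi.add_apply, smul_eq_mul]
    linear_combination (-(x * a l + y * b l)) * hinv

end BaseChange

section Fermat

variable {k : Type*} [Field k]

/-- A line on the Fermat surface of degree `q + 1`. -/
def IsFermatLine (q : ℕ) (W : Submodule k (Fin 4 → k)) : Prop :=
  Module.finrank k W = 2 ∧
    ∀ v ∈ W, v 0 ^ (q + 1) + v 1 ^ (q + 1) + v 2 ^ (q + 1) + v 3 ^ (q + 1) = 0

variable {p e q : ℕ} [Fact p.Prime] [CharP k p]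

lemma IsFermatLine.sum_eq_zero [IsAlgClosed k] (hpe : q = p ^ e) (hq : 2 ≤ q)
    {W : Submodule k (Fin 4 → k)} (hW : IsFermatLine q W) {u v : Fin 4 → k} (hu : u ∈ W)
    (hv : v ∈ W) : ∑ i, u i ^ q * v i = 0 := by
  let φ := iterateFrobenius k p e
  have hφ : ∀ x : k, x ^ q = φ x := fun x => by rw [iterateFrobenius_def, hpe]
  have key : ∀ t : k, t * ∑ i, u i ^ q * v i + t ^ q * ∑ i, v i ^ q * u i = 0 := by
    intro t
    have h1 := hW.2 _ (W.add_mem hu (W.smul_mem t hv))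
    have h2 := hW.2 _ hu
    have h3 := hW.2 _ hv
    simp only [Fin.sum_univ_four, Pi.add_apply, Pi.smul_apply, smul_eq_mul, pow_succ, hφ,
      map_add, map_mul] at h1 h2 h3 ⊢
    linear_combination h1 - h2 - φ t * t * h3
  obtain ⟨t, ht⟩ : ∃ t : k, t ^ q - t ≠ 0 := by
    by_contra! hcon
    have : (Polynomial.X ^ q - Polynomial.X : Polynomial k) = 0 := by
      apply Polynomial.funext
      simpa using hcon
    have h1 := congrArg (Polynomial.coeff · q) this
    simp [Polynomial.coeff_X, show 1 ≠ q by omega] at h1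
  have h1 := key 1
  have h2 := key t
  simp only [one_mul, one_pow] at h1
  apply mul_left_cancel₀ ht
  linear_combination t ^ q * h1 - h2

lemma IsFermatLine.pow_mem [IsAlgClosed k] (hpe : q = p ^ e) (hq : 2 ≤ q)
    {W : Submodule k (Fin 4 → k)} (hW : IsFermatLine q W) {u : Fin 4 → k} (hu : u ∈ W) :
    (fun i => u i ^ (q * q)) ∈ W := by
  let φ := iterateFrobenius k p e
  have hφ : ∀ x : k, x ^ q = φ x := fun x => by rw [iterateFrobenius_def, hpe]
  obtain ⟨a, b, hab, hWab⟩ := exists_basis_of_finrank_eq_two hW.1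
  have ha : a ∈ W := hWab ▸ Submodule.subset_span (by simp)
  have hb : b ∈ W := hWab ▸ Submodule.subset_span (by simp)
  let M : Matrix (Fin 2) (Fin 4) k := Matrix.of ![φ ∘ a, φ ∘ b]
  have hrank : M.rank = 2 := by
    have := LinearIndependent.rank_matrix (M := M) (linearIndependent_comp_pair (σ := φ) hab)
    simpa using this
  have hker : Module.finrank k (LinearMap.ker M.mulVecLin) = 2 := by
    have := LinearMap.finrank_range_add_finrank_ker M.mulVecLin
    rw [Matrix.rank] at hrank
    rw [hrank] at this
    simp at this
    omega
  have hmem : ∀ x, x ∈ LinearMap.ker M.mulVecLin ↔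
      ∑ i, a i ^ q * x i = 0 ∧ ∑ i, b i ^ q * x i = 0 := by
    intro x
    rw [LinearMap.mem_ker, funext_iff, Fin.forall_fin_two]
    simp [M, Matrix.mulVec, dotProduct, hφ]
  have hle : W ≤ LinearMap.ker M.mulVecLin := fun x hx =>
    (hmem x).mpr ⟨hW.sum_eq_zero hpe hq ha hx, hW.sum_eq_zero hpe hq hb hx⟩
  rw [Submodule.eq_of_le_of_finrank_eq hle (hW.1.trans hker.symm), hmem]
  have hpow : ∀ c ∈ W, ∑ i, c i ^ q * u i ^ (q * q) = 0 := by
    intro c hc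
    have := congrArg φ (hW.sum_eq_zero hpe hq hu hc)
    simp only [map_sum, map_mul, hφ, map_zero, pow_mul] at this ⊢
    rw [← this]
    exact Finset.sum_congr rfl fun i _ => mul_comm _ _
  exact ⟨hpow a ha, hpow b hb⟩

lemma mem_range_of_pow_eq {K : Type*} [Field K] [IsAlgClosed K] (σ : K →+* k) {Q : ℕ}
    (hQ : 2 ≤ Q) {x : k} (hx : x ^ Q = x) : ∃ y, σ y = x := by
  let P : Polynomial K := Polynomial.X ^ Q - Polynomial.X
  have hP : P ≠ 0 := by
    intro h
    have h1 := congrArg (Polynomial.coeff · Q) h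
    simp [P, Polynomial.coeff_X, show 1 ≠ Q by omega] at h1
  have hroot : x ∈ (P.map σ).roots := by
    rw [Polynomial.mem_roots (Polynomial.map_ne_zero hP)]
    simp [P, hx]
  rw [(IsAlgClosed.splits P).roots_map] at hroot
  obtain ⟨y, -, hy⟩ := Multiset.mem_map.mp hroot
  exact ⟨y, hy⟩

lemma IsFermatLine.baseChange {K : Type*} [Field K] [CharP K p] [Infinite K] (σ : K →+* k)
    (hpe : q = p ^ e) {U : Submodule K (Fin 4 → K)} (hU : IsFermatLine q U)
    (hsum : ∀ u ∈ U, ∀ v ∈ U, ∑ i, u i ^ q * v i = 0) : IsFermatLine q (baseChange σ U) := by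
  refine ⟨finrank_baseChange hU.1, ?_⟩
  let φ := iterateFrobenius k p e
  have hφ : ∀ x : k, x ^ q = φ x := fun x => by rw [iterateFrobenius_def, hpe]
  obtain ⟨a, b, hab, rfl⟩ := exists_basis_of_finrank_eq_two hU.1
  rw [baseChange_span_pair]
  intro v hv
  obtain ⟨x, y, rfl⟩ := Submodule.mem_span_pair.mp hv
  have ha : a ∈ Submodule.span K {a, b} := Submodule.subset_span (by simp)
  have hb : b ∈ Submodule.span K {a, b} := Submodule.subset_span (by simp)
  have h1 := congrArg σ (hsum a ha a ha)
  have h2 := congrArg σ (hsum a ha b hb)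
  have h3 := congrArg σ (hsum b hb a ha)
  have h4 := congrArg σ (hsum b hb b hb)
  simp only [Fin.sum_univ_four, map_add, map_mul, map_pow, map_zero, hφ, pow_succ, Pi.add_apply,
    Pi.smul_apply, smul_eq_mul, Function.comp] at h1 h2 h3 h4 ⊢
  linear_combination φ x * x * h1 + φ x * y * h2 + φ y * x * h3 + φ y * y * h4

lemma IsFermatLine.exists_baseChange_eq [IsAlgClosed k] {K : Type*} [Field K] [IsAlgClosed K]
    (σ : K →+* k) (hpe : q = p ^ e) (hq : 2 ≤ q)
    {W : Submodule k (Fin 4 → k)} (hW : IsFermatLine q W) :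
    ∃ U : Submodule K (Fin 4 → K), IsFermatLine q U ∧ FermatLines.baseChange σ U = W := by
  obtain ⟨i, j, u, v, hu, hv, hui, huj, hvi, hvj, hspan⟩ := exists_echelon_basis hW.1
  have hQ : 2 ≤ q * q := by nlinarith
  have hu' : ∀ l, u l ^ (q * q) = u l := by
    have := hspan _ (hW.pow_mem hpe hq hu)
    simp only [hui, huj, one_pow, one_smul, zero_pow (show q * q ≠ 0 by omega), zero_smul,
      add_zero] at this
    exact congrFun this
  have hv' : ∀ l, v l ^ (q * q) = v l := by
    have := hspan _ (hW.pow_mem hpe hq hv)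
    simp only [hvi, hvj, one_pow, one_smul, zero_pow (show q * q ≠ 0 by omega), zero_smul,
      zero_add] at this
    exact congrFun this
  choose a ha using fun l => mem_range_of_pow_eq σ hQ (hu' l)
  choose b hb using fun l => mem_range_of_pow_eq σ hQ (hv' l)
  obtain rfl : σ ∘ a = u := funext ha
  obtain rfl : σ ∘ b = v := funext hb
  have hli : LinearIndependent K ![a, b] := by
    rw [LinearIndependent.pair_iff]
    intro s t hst
    have h0 := congrArg σ (congrFun hst i)
    have h1 := congrArg σ (congrFun hst j)
    simp only [Function.comp] at hui hvi huj hvj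
    simp [hui, hvi] at h0
    simp [huj, hvj] at h1
    exact ⟨h0, h1⟩
  refine ⟨Submodule.span K {a, b}, ⟨finrank_span_pair hli, ?_⟩, ?_⟩
  · intro w hw
    obtain ⟨x, y, rfl⟩ := Submodule.mem_span_pair.mp hw
    have := hW.2 _ (W.add_mem (W.smul_mem (σ x) hu) (W.smul_mem (σ y) hv))
    apply σ.injective
    simpa using this
  · rw [baseChange_span_pair]
    apply le_antisymm
    · rw [Submodule.span_le]
      rintro - (rfl | rfl)
      · exact hu
      · exact hv
    · intro w hw
      exact Submodule.mem_span_pair.mpr ⟨_, _, (hspan w hw).symm⟩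

end Fermat

section Assembly

variable {k : Type*} [Field k] [IsAlgClosed k] {f : MvPolynomial (Fin 4) k} {p e q d : ℕ}

lemma exists_equiv_of_fermat_form [Fact p.Prime] [CharP k p] (hpe : q = p ^ e) (hq : 2 ≤ q)
    (T : (Fin 4 → k) ≃ₗ[k] (Fin 4 → k)) (hT : ∀ v, eval v f =
        T v 0 ^ (q + 1) + T v 1 ^ (q + 1) + T v 2 ^ (q + 1) + T v 3 ^ (q + 1)) :
    ∃ φ : {W : Submodule k (Fin 4 → k) // IsLineOn f W} ≃
        {W : Submodule (AlgebraicClosure (ZMod p)) (Fin 4 → AlgebraicClosure (ZMod p)) //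
          IsFermatLine q W},
      ∀ W W' : {W : Submodule k (Fin 4 → k) // IsLineOn f W}, W.1 ⊓ W'.1 ≠ ⊥ ↔
        (φ W).1 ⊓ (φ W').1 ≠ ⊥ := by
  let _ : Algebra (ZMod p) k := ZMod.algebra k p
  let σ : AlgebraicClosure (ZMod p) →+* k :=
    (IsAlgClosed.lift : AlgebraicClosure (ZMod p) →ₐ[ZMod p] k)
  have : CharP (AlgebraicClosure (ZMod p)) p := charP_of_injective_ringHom
    (algebraMap (ZMod p) (AlgebraicClosure (ZMod p))).injective p
  have hline : ∀ W : Submodule k (Fin 4 → k), IsFermatLine q W ↔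
      IsLineOn f (W.map (T.symm : (Fin 4 → k) →ₗ[k] (Fin 4 → k))) := by
    intro W
    rw [IsFermatLine, IsLineOn, LinearEquiv.finrank_map_eq]
    simp only [hT, Submodule.mem_map, forall_exists_index, and_imp, forall_apply_eq_imp_iff₂]
    simp
  let g : {W : Submodule (AlgebraicClosure (ZMod p)) (Fin 4 → AlgebraicClosure (ZMod p)) //
      IsFermatLine q W} → {W : Submodule k (Fin 4 → k) // IsLineOn f W} := fun U =>
    ⟨(baseChange σ U.1).map (T.symm : (Fin 4 → k) →ₗ[k] (Fin 4 → k)), (hline _).mp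
      (U.2.baseChange σ hpe fun _ hu _ hv => U.2.sum_eq_zero hpe hq hu hv)⟩
  have hmap : Function.Injective
      (Submodule.map (T.symm : (Fin 4 → k) →ₗ[k] (Fin 4 → k))) :=
    Submodule.map_injective_of_injective T.symm.injective
  have hg : Function.Bijective g := by
    constructor
    · intro U V hUV
      exact Subtype.ext (baseChange_injOn U.2.1 V.2.1 (hmap (congrArg Subtype.val hUV)))
    · rintro ⟨W, hW⟩
      have hTW : (W.map (T : (Fin 4 → k) →ₗ[k] (Fin 4 → k))).map
          (T.symm : (Fin 4 → k) →ₗ[k] (Fin 4 → k)) = W := by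
        rw [← Submodule.map_comp]; simp
      rw [← hTW, ← hline] at hW
      obtain ⟨U, hU, hUW⟩ := hW.exists_baseChange_eq σ hpe hq
      refine ⟨⟨U, hU⟩, Subtype.ext ?_⟩
      simp only [g]
      rw [hUW, hTW]
  have hinc : ∀ U V, (g U).1 ⊓ (g V).1 ≠ ⊥ ↔ U.1 ⊓ V.1 ≠ ⊥ := by
    intro U V
    rw [← baseChange_inf_ne_bot_iff (σ := σ) U.2.1 V.2.1]
    simp only [g]
    rw [← Submodule.map_inf _ T.symm.injective, ne_eq, ne_eq,
      Submodule.map_eq_bot_iff]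
  refine ⟨(Equiv.ofBijective g hg).symm, fun W W' => ?_⟩
  obtain ⟨U, rfl⟩ := hg.2 W
  obtain ⟨U', rfl⟩ := hg.2 W'
  rw [hinc]
  simp

lemma exists_equiv_of_four_le (hd : 4 ≤ d) (hf : IsSmoothSurface f d)
    (hcount : {W : Submodule k (Fin 4 → k) | IsLineOn f W}.ncard =
      d ^ 2 * (d ^ 2 - 3 * d + 3)) :
    ∃ (p e : ℕ) (hp : p.Prime), 1 ≤ e ∧ d = p ^ e + 1 ∧
      (letI : Fact p.Prime := ⟨hp⟩
       ∃ φ : {W : Submodule k (Fin 4 → k) // IsLineOn f W} ≃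
          {W : Submodule (AlgebraicClosure (ZMod p)) (Fin 4 → AlgebraicClosure (ZMod p)) //
            IsFermatLine (p ^ e) W},
        ∀ W W' : {W : Submodule k (Fin 4 → k) // IsLineOn f W},
          W.1 ⊓ W'.1 ≠ ⊥ ↔ (φ W).1 ⊓ (φ W').1 ≠ ⊥) := by
  obtain ⟨q, rfl⟩ := Nat.exists_eq_add_of_le' (show 1 ≤ d by omega)
  have hbig : q + 1 < (q + 1) ^ 2 * ((q + 1) ^ 2 - 3 * (q + 1) + 3) := by nlinarith
  have hfin : {W : Submodule k (Fin 4 → k) | IsLineOn f W}.Finite :=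
    Set.finite_of_ncard_ne_zero (by omega)
  have hpol : NoMiddleContact f q := fun j hj hjq P D =>
    polar_eq_zero_of_ncard hf hfin hcount j hj (by omega) P D
  obtain ⟨A, B, hA, hB, hAB⟩ := exists_skew_lines hf (by omega) hfin (hcount ▸ hbig)
  obtain ⟨e₁, e₂, g₁, g₂, h⟩ := exists_skewPair hA hB hAB
  obtain ⟨p, e, hp, hchar, he, rfl, T, hT⟩ := exists_fermat_form hf (by omega) h hpol
  have : Fact p.Prime := ⟨hp⟩
  exact ⟨p, e, hp, he, rfl, exists_equiv_of_fermat_form rfl (by omega) T hT⟩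

end Assembly

section Configuration

variable {V : Type*} {G : SimpleGraph V}

/-- Every edge lies in a unique triangle, and every vertex outside a triangle is joined to it. -/
structure IsTritangent (G : SimpleGraph V) : Prop where
  exists_third : ∀ a b, G.Adj a b → ∃ c, G.Adj a c ∧ G.Adj b c
  unique : ∀ a b c x, G.Adj a b → G.Adj a c → G.Adj b c → G.Adj a x → G.Adj b x → x = c
  cover : ∀ a b c x, G.Adj a b → G.Adj a c → G.Adj b c → x ≠ a → x ≠ b → x ≠ c →
    G.Adj a x ∨ G.Adj b x ∨ G.Adj c x

/-- The double-six configuration. -/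
structure IsDoubleSix (G : SimpleGraph V) (a b : Fin 6 → V) : Prop where
  left : ∀ i j, ¬ G.Adj (a i) (a j)
  right : ∀ i j, ¬ G.Adj (b i) (b j)
  adj : ∀ i j, G.Adj (a i) (b j) ↔ i ≠ j

lemma IsDoubleSix.left_injective {a b : Fin 6 → V} (h : IsDoubleSix G a b) :
    Function.Injective a := by
  intro i j hij
  by_contra hne
  have := (h.adj i j).mpr hne
  rw [hij, h.adj] at this
  exact this rfl

lemma IsDoubleSix.right_injective {a b : Fin 6 → V} (h : IsDoubleSix G a b) :
    Function.Injective b := by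
  intro i j hij
  by_contra hne
  have := (h.adj i j).mpr hne
  rw [← hij, h.adj] at this
  exact this rfl

lemma IsDoubleSix.ne {a b : Fin 6 → V} (h : IsDoubleSix G a b) (i j : Fin 6) : a i ≠ b j := by
  intro hij
  obtain ⟨l, hl⟩ := exists_ne i
  have := (h.adj i l).mpr hl.symm
  rw [hij] at this
  exact h.right _ _ this

/-- The vertices of the intersection graph of the lines on a cubic surface. -/
abbrev SchlaefliVertex : Type := Fin 6 ⊕ Fin 6 ⊕ {p : Fin 6 × Fin 6 // p.1 < p.2}

/-- Adjacency in the intersection graph of the lines on a cubic surface. -/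
def schlaefliAdj : SchlaefliVertex → SchlaefliVertex → Prop
  | .inl _, .inl _ => False
  | .inl i, .inr (.inl j) => i ≠ j
  | .inl i, .inr (.inr p) => i = p.1.1 ∨ i = p.1.2
  | .inr (.inl i), .inl j => j ≠ i
  | .inr (.inl _), .inr (.inl _) => False
  | .inr (.inl i), .inr (.inr p) => i = p.1.1 ∨ i = p.1.2
  | .inr (.inr p), .inl i => i = p.1.1 ∨ i = p.1.2
  | .inr (.inr p), .inr (.inl i) => i = p.1.1 ∨ i = p.1.2
  | .inr (.inr p), .inr (.inr p') =>
    ¬ ((p'.1.1 = p.1.1 ∨ p'.1.1 = p.1.2) ∨ (p'.1.2 = p.1.1 ∨ p'.1.2 = p.1.2))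

variable {a b : Fin 6 → V}

lemma IsDoubleSix.adj_third_left (hG : IsTritangent G) (h : IsDoubleSix G a b) {i j : Fin 6}
    (hij : i ≠ j) {c : V} (h1 : G.Adj (a i) c) (h2 : G.Adj (b j) c) (l : Fin 6) :
    G.Adj (b l) c ↔ l = i ∨ l = j := by
  have hab := (h.adj i j).mpr hij
  have hcb : ∀ l, c ≠ b l := fun l hl => h.right j l (hl ▸ h2)
  constructor
  · intro hl
    by_contra! hne
    have := hG.unique (a i) c (b j) (b l) h1 hab h2.symm ((h.adj i l).mpr hne.1.symm) hl.symm
    exact hne.2 (h.right_injective this)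
  · rintro (rfl | rfl)
    · rcases hG.cover (a l) (b j) c (b l) hab h1 h2 (h.ne _ _).symm
        (fun he => hij (h.right_injective he)) (hcb l).symm with h3 | h3 | h3
      · exact absurd rfl ((h.adj _ _).mp h3)
      · exact absurd h3 (h.right _ _)
      · exact h3.symm
    · exact h2

lemma IsDoubleSix.symm (h : IsDoubleSix G a b) : IsDoubleSix G b a where
  left := h.right
  right := h.left
  adj i j := by rw [G.adj_comm, h.adj, ne_comm]

lemma exists_schlaefli_equiv [Fintype V] (hcard : Fintype.card V ≤ 27) (hG : IsTritangent G)
    (h : IsDoubleSix G a b) :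
    ∃ ψ : SchlaefliVertex ≃ V, ∀ x y, G.Adj (ψ x) (ψ y) ↔ schlaefliAdj x y := by
  have hthird : ∀ p : {p : Fin 6 × Fin 6 // p.1 < p.2}, ∃ c, G.Adj (a p.1.1) c ∧
      G.Adj (b p.1.2) c := fun p => hG.exists_third _ _ ((h.adj _ _).mpr p.2.ne)
  choose c hca hcb using hthird
  have hb : ∀ p l, G.Adj (b l) (c p) ↔ l = p.1.1 ∨ l = p.1.2 := fun p l =>
    h.adj_third_left hG p.2.ne (hca p) (hcb p) l
  have ha : ∀ p l, G.Adj (a l) (c p) ↔ l = p.1.1 ∨ l = p.1.2 := fun p l =>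
    (h.symm.adj_third_left hG p.2.ne' (hcb p) (hca p) l).trans or_comm
  have hane : ∀ p l, a l ≠ c p := fun p l hl => h.left _ l (hl ▸ hca p)
  have hbne : ∀ p l, b l ≠ c p := fun p l hl => h.right _ l (hl ▸ hcb p)
  have hcinj : ∀ p p', c p = c p' → p = p' := by
    rintro ⟨⟨i, j⟩, hij⟩ p' hpp
    have h1 := (ha _ i).mp (hpp ▸ (ha ⟨(i, j), hij⟩ i).mpr (Or.inl rfl))
    have h2 := (ha _ j).mp (hpp ▸ (ha ⟨(i, j), hij⟩ j).mpr (Or.inr rfl))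
    obtain ⟨⟨i', j'⟩, hij'⟩ := p'
    simp only at h1 h2 hij hij'
    ext <;> simp only <;> omega
  have hcc : ∀ p p', G.Adj (c p) (c p') ↔
      ¬ ((p'.1.1 = p.1.1 ∨ p'.1.1 = p.1.2) ∨ (p'.1.2 = p.1.1 ∨ p'.1.2 = p.1.2)) := by
    intro p p'
    have hab := (h.adj p'.1.1 p'.1.2).mpr p'.2.ne
    constructor
    · rintro hadj (h1 | h1)
      · rw [← ha] at h1
        exact hbne p _ (hG.unique (a p'.1.1) (c p') (b p'.1.2) (c p) (hca p') hab (hcb p').symm h1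
          hadj.symm).symm
      · rw [← hb] at h1
        exact hane p _ (hG.unique (b p'.1.2) (c p') (a p'.1.1) (c p) (hcb p') hab.symm
          (hca p').symm h1 hadj.symm).symm
    · intro hne
      rw [not_or, ← ha, ← hb] at hne
      rcases hG.cover _ _ _ (c p) hab (hca p') (hcb p') (hane _ _).symm (hbne _ _).symm
        (by rintro he; rw [he] at hne; exact hne.1 (hca p')) with h3 | h3 | h3
      · exact absurd h3 hne.1
      · exact absurd h3 hne.2
      · exact h3.symm
  let ψ : SchlaefliVertex → V := Sum.elim a (Sum.elim b c)
  have hinj : Function.Injective ψ := by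
    refine Function.Injective.sumElim h.left_injective
      (Function.Injective.sumElim h.right_injective (fun p p' => hcinj p p') fun l p => hbne p l) ?_
    rintro i (j | p)
    · exact h.ne i j
    · exact hane p i
  have hbij : Function.Bijective ψ := by
    rw [Fintype.bijective_iff_injective_and_card]
    refine ⟨hinj, le_antisymm (Fintype.card_le_of_injective ψ hinj) (hcard.trans ?_)⟩
    decide
  refine ⟨Equiv.ofBijective ψ hbij, ?_⟩
  rintro (i | i | p) (j | j | p')
  · exact iff_of_false (h.left i j) id
  · exact h.adj i j
  · exact ha p' i
  · exact (G.adj_comm _ _).trans (h.adj j i)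
  · exact iff_of_false (h.right i j) id
  · exact hb p' i
  · exact (G.adj_comm _ _).trans (ha p j)
  · exact (G.adj_comm _ _).trans (hb p j)
  · exact hcc p p'

open scoped Classical in
lemma IsTritangent.degree_eq [Fintype V] (hG : IsTritangent G) (hcard : 27 ≤ Fintype.card V)
    (hdeg : ∀ v, G.degree v ≤ 10) (hnb : ∀ v, ∃ w, G.Adj v w) :
    Fintype.card V ≤ 27 ∧ ∀ v, G.degree v = 10 := by
  have key : ∀ v, Fintype.card V ≤ G.degree v + 17 := by
    intro v
    obtain ⟨b, hvb⟩ := hnb v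
    obtain ⟨c, hvc, hbc⟩ := hG.exists_third v b hvb
    have hsub : (Finset.univ : Finset V) ⊆ G.neighborFinset v ∪ ((G.neighborFinset b).erase c ∪
        ((G.neighborFinset c).erase v).erase b) := by
      intro x _
      simp only [Finset.mem_union, Finset.mem_erase, SimpleGraph.mem_neighborFinset]
      by_cases hxb : x = b
      · left; rw [hxb]; exact hvb
      by_cases hxc : x = c
      · left; rw [hxc]; exact hvc
      by_cases hxv : x = v
      · right; left; rw [hxv]; exact ⟨hvc.ne, hvb.symm⟩
      rcases hG.cover v b c x hvb hvc hbc hxv hxb hxc with h | h | h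
      · exact Or.inl h
      · exact Or.inr (Or.inl ⟨hxc, h⟩)
      · exact Or.inr (Or.inr ⟨hxb, hxv, h⟩)
    have h1 := Finset.card_le_card hsub
    have h2 := Finset.card_union_le (G.neighborFinset v) ((G.neighborFinset b).erase c ∪
        ((G.neighborFinset c).erase v).erase b)
    have h3 := Finset.card_union_le ((G.neighborFinset b).erase c)
        (((G.neighborFinset c).erase v).erase b)
    have h4 : ((G.neighborFinset b).erase c).card = G.degree b - 1 := by
      rw [Finset.card_erase_of_mem (by simpa using hbc), SimpleGraph.card_neighborFinset_eq_degree]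
    have h5 : (((G.neighborFinset c).erase v).erase b).card = G.degree c - 1 - 1 := by
      rw [Finset.card_erase_of_mem, Finset.card_erase_of_mem (by simpa using hvc.symm),
        SimpleGraph.card_neighborFinset_eq_degree]
      simpa using ⟨hvb.ne', hbc.symm⟩
    rw [Finset.card_univ] at h1
    rw [SimpleGraph.card_neighborFinset_eq_degree] at h2
    have h6 := hdeg b
    have h7 := hdeg c
    omega
  have hpos : 0 < Fintype.card V := by omega
  obtain ⟨v⟩ := Fintype.card_pos_iff.mp hpos
  refine ⟨(key v).trans (by have := hdeg v; omega), fun w => le_antisymm (hdeg w) ?_⟩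
  have := key w
  omega

open scoped Classical in
lemma IsTritangent.exists_isDoubleSix [Fintype V] (hG : IsTritangent G)
    (hcard : 27 ≤ Fintype.card V) (hdeg : ∀ v, G.degree v = 10) :
    ∃ a b, IsDoubleSix G a b := by
  have hpos : 0 < Fintype.card V := by omega
  obtain ⟨a₀⟩ := Fintype.card_pos_iff.mp hpos
  obtain ⟨b₀, hb₀⟩ : ∃ b₀, b₀ ∉ insert a₀ (G.neighborFinset a₀) := by
    by_contra! hcon
    have h1 := Finset.card_le_card (fun x _ => hcon x :
      (Finset.univ : Finset V) ⊆ insert a₀ (G.neighborFinset a₀))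
    have h2 := Finset.card_insert_le a₀ (G.neighborFinset a₀)
    rw [SimpleGraph.card_neighborFinset_eq_degree, hdeg] at h2
    rw [Finset.card_univ] at h1
    omega
  simp only [Finset.mem_insert, SimpleGraph.mem_neighborFinset, not_or] at hb₀
  obtain ⟨hba, hab⟩ := hb₀
  have hthird : ∀ x y, ∃ z, G.Adj x y → G.Adj x z ∧ G.Adj y z := by
    intro x y
    by_cases hxy : G.Adj x y
    · obtain ⟨z, hz⟩ := hG.exists_third x y hxy
      exact ⟨z, fun _ => hz⟩
    · exact ⟨x, fun h => absurd h hxy⟩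
  choose τ hτ using hthird
  have hττ : ∀ x y, G.Adj x y → τ x (τ x y) = y := fun x y hxy =>
    (hG.unique x (τ x y) _ y (hτ x y hxy).1 (hτ _ _ (hτ x y hxy).1).1 (hτ _ _ (hτ x y hxy).1).2 hxy
      (hτ x y hxy).2.symm).symm
  let C : Finset V := (G.neighborFinset a₀).filter (G.Adj b₀)
  have hC : C.card = 5 := by
    have h1 : C.card = ((G.neighborFinset a₀).filter fun x => ¬ G.Adj b₀ x).card := by
      refine Finset.card_nbij' (τ a₀) (τ a₀) ?_ ?_ ?_ ?_
      · intro x hx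
        simp only [C, Finset.coe_filter, SimpleGraph.mem_neighborFinset, Set.mem_ofPred_eq] at hx ⊢
        refine ⟨(hτ _ _ hx.1).1, fun h => ?_⟩
        exact hba (hG.unique x (τ a₀ x) a₀ b₀ (hτ _ _ hx.1).2 hx.1.symm (hτ _ _ hx.1).1.symm
          hx.2.symm h.symm)
      · intro x hx
        simp only [C, Finset.coe_filter, SimpleGraph.mem_neighborFinset, Set.mem_ofPred_eq] at hx ⊢
        refine ⟨(hτ _ _ hx.1).1, ?_⟩
        rcases hG.cover a₀ x (τ a₀ x) b₀ hx.1 (hτ _ _ hx.1).1 (hτ _ _ hx.1).2 hba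
          (by rintro rfl; exact hab hx.1) (by intro he; exact hab (he ▸ (hτ _ _ hx.1).1))
          with h | h | h
        · exact absurd h hab
        · exact absurd h.symm hx.2
        · exact h.symm
      · intro x hx
        simp only [C, Finset.coe_filter, SimpleGraph.mem_neighborFinset, Set.mem_ofPred_eq] at hx
        exact hττ _ _ hx.1
      · intro x hx
        simp only [Finset.coe_filter, SimpleGraph.mem_neighborFinset, Set.mem_ofPred_eq] at hx
        exact hττ _ _ hx.1
    have h2 := Finset.card_filter_add_card_filter_not (s := G.neighborFinset a₀) (G.Adj b₀)
    rw [SimpleGraph.card_neighborFinset_eq_degree, hdeg] at h2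
    change C.card + _ = _ at h2
    omega
  let c : Fin 5 → V := fun i => (C.equivFinOfCardEq hC).symm i
  have hcinj : Function.Injective c :=
    Subtype.val_injective.comp (C.equivFinOfCardEq hC).symm.injective
  have hcC : ∀ i, G.Adj a₀ (c i) ∧ G.Adj b₀ (c i) := by
    intro i
    have := ((C.equivFinOfCardEq hC).symm i).2
    simpa only [C, Finset.mem_filter, SimpleGraph.mem_neighborFinset] using this
  have main : ∀ x y : V, y ≠ x → ¬ G.Adj x y → (∀ i, G.Adj x (c i) ∧ G.Adj y (c i)) →
      (∀ i j, i ≠ j → ¬ G.Adj (c i) (c j)) ∧ (∀ i, ¬ G.Adj x (τ y (c i))) ∧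
      (∀ i j, ¬ G.Adj (τ y (c i)) (τ y (c j))) ∧ (∀ i j, G.Adj (τ y (c i)) (c j) ↔ i = j) := by
    intro x y hyx hxy hc
    have k1 : ∀ i j, i ≠ j → ¬ G.Adj (c i) (c j) := by
      intro i j hij hadj
      exact hyx (hG.unique (c i) (c j) x y hadj (hc i).1.symm (hc j).1.symm (hc i).2.symm
        (hc j).2.symm)
    have k2 : ∀ i, ¬ G.Adj x (τ y (c i)) := by
      intro i h
      have h1 := hτ y (c i) (hc i).2
      exact hyx (hG.unique (c i) (τ y (c i)) y x h1.2 (hc i).2.symm h1.1.symm (hc i).1.symm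
        h.symm).symm
    have hne : ∀ i j, τ y (c i) ≠ c j := fun i j he => k2 i (he ▸ (hc j).1)
    have k4 : ∀ i j, G.Adj (τ y (c i)) (c j) ↔ i = j := by
      intro i j
      constructor
      · intro hadj
        have h1 := hτ y (c i) (hc i).2
        exact hcinj (hG.unique y (τ y (c i)) (c i) (c j) h1.1 (hc i).2 h1.2.symm (hc j).2 hadj).symm
      · rintro rfl
        exact (hτ y (c i) (hc i).2).2.symm
    refine ⟨k1, k2, ?_, k4⟩
    intro i j hadj
    have h1 := hτ y (c i) (hc i).2
    have h2 := hτ y (c j) (hc j).2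
    exact hne j i (hG.unique y (τ y (c i)) (c i) _ h1.1 (hc i).2 h1.2.symm h2.1 hadj)
  obtain ⟨m1, m2, m3, m4⟩ := main a₀ b₀ hba hab hcC
  obtain ⟨-, n2, n3, n4⟩ := main b₀ a₀ (Ne.symm hba) (fun h => hab h.symm) fun i => (hcC i).symm
  refine ⟨Fin.cons a₀ fun i => τ b₀ (c i), Fin.cons b₀ fun i => τ a₀ (c i), ?_, ?_, ?_⟩
  · intro i j
    refine Fin.cases ?_ (fun i => ?_) i <;> refine Fin.cases ?_ (fun j => ?_) j
    · simp
    · simpa using m2 j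
    · simpa using fun h => m2 i (G.adj_symm h)
    · simpa using m3 i j
  · intro i j
    refine Fin.cases ?_ (fun i => ?_) i <;> refine Fin.cases ?_ (fun j => ?_) j
    · simp
    · simpa using n2 j
    · simpa using fun h => n2 i (G.adj_symm h)
    · simpa using n3 i j
  · intro i j
    refine Fin.cases ?_ (fun i => ?_) i <;> refine Fin.cases ?_ (fun j => ?_) j
    · simpa using hab
    · simpa [(Fin.succ_ne_zero j).symm] using (hτ a₀ (c j) (hcC j).1).1
    · simpa using (hτ b₀ (c i) (hcC i).2).1.symm
    · simp only [Fin.cons_succ, ne_eq, Fin.succ_inj]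
      constructor
      · rintro h rfl
        have h1 := hτ b₀ (c i) (hcC i).2
        have h2 := hτ a₀ (c i) (hcC i).1
        have h3 := hG.unique (c i) (τ a₀ (c i)) a₀ _ h2.2 (hcC i).1.symm h2.1.symm h1.2 h.symm
        exact hab (h3 ▸ h1.1).symm
      · intro hij
        have h2 := hτ a₀ (c j) (hcC j).1
        have e1 : τ b₀ (c i) ≠ a₀ := fun he => hab (he ▸ (hτ b₀ (c i) (hcC i).2).1).symm
        have e2 : τ b₀ (c i) ≠ c j := fun he => m2 i (he ▸ (hcC j).1)
        have e3 : τ b₀ (c i) ≠ τ a₀ (c j) := fun he => m2 i (he ▸ h2.1)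
        rcases hG.cover a₀ (c j) (τ a₀ (c j)) (τ b₀ (c i)) (hcC j).1 h2.1 h2.2 e1 e2 e3
          with h | h | h
        · exact absurd h (m2 i)
        · exact absurd ((m4 i j).mp h.symm) hij
        · exact h.symm

open scoped Classical in
/-- A tritangent configuration of at least 27 lines is unique. -/
lemma exists_equiv_of_isTritangent {V' : Type*} [Fintype V] [Fintype V'] {G' : SimpleGraph V'}
    (hG : IsTritangent G) (hcard : 27 ≤ Fintype.card V)
    (hdeg : ∀ v, G.degree v ≤ 10) (hnb : ∀ v, ∃ w, G.Adj v w)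
    (hG' : IsTritangent G') (hcard' : 27 ≤ Fintype.card V')
    (hdeg' : ∀ v, G'.degree v ≤ 10) (hnb' : ∀ v, ∃ w, G'.Adj v w) :
    ∃ φ : V ≃ V', ∀ x y, G.Adj x y ↔ G'.Adj (φ x) (φ y) := by
  obtain ⟨h1, h2⟩ := hG.degree_eq hcard hdeg hnb
  obtain ⟨h1', h2'⟩ := hG'.degree_eq hcard' hdeg' hnb'
  obtain ⟨a, b, hab⟩ := hG.exists_isDoubleSix hcard h2
  obtain ⟨a', b', hab'⟩ := hG'.exists_isDoubleSix hcard' h2'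
  obtain ⟨ψ, hψ⟩ := exists_schlaefli_equiv h1 hG hab
  obtain ⟨ψ', hψ'⟩ := exists_schlaefli_equiv h1' hG' hab'
  refine ⟨ψ.symm.trans ψ', fun x y => ?_⟩
  rw [Equiv.trans_apply, Equiv.trans_apply, hψ', ← hψ, ψ.apply_symm_apply, ψ.apply_symm_apply]

end Configuration

section Cubic

variable {k : Type*} [Field k] {f : MvPolynomial (Fin 4) k}

lemma exists_det4_ne_zero_of_notMem {e₁ e₂ g : Fin 4 → k} (h : LinearIndependent k ![e₁, e₂])
    (hg : g ∉ Submodule.span k {e₁, e₂}) : ∃ g', det4 e₁ e₂ g g' ≠ 0 := by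
  obtain ⟨c, e, hdet⟩ := exists_det4_ne_zero h
  obtain ⟨x, y, z, w, rfl⟩ := exists_coordinates hdet g
  by_cases hz : z = 0
  · have hw : w ≠ 0 := by
      rintro rfl
      apply hg
      rw [Submodule.mem_span_pair]
      exact ⟨x, y, by simp [hz]⟩
    refine ⟨c, ?_⟩
    have : det4 e₁ e₂ (x • e₁ + y • e₂ + z • c + w • e) c = -w * det4 e₁ e₂ c e := by
      simp only [det4_eq, Pi.add_apply, Pi.smul_apply, smul_eq_mul]
      ring
    rw [this]
    exact mul_ne_zero (neg_ne_zero.mpr hw) hdet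
  · refine ⟨e, ?_⟩
    have : det4 e₁ e₂ (x • e₁ + y • e₂ + z • c + w • e) e = z * det4 e₁ e₂ c e := by
      simp only [det4_eq, Pi.add_apply, Pi.smul_apply, smul_eq_mul]
      ring
    rw [this]
    exact mul_ne_zero hz hdet

/-- The gradient at a nonzero point of a smooth surface does not vanish on a frame. -/
lemma IsSmooth.exists_polar_ne_zero {d : ℕ} (hf : IsSmoothSurface f d) {P : Fin 4 → k} (hP : P ≠ 0)
    (hfP : eval P f = 0) {a b c e : Fin 4 → k} (h : det4 a b c e ≠ 0)
    (ha : polar f 1 P a = 0) (hb : polar f 1 P b = 0) (hc : polar f 1 P c = 0) :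
    polar f 1 P e ≠ 0 := by
  intro he
  obtain ⟨i, hi⟩ := IsSmooth.exists_grad_ne hf hP hfP
  apply hi
  obtain ⟨x, y, z, w, hD⟩ := exists_coordinates h (Pi.single i 1)
  have h1 : polar f 1 P (Pi.single i 1) = 0 := by
    simp only [hD, polar_one_add, polar_one_smul, ha, hb, hc, he]
    simp
  rw [polar_one'] at h1
  simpa [Pi.single_apply] using h1

lemma exists_quadratic_root [IsAlgClosed k] {a : k} (ha : a ≠ 0) (b c : k) :
    ∃ x, a * x ^ 2 + b * x + c = 0 := by
  obtain ⟨x, hx⟩ := IsAlgClosed.exists_root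
    (Polynomial.C a * Polynomial.X ^ 2 + Polynomial.C b * Polynomial.X + Polynomial.C c)
    (by rw [Polynomial.degree_quadratic ha]; decide)
  exact ⟨x, by simpa [Polynomial.IsRoot] using hx⟩

lemma exists_binary_root [IsAlgClosed k] (a b c : k) :
    ∃ s t : k, (s ≠ 0 ∨ t ≠ 0) ∧ a * s ^ 2 + b * s * t + c * t ^ 2 = 0 := by
  by_cases ha : a = 0
  · exact ⟨1, 0, by simp, by simp [ha]⟩
  · obtain ⟨x, hx⟩ := exists_quadratic_root ha b c
    exact ⟨x, 1, by simp, by simpa using hx⟩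

/-- The mixed coefficient of the polar pairing of a line with a vector. -/
noncomputable def mixed (f : MvPolynomial (Fin 4) k) (e₁ e₂ g : Fin 4 → k) : k :=
  polar f 1 (e₁ + e₂) g - polar f 1 e₁ g - polar f 1 e₂ g

variable [Infinite k]

lemma polar_one_combination (hf : f.IsHomogeneous 3) (e₁ e₂ g : Fin 4 → k) (s t : k) :
    polar f 1 (s • e₁ + t • e₂) g =
      polar f 1 e₁ g * s ^ 2 + mixed f e₁ e₂ g * s * t + polar f 1 e₂ g * t ^ 2 := by
  have h := (derivAlong_spec (q := 2) hf e₁ e₂ g).2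
  have h1 := h 1 0
  have h2 := h 0 1
  have h3 := h 1 1
  rw [← h s t]
  simp only [binEval, Finset.sum_range_succ, Finset.sum_range_zero, one_smul, zero_smul, add_zero,
    zero_add] at h1 h2 h3 ⊢
  norm_num at h1 h2 h3 ⊢
  rw [mixed, ← h1, ← h2, ← h3]
  ring

lemma eval_plane (hf : f.IsHomogeneous 3) {L : Submodule k (Fin 4 → k)} (hL : IsLineOn f L)
    {e₁ e₂ : Fin 4 → k} (h₁ : e₁ ∈ L) (h₂ : e₂ ∈ L) (g : Fin 4 → k) (s t r : k) :
    eval (s • e₁ + t • e₂ + r • g) f =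
      r * (polar f 1 e₁ g * s ^ 2 + mixed f e₁ e₂ g * s * t + polar f 1 e₂ g * t ^ 2) +
        r ^ 2 * (polar f 1 g e₁ * s + polar f 1 g e₂ * t) + r ^ 3 * eval g f := by
  have h := eval_smul_add_smul hf (s • e₁ + t • e₂) g 1 r
  have h0 : polar f 0 (s • e₁ + t • e₂) g = 0 := by
    rw [polar_zero']
    exact hL.2 _ (L.add_mem (L.smul_mem _ h₁) (L.smul_mem _ h₂))
  have h2' : polar f 2 (s • e₁ + t • e₂) g = polar f 1 g e₁ * s + polar f 1 g e₂ * t := by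
    rw [polar_swap hf (by norm_num)]
    norm_num
    rw [polar_one_add, polar_one_smul, polar_one_smul]
    ring
  have h3 : polar f 3 (s • e₁ + t • e₂) g = eval g f := by
    rw [polar_swap hf le_rfl, polar_zero']
  simp only [Finset.sum_range_succ, Finset.sum_range_zero, one_smul, one_pow, h0, h2', h3,
    polar_one_combination hf] at h
  rw [h]
  ring

/-- A smooth cubic surface is not singular along a plane section containing a line. -/
lemma polar_line_ne_zero [IsAlgClosed k] (hf : IsSmoothSurface f 3)
    {L : Submodule k (Fin 4 → k)} (hL : IsLineOn f L) {e₁ e₂ g : Fin 4 → k} (h₁ : e₁ ∈ L)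
    (h₂ : e₂ ∈ L) (hli : LinearIndependent k ![e₁, e₂]) (hg : g ∉ L)
    (hA : polar f 1 e₁ g = 0) (hB : mixed f e₁ e₂ g = 0) : polar f 1 e₂ g ≠ 0 := by
  intro hC
  have hspan := eq_span_pair hL.1 hli h₁ h₂
  obtain ⟨g', hdet⟩ := exists_det4_ne_zero_of_notMem hli (hspan ▸ hg)
  obtain ⟨s, t, hst, h0⟩ := exists_binary_root (polar f 1 e₁ g') (mixed f e₁ e₂ g')
    (polar f 1 e₂ g')
  have hPL : s • e₁ + t • e₂ ∈ L := L.add_mem (L.smul_mem _ h₁) (L.smul_mem _ h₂)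
  refine IsSmooth.exists_polar_ne_zero hf (P := s • e₁ + t • e₂) ?_ (hL.2 _ hPL) hdet
    (IsLineOn.polar_eq_zero hL hPL h₁ 1) (IsLineOn.polar_eq_zero hL hPL h₂ 1) ?_ ?_
  · intro he
    have := LinearIndependent.pair_iff.mp hli s t he
    tauto
  · rw [polar_one_combination hf.2.1, hA, hB, hC]
    simp
  · rw [polar_one_combination hf.2.1, h0]

lemma linear_forms_mul_eq_zero {a₁ b₁ a₂ b₂ a₃ b₃ : k}
    (h : ∀ α β : k, (a₁ * α + b₁ * β) * (a₂ * α + b₂ * β) * (a₃ * α + b₃ * β) = 0) :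
    (a₁ = 0 ∧ b₁ = 0) ∨ (a₂ = 0 ∧ b₂ = 0) ∨ (a₃ = 0 ∧ b₃ = 0) := by
  have key : ∀ a b : k, Polynomial.C a * Polynomial.X + Polynomial.C b = 0 → a = 0 ∧ b = 0 := by
    intro a b hab
    have h0 := congrArg (Polynomial.eval 0) hab
    have h1 := congrArg (Polynomial.eval 1) hab
    simp at h0 h1
    rw [h0] at h1
    exact ⟨by simpa using h1, h0⟩
  have : (Polynomial.C a₁ * Polynomial.X + Polynomial.C b₁) *
      (Polynomial.C a₂ * Polynomial.X + Polynomial.C b₂) *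
      (Polynomial.C a₃ * Polynomial.X + Polynomial.C b₃) = 0 := by
    refine Polynomial.funext fun x => ?_
    have := h x 1
    simp only [mul_one] at this
    simpa [mul_assoc] using this
  rcases mul_eq_zero.mp this with h' | h'
  · rcases mul_eq_zero.mp h' with h' | h'
    · exact Or.inl (key _ _ h')
    · exact Or.inr (Or.inl (key _ _ h'))
  · exact Or.inr (Or.inr (key _ _ h'))

end Cubic

section Tritangent

variable {k : Type*} [Field k] [IsAlgClosed k] {f : MvPolynomial (Fin 4) k}

/-- Coordinates on the plane spanned by two intersecting lines of a smooth cubic surface. -/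
lemma exists_tritangent_coordinates (hf : IsSmoothSurface f 3) {a b : Submodule k (Fin 4 → k)}
    (ha : IsLineOn f a) (hb : IsLineOn f b) (hab : a ≠ b) (h : a ⊓ b ≠ ⊥) :
    ∃ (P U V Y : Fin 4 → k) (B C E : k), det4 P U V Y ≠ 0 ∧ P ∈ a ∧ P ∈ b ∧ U ∈ a ∧ V ∈ b ∧
      (B ≠ 0 ∨ C ≠ 0) ∧ (B ≠ 0 ∨ E ≠ 0) ∧
      ∀ s t r : k, eval (s • P + t • U + r • V) f = t * r * (B * s + C * t + E * r) := by
  have : Infinite k := IsAlgClosed.instInfinite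
  obtain ⟨P, hP0, hPa, hPb⟩ := inf_ne_bot_iff.mp h
  obtain ⟨V, hVb, hVa⟩ : ∃ V ∈ b, V ∉ a := by
    by_contra! hcon
    exact hab (Submodule.eq_of_le_of_finrank_eq hcon (by rw [ha.1, hb.1])).symm
  obtain ⟨U, hUa, hUb⟩ : ∃ U ∈ a, U ∉ b := by
    by_contra! hcon
    exact hab (Submodule.eq_of_le_of_finrank_eq hcon (by rw [ha.1, hb.1]))
  have hPU := linearIndependent_of_notMem hPb hP0 hUb
  have hPV := linearIndependent_of_notMem hPa hP0 hVa
  obtain ⟨Y, hdet⟩ := exists_det4_ne_zero_of_notMem hPU (eq_span_pair ha.1 hPU hPa hUa ▸ hVa)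
  have hA : polar f 1 P V = 0 := IsLineOn.polar_eq_zero hb hPb hVb 1
  have hA' : polar f 1 P U = 0 := IsLineOn.polar_eq_zero ha hPa hUa 1
  have hD : polar f 1 V P = 0 := IsLineOn.polar_eq_zero hb hVb hPb 1
  have hD' : polar f 1 U P = 0 := IsLineOn.polar_eq_zero ha hUa hPa 1
  have hplane := eval_plane hf.2.1 ha hPa hUa V
  have hplane' := eval_plane hf.2.1 hb hPb hVb U
  have hmix : mixed f P U V = mixed f P V U := by
    have h1 := hplane 1 1 1
    have h2 := hplane' 1 1 1
    rw [add_right_comm, h2] at h1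
    simp only [hA, hA', hD, hD', ha.2 _ hUa, hb.2 _ hVb] at h1
    linear_combination -h1
  refine ⟨P, U, V, Y, mixed f P U V, polar f 1 U V, polar f 1 V U, hdet, hPa, hPb, hUa, hVb,
    ?_, ?_, ?_⟩
  · by_contra! hcon
    exact polar_line_ne_zero hf ha hPa hUa hPU hVa hA hcon.1 hcon.2
  · by_contra! hcon
    exact polar_line_ne_zero hf hb hPb hVb hPV hUb hA' (hmix ▸ hcon.1) hcon.2
  · intro s t r
    rw [hplane, hA, hD, hb.2 _ hVb]
    ring

/-- The third line in a plane containing two lines of a smooth cubic surface. -/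
lemma exists_tritangent (hf : IsSmoothSurface f 3) {a b : Submodule k (Fin 4 → k)}
    (ha : IsLineOn f a) (hb : IsLineOn f b) (hab : a ≠ b) (h : a ⊓ b ≠ ⊥) :
    ∃ c, IsLineOn f c ∧ c ≠ a ∧ c ≠ b ∧ a ⊓ c ≠ ⊥ ∧ b ⊓ c ≠ ⊥ ∧
      (∀ x, IsLineOn f x → x ≠ a → x ≠ b → a ⊓ x ≠ ⊥ → b ⊓ x ≠ ⊥ → x = c) ∧
      ∀ x, IsLineOn f x → a ⊓ x ≠ ⊥ ∨ b ⊓ x ≠ ⊥ ∨ c ⊓ x ≠ ⊥ := by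
  have : Infinite k := IsAlgClosed.instInfinite
  obtain ⟨P, U, V, Y, B, C, E, hdet, hPa, hPb, hUa, hVb, hBC, hBE, hplane⟩ :=
    exists_tritangent_coordinates hf ha hb hab h
  have hli := linearIndependent_of_det4 hdet
  have hcoord : ∀ s t r w : k, s • P + t • U + r • V + w • Y = 0 →
      s = 0 ∧ t = 0 ∧ r = 0 ∧ w = 0 := by
    intro s t r w h0
    have := Fintype.linearIndependent_iff.mp hli ![s, t, r, w] (by
      simpa [Fin.sum_univ_four] using h0)
    exact ⟨this 0, this 1, this 2, this 3⟩
  have hPU : LinearIndependent k ![P, U] := by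
    rw [LinearIndependent.pair_iff]
    intro s t h0
    have := hcoord s t 0 0 (by simpa using h0)
    exact ⟨this.1, this.2.1⟩
  have hPV : LinearIndependent k ![P, V] := by
    rw [LinearIndependent.pair_iff]
    intro s t h0
    have := hcoord s 0 t 0 (by simpa using h0)
    exact ⟨this.1, this.2.2.1⟩
  have hP0 : P ≠ 0 := hPU.ne_zero 0
  have haspan := eq_span_pair ha.1 hPU hPa hUa
  have hbspan := eq_span_pair hb.1 hPV hPb hVb
  -- membership in the two given lines
  have hmema : ∀ s t r w : k, s • P + t • U + r • V + w • Y ∈ a → r = 0 ∧ w = 0 := by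
    intro s t r w hm
    rw [haspan, Submodule.mem_span_pair] at hm
    obtain ⟨x, y, hxy⟩ := hm
    have := hcoord (s - x) (t - y) r w (by
      rw [← sub_eq_zero] at hxy
      rw [← neg_eq_zero, ← hxy]
      module)
    exact this.2.2
  have hmemb : ∀ s t r w : k, s • P + t • U + r • V + w • Y ∈ b → t = 0 ∧ w = 0 := by
    intro s t r w hm
    rw [hbspan, Submodule.mem_span_pair] at hm
    obtain ⟨x, y, hxy⟩ := hm
    have := hcoord (s - x) t (r - y) w (by
      rw [← sub_eq_zero] at hxy
      rw [← neg_eq_zero, ← hxy]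
      module)
    exact ⟨this.2.1, this.2.2.2⟩
  -- the third line
  obtain ⟨c, hc, hca, hcb, hac, hbc, hcmem⟩ : ∃ c, IsLineOn f c ∧ c ≠ a ∧ c ≠ b ∧ a ⊓ c ≠ ⊥ ∧
      b ⊓ c ≠ ⊥ ∧ ∀ s t r : k, B * s + C * t + E * r = 0 → s • P + t • U + r • V ∈ c := by
    by_cases hB : B = 0
    · have hC : C ≠ 0 := by tauto
      have hE : E ≠ 0 := by tauto
      have hPZ : LinearIndependent k ![P, E • U - C • V] := by
        rw [LinearIndependent.pair_iff]
        intro s t h0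
        have := hcoord s (t * E) (-(t * C)) 0 (by rw [← h0]; module)
        exact ⟨this.1, by simpa [hE] using this.2.1⟩
      have hPc : P ∈ Submodule.span k {P, E • U - C • V} := Submodule.subset_span (by simp)
      have hZc : E • U - C • V ∈ Submodule.span k {P, E • U - C • V} :=
        Submodule.subset_span (by simp)
      refine ⟨Submodule.span k {P, E • U - C • V}, ⟨finrank_span_pair hPZ, ?_⟩, ?_, ?_,
        inf_ne_bot_iff.mpr ⟨P, hP0, hPa, hPc⟩, inf_ne_bot_iff.mpr ⟨P, hP0, hPb, hPc⟩, ?_⟩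
      · intro v hv
        obtain ⟨x, y, rfl⟩ := Submodule.mem_span_pair.mp hv
        have := hplane x (y * E) (-(y * C))
        rw [show x • P + y • (E • U - C • V) = x • P + (y * E) • U + (-(y * C)) • V by module,
          this, hB]
        ring
      · rintro rfl
        have := hmema 0 E (-C) 0 (by convert hZc using 1; module)
        simp [hC] at this
      · rintro rfl
        have := hmemb 0 E (-C) 0 (by convert hZc using 1; module)
        simp [hE] at this
      · intro s t r h0
        rw [Submodule.mem_span_pair]
        refine ⟨s, -(r / C), ?_⟩
        have ht : t = -(r / C) * E := by
          field_simp
          rw [hB] at h0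
          linear_combination h0
        rw [ht]
        have hr : r = (r / C) * C := by field_simp
        rw [show s • P + -(r / C) • (E • U - C • V) =
          s • P + (-(r / C) * E) • U + (r / C * C) • V by module, ← hr]
    · set Z₁ := U - (C / B) • P
      set Z₂ := V - (E / B) • P
      have hZ : LinearIndependent k ![Z₁, Z₂] := by
        rw [LinearIndependent.pair_iff]
        intro s t h0
        have := hcoord (-(s * (C / B)) - t * (E / B)) s t 0 (by rw [← h0]; module)
        exact ⟨this.2.1, this.2.2.1⟩
      have h1c : Z₁ ∈ Submodule.span k {Z₁, Z₂} := Submodule.subset_span (by simp)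
      have h2c : Z₂ ∈ Submodule.span k {Z₁, Z₂} := Submodule.subset_span (by simp)
      refine ⟨Submodule.span k {Z₁, Z₂}, ⟨finrank_span_pair hZ, ?_⟩, ?_, ?_,
        inf_ne_bot_iff.mpr ⟨Z₁, hZ.ne_zero 0, a.sub_mem hUa (a.smul_mem _ hPa), h1c⟩,
        inf_ne_bot_iff.mpr ⟨Z₂, hZ.ne_zero 1, b.sub_mem hVb (b.smul_mem _ hPb), h2c⟩, ?_⟩
      · intro v hv
        obtain ⟨x, y, rfl⟩ := Submodule.mem_span_pair.mp hv
        have := hplane (-(x * (C / B)) - y * (E / B)) x y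
        rw [show x • Z₁ + y • Z₂ = (-(x * (C / B)) - y * (E / B)) • P + x • U + y • V by
          simp only [Z₁, Z₂]; module, this]
        field_simp
        ring
      · intro he
        rw [he] at h2c
        have := hmema (-(E / B)) 0 1 0 (by convert h2c using 1; simp only [Z₂]; module)
        simp at this
      · intro he
        rw [he] at h1c
        have := hmemb (-(C / B)) 1 0 0 (by convert h1c using 1; simp only [Z₁]; module)
        simp at this
      · intro s t r h0
        rw [Submodule.mem_span_pair]
        refine ⟨t, r, ?_⟩
        have hs : s = -(t * (C / B)) - r * (E / B) := by
          field_simp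
          linear_combination h0
        rw [hs]
        simp only [Z₁, Z₂]
        module
  -- two independent vectors of a line in the plane
  have hinplane : ∀ x, IsLineOn f x → x ≠ a → x ≠ b → ∀ s t r s' t' r' : k,
      s • P + t • U + r • V ∈ x → s' • P + t' • U + r' • V ∈ x →
      LinearIndependent k ![s • P + t • U + r • V, s' • P + t' • U + r' • V] → x = c := by
    intro x hx hxa hxb s t r s' t' r' h1 h2 hxli
    rcases linear_forms_mul_eq_zero (a₁ := t) (b₁ := t') (a₂ := r) (b₂ := r')
        (a₃ := B * s + C * t + E * r) (b₃ := B * s' + C * t' + E * r') (by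
        intro α β
        have h3 := hx.2 _ (x.add_mem (x.smul_mem α h1) (x.smul_mem β h2))
        rw [show α • (s • P + t • U + r • V) + β • (s' • P + t' • U + r' • V) =
          (s * α + s' * β) • P + (t * α + t' * β) • U + (r * α + r' * β) • V by module, hplane] at h3
        linear_combination h3) with ⟨ht, ht'⟩ | ⟨hr, hr'⟩ | ⟨hl, hl'⟩
    · refine absurd (eq_of_mem_of_mem hx.1 hb.1 hxli h1 h2 ?_ ?_) hxb
      · rw [ht, zero_smul, add_zero]
        exact b.add_mem (b.smul_mem _ hPb) (b.smul_mem _ hVb)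
      · rw [ht', zero_smul, add_zero]
        exact b.add_mem (b.smul_mem _ hPb) (b.smul_mem _ hVb)
    · refine absurd (eq_of_mem_of_mem hx.1 ha.1 hxli h1 h2 ?_ ?_) hxa
      · rw [hr, zero_smul, add_zero]
        exact a.add_mem (a.smul_mem _ hPa) (a.smul_mem _ hUa)
      · rw [hr', zero_smul, add_zero]
        exact a.add_mem (a.smul_mem _ hPa) (a.smul_mem _ hUa)
    · exact eq_of_mem_of_mem hx.1 hc.1 hxli h1 h2 (hcmem _ _ _ hl) (hcmem _ _ _ hl')
  refine ⟨c, hc, hca, hcb, hac, hbc, ?_, ?_⟩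
  · intro x hx hxa hxb hax hbx
    obtain ⟨u, hu0, hua, hux⟩ := inf_ne_bot_iff.mp hax
    obtain ⟨v, hv0, hvb, hvx⟩ := inf_ne_bot_iff.mp hbx
    by_cases hua' : u ∈ b
    · -- the line passes through the common point
      have hPx : P ∈ x := by
        by_contra hPx
        refine hab (eq_of_mem_of_mem ha.1 hb.1 (linearIndependent_of_notMem hux hu0 hPx)
          hua hPa hua' hPb)
      obtain ⟨Q, hQx, hQa⟩ : ∃ Q ∈ x, Q ∉ a := by
        by_contra! hcon
        exact hxa (Submodule.eq_of_le_of_finrank_eq hcon (by rw [ha.1, hx.1]))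
      obtain ⟨s, t, r, w, rfl⟩ := exists_coordinates hdet Q
      have hw : w = 0 := by
        have h1 := IsLineOn.polar_eq_zero hx hPx hQx 1
        have hPU0 := IsLineOn.polar_eq_zero ha hPa hUa 1
        have hPV0 := IsLineOn.polar_eq_zero hb hPb hVb 1
        have hPP0 := IsLineOn.polar_eq_zero hb hPb hPb 1
        have hne := IsSmooth.exists_polar_ne_zero hf hP0 (ha.2 _ hPa) hdet hPP0 hPU0 hPV0
        simp only [polar_one_add, polar_one_smul, hPU0, hPV0, hPP0, mul_zero, zero_add] at h1
        exact (mul_eq_zero.mp h1).resolve_right hne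
      rw [hw, zero_smul, add_zero] at hQx hQa
      refine hinplane x hx hxa hxb 1 0 0 s t r (by simpa using hPx) hQx ?_
      simpa using linearIndependent_of_notMem hPa hP0 hQa
    · have huv := linearIndependent_of_notMem hvb hv0 hua'
      rw [haspan, Submodule.mem_span_pair] at hua
      rw [hbspan, Submodule.mem_span_pair] at hvb
      obtain ⟨s, t, rfl⟩ := hua
      obtain ⟨s', r', rfl⟩ := hvb
      exact hinplane x hx hxa hxb s' 0 r' s t 0 (by simpa using hvx) (by simpa using hux)
        (by simpa using huv)
  · intro x hx
    obtain ⟨v, hv0, hvx, s, t, r, rfl⟩ : ∃ v, v ≠ 0 ∧ v ∈ x ∧ ∃ s t r : k,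
        v = s • P + t • U + r • V := by
      obtain ⟨y₁, y₂, hy, hxs⟩ := exists_basis_of_finrank_eq_two hx.1
      have hy₁ : y₁ ∈ x := hxs ▸ Submodule.subset_span (by simp)
      have hy₂ : y₂ ∈ x := hxs ▸ Submodule.subset_span (by simp)
      obtain ⟨s, t, r, w, h1⟩ := exists_coordinates hdet y₁
      obtain ⟨s', t', r', w', h2⟩ := exists_coordinates hdet y₂
      by_cases hw : w = 0
      · exact ⟨y₁, hy.ne_zero 0, hy₁, s, t, r, by rw [h1, hw]; module⟩
      · refine ⟨w' • y₁ + (-w) • y₂, ?_, x.add_mem (x.smul_mem _ hy₁) (x.smul_mem _ hy₂),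
          w' * s - w * s', w' * t - w * t', w' * r - w * r', by rw [h1, h2]; module⟩
        intro h0
        exact hw (neg_eq_zero.mp (LinearIndependent.pair_iff.mp hy _ _ h0).2)
    have h0 := hx.2 _ hvx
    rw [hplane] at h0
    rcases mul_eq_zero.mp h0 with h0 | h0
    · rcases mul_eq_zero.mp h0 with h0 | h0
      · refine Or.inr (Or.inl (inf_ne_bot_iff.mpr ⟨_, hv0, ?_, hvx⟩))
        rw [h0, zero_smul, add_zero]
        exact b.add_mem (b.smul_mem _ hPb) (b.smul_mem _ hVb)
      · refine Or.inl (inf_ne_bot_iff.mpr ⟨_, hv0, ?_, hvx⟩)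
        rw [h0, zero_smul, add_zero]
        exact a.add_mem (a.smul_mem _ hPa) (a.smul_mem _ hUa)
    · exact Or.inr (Or.inr (inf_ne_bot_iff.mpr ⟨_, hv0, hcmem _ _ _ h0, hvx⟩))

end Tritangent

section LineGraph

variable {k : Type*} [Field k] {f : MvPolynomial (Fin 4) k}

/-- The incidence graph of the lines on a surface. -/
def lineGraph (f : MvPolynomial (Fin 4) k) :
    SimpleGraph {W : Submodule k (Fin 4 → k) // IsLineOn f W} where
  Adj a b := a ≠ b ∧ a.1 ⊓ b.1 ≠ ⊥
  symm := ⟨fun a b h => ⟨h.1.symm, by rw [inf_comm]; exact h.2⟩⟩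
  loopless := ⟨fun a h => h.1 rfl⟩

lemma isTritangent_lineGraph [IsAlgClosed k] (hf : IsSmoothSurface f 3) :
    IsTritangent (lineGraph f) where
  exists_third a b hab := by
    obtain ⟨c, hc, hca, hcb, hac, hbc, -, -⟩ :=
      exists_tritangent hf a.2 b.2 (fun h => hab.1 (Subtype.ext h)) hab.2
    exact ⟨⟨c, hc⟩, ⟨fun h => hca (congrArg Subtype.val h).symm, hac⟩,
      ⟨fun h => hcb (congrArg Subtype.val h).symm, hbc⟩⟩
  unique a b c x hab hac hbc hax hbx := by
    obtain ⟨c', -, -, -, -, -, huniq, -⟩ :=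
      exists_tritangent hf a.2 b.2 (fun h => hab.1 (Subtype.ext h)) hab.2
    have hval : ∀ y, (lineGraph f).Adj a y → (lineGraph f).Adj b y → y.1 = c' :=
      fun y hy hy' => huniq y.1 y.2 (fun h => hy.1 (Subtype.ext h.symm))
        (fun h => hy'.1 (Subtype.ext h.symm)) hy.2 hy'.2
    exact Subtype.ext ((hval x hax hbx).trans (hval c hac hbc).symm)
  cover a b c x hab hac hbc hxa hxb hxc := by
    obtain ⟨c', -, -, -, -, -, huniq, hcov⟩ :=
      exists_tritangent hf a.2 b.2 (fun h => hab.1 (Subtype.ext h)) hab.2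
    have hc : c.1 = c' := huniq c.1 c.2 (fun h => hac.1 (Subtype.ext h.symm))
        (fun h => hbc.1 (Subtype.ext h.symm)) hac.2 hbc.2
    rw [← hc] at hcov
    rcases hcov x.1 x.2 with h | h | h
    · exact Or.inl ⟨hxa.symm, h⟩
    · exact Or.inr (Or.inl ⟨hxb.symm, h⟩)
    · exact Or.inr (Or.inr ⟨hxc.symm, h⟩)

end LineGraph

section Discriminant

variable {k : Type*} [Field k] {f : MvPolynomial (Fin 4) k}

/-- The discriminant of a ternary quadratic form. -/
def conicDisc {R : Type*} [CommRing R] (A B C D E F : R) : R :=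
  4 * A * C * F + B * D * E - A * E ^ 2 - C * D ^ 2 - F * B ^ 2

lemma exists_line_of_root [IsAlgClosed k] {A B C D E F m : k} (hdisc : conicDisc A B C D E F = 0)
    (hm : A + B * m + C * m ^ 2 = 0) (h : ¬ (B + 2 * C * m = 0 ∧ C = 0)) :
    ∃ n, (B + 2 * C * m) * n + D + E * m = 0 ∧ C * n ^ 2 + E * n + F = 0 := by
  rw [conicDisc] at hdisc
  have hA : A = -(B * m + C * m ^ 2) := by linear_combination hm
  subst hA
  by_cases hB : B + 2 * C * m = 0
  · have hC : C ≠ 0 := fun hC => h ⟨hB, hC⟩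
    have hB' : B = -(2 * C * m) := by linear_combination hB
    subst hB'
    have hD : C * (D + E * m) ^ 2 = 0 := by linear_combination -hdisc
    have hD' : D + E * m = 0 := by simpa [hC] using hD
    obtain ⟨n, hn⟩ := exists_quadratic_root hC E F
    exact ⟨n, by linear_combination hD', hn⟩
  · obtain ⟨n, hn⟩ : ∃ n, (B + 2 * C * m) * n + D + E * m = 0 :=
      ⟨-(D + E * m) / (B + 2 * C * m), by field_simp; ring⟩
    refine ⟨n, hn, mul_left_cancel₀ (pow_ne_zero 2 hB) ?_⟩
    linear_combination (C * ((B + 2 * C * m) * n - (D + E * m)) + E * (B + 2 * C * m)) * hn - hdisc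

/-- A singular conic contains a line. -/
lemma exists_line_of_conicDisc_eq_zero [IsAlgClosed k] {A B C D E F : k}
    (hdisc : conicDisc A B C D E F = 0) (h : ¬ (A = 0 ∧ B = 0 ∧ C = 0)) :
    ∃ s₀ t₀ s₁ t₁ : k, (s₀ ≠ 0 ∨ t₀ ≠ 0) ∧ ∀ x y : k,
      A * (x * s₀ + y * s₁) ^ 2 + B * (x * s₀ + y * s₁) * (x * t₀ + y * t₁) +
        C * (x * t₀ + y * t₁) ^ 2 + (D * (x * s₀ + y * s₁) + E * (x * t₀ + y * t₁)) * y +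
        F * y ^ 2 = 0 := by
  by_cases hC : C = 0
  · obtain ⟨n, h1, h2⟩ := exists_line_of_root (A := C) (B := B) (C := A) (D := E) (E := D) (F := F)
      (m := 0) (by rw [← hdisc, conicDisc, conicDisc]; ring) (by rw [hC]; ring)
      (fun h' => h ⟨h'.2, by simpa using h'.1, hC⟩)
    refine ⟨0, 1, n, 0, by simp, fun x y => ?_⟩
    rw [hC]
    linear_combination y ^ 2 * h2 + x * y * h1
  · obtain ⟨m, hm⟩ := exists_quadratic_root hC B A
    obtain ⟨n, h1, h2⟩ := exists_line_of_root (m := m) hdisc (by linear_combination hm)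
      (fun h' => hC h'.2)
    refine ⟨1, m, 0, n, by simp, fun x y => ?_⟩
    linear_combination x ^ 2 * hm + y ^ 2 * h2 + x * y * h1

/-- The discriminant of the residual conic in the plane spanned by a line and a vector. -/
noncomputable def residualDisc (f : MvPolynomial (Fin 4) k) (e₁ e₂ g : Fin 4 → k) : k :=
  conicDisc (polar f 1 e₁ g) (mixed f e₁ e₂ g) (polar f 1 e₂ g) (polar f 1 g e₁) (polar f 1 g e₂)
    (eval g f)

lemma mixed_add (e₁ e₂ g g' : Fin 4 → k) :
    mixed f e₁ e₂ (g + g') = mixed f e₁ e₂ g + mixed f e₁ e₂ g' := by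
  simp only [mixed, polar_one_add]
  ring

lemma mixed_smul (e₁ e₂ g : Fin 4 → k) (c : k) :
    mixed f e₁ e₂ (c • g) = c * mixed f e₁ e₂ g := by
  simp only [mixed, polar_one_smul]
  ring

lemma conicDisc_eq_zero_of_line [Infinite k] {A B C D E F s₁ t₁ s₂ t₂ : k}
    (h0 : s₁ ≠ 0 ∨ t₁ ≠ 0)
    (h : ∀ x : k, A * (x * s₁ + s₂) ^ 2 + B * (x * s₁ + s₂) * (x * t₁ + t₂) +
      C * (x * t₁ + t₂) ^ 2 + (D * (x * s₁ + s₂) + E * (x * t₁ + t₂)) + F = 0) :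
    conicDisc A B C D E F = 0 := by
  obtain ⟨p, hp⟩ : ∃ p : Polynomial k, p = Polynomial.C (A * s₁ ^ 2 + B * s₁ * t₁ + C * t₁ ^ 2) *
      Polynomial.X ^ 2 + Polynomial.C (2 * A * s₁ * s₂ + B * (s₁ * t₂ + s₂ * t₁) +
        2 * C * t₁ * t₂ + D * s₁ + E * t₁) * Polynomial.X +
      Polynomial.C (A * s₂ ^ 2 + B * s₂ * t₂ + C * t₂ ^ 2 + D * s₂ + E * t₂ + F) := ⟨_, rfl⟩
  have hp0 : p = 0 := Polynomial.funext fun x => by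
    rw [hp, Polynomial.eval_zero, ← h x]
    simp only [Polynomial.eval_add, Polynomial.eval_mul, Polynomial.eval_C, Polynomial.eval_X,
      Polynomial.eval_pow]
    ring
  have hX := congrArg (Polynomial.coeff · 2) hp0
  have hY := congrArg (Polynomial.coeff · 1) hp0
  have hZ := congrArg (Polynomial.coeff · 0) hp0
  simp only [hp, Polynomial.coeff_add, Polynomial.coeff_C_mul, Polynomial.coeff_X_pow,
    Polynomial.coeff_X, Polynomial.coeff_C, Polynomial.coeff_zero] at hX hY hZ
  norm_num at hX hY hZ
  obtain ⟨D', hD'⟩ : ∃ D', D' = D + 2 * A * s₂ + B * t₂ := ⟨_, rfl⟩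
  obtain ⟨E', hE'⟩ : ∃ E', E' = E + B * s₂ + 2 * C * t₂ := ⟨_, rfl⟩
  obtain ⟨F', hF'⟩ : ∃ F', F' = A * s₂ ^ 2 + B * s₂ * t₂ + C * t₂ ^ 2 + D * s₂ + E * t₂ + F :=
    ⟨_, rfl⟩
  have hdisc : conicDisc A B C D E F = conicDisc A B C D' E' F' := by
    rw [conicDisc, conicDisc, hD', hE', hF']
    ring
  have hY' : D' * s₁ + E' * t₁ = 0 := by
    rw [hD', hE']
    linear_combination hY
  rw [← hF'] at hZ
  rw [hdisc, conicDisc]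
  rcases h0 with h0 | h0
  · refine mul_left_cancel₀ (pow_ne_zero 2 h0) ?_
    linear_combination (4 * A * C - B ^ 2) * s₁ ^ 2 * hZ - E' ^ 2 * hX +
      (B * E' * s₁ - C * (D' * s₁ - E' * t₁)) * hY'
  · refine mul_left_cancel₀ (pow_ne_zero 2 h0) ?_
    linear_combination (4 * A * C - B ^ 2) * t₁ ^ 2 * hZ - D' ^ 2 * hX +
      (B * D' * t₁ - A * (E' * t₁ - D' * s₁)) * hY'

lemma exists_conicDisc_polynomial {A B C D E F : Polynomial k} (hA : A.natDegree ≤ 1)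
    (hB : B.natDegree ≤ 1) (hC : C.natDegree ≤ 1) (hD : D.natDegree ≤ 2) (hE : E.natDegree ≤ 2)
    (hF : F.natDegree ≤ 3) : (conicDisc A B C D E F).natDegree ≤ 5 ∧
      (conicDisc A B C D E F).coeff 5 = conicDisc (A.coeff 1) (B.coeff 1) (C.coeff 1) (D.coeff 2)
        (E.coeff 2) (F.coeff 3) := by
  have deg3 : ∀ {p q r : Polynomial k} {a b c : ℕ}, p.natDegree ≤ a → q.natDegree ≤ b →
      r.natDegree ≤ c → (p * q * r).natDegree ≤ a + b + c ∧
        (p * q * r).coeff (a + b + c) = p.coeff a * q.coeff b * r.coeff c := by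
    intro p q r a b c hp hq hr
    have hpq := Polynomial.natDegree_mul_le_of_le hp hq
    refine ⟨Polynomial.natDegree_mul_le_of_le hpq hr, ?_⟩
    rw [Polynomial.coeff_mul_add_eq_of_natDegree_le hpq hr,
      Polynomial.coeff_mul_add_eq_of_natDegree_le hp hq]
  have e : conicDisc A B C D E F = (4 : k) • (A * C * F) + B * D * E - A * E * E - C * D * D -
      B * B * F := by
    rw [conicDisc, Polynomial.smul_eq_C_mul, map_ofNat]
    ring
  obtain ⟨d1, c1⟩ := deg3 hA hC hF
  obtain ⟨d2, c2⟩ := deg3 hB hD hE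
  obtain ⟨d3, c3⟩ := deg3 hA hE hE
  obtain ⟨d4, c4⟩ := deg3 hC hD hD
  obtain ⟨d5, c5⟩ := deg3 hB hB hF
  norm_num at d1 c1 d2 c2 d3 c3 d4 c4 d5 c5
  rw [e]
  constructor
  · refine Polynomial.natDegree_sub_le_of_le (Polynomial.natDegree_sub_le_of_le
      (Polynomial.natDegree_sub_le_of_le (Polynomial.natDegree_add_le_of_le
        ((Polynomial.natDegree_smul_le _ _).trans d1) d2) d3) d4) d5
  · simp only [Polynomial.coeff_sub, Polynomial.coeff_add, Polynomial.coeff_smul, c1, c2, c3, c4,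
      c5, conicDisc, smul_eq_mul]
    ring

lemma exists_residualDisc_polynomial [Infinite k] (hf : f.IsHomogeneous 3)
    (e₁ e₂ g₁ g₂ : Fin 4 → k) : ∃ p : Polynomial k, p.natDegree ≤ 5 ∧
      p.coeff 5 = residualDisc f e₁ e₂ g₁ ∧ ∀ x, p.eval x = residualDisc f e₁ e₂ (x • g₁ + g₂) := by
  have hlin : ∀ a b : k, (Polynomial.C a * Polynomial.X + Polynomial.C b).natDegree ≤ 1 := by
    intro a b
    compute_degree
  obtain ⟨h1, h2⟩ := exists_conicDisc_polynomial (hlin (polar f 1 e₁ g₁) (polar f 1 e₁ g₂))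
    (hlin (mixed f e₁ e₂ g₁) (mixed f e₁ e₂ g₂)) (hlin (polar f 1 e₂ g₁) (polar f 1 e₂ g₂))
    (derivAlong_spec (q := 2) hf g₁ g₂ e₁).1 (derivAlong_spec (q := 2) hf g₁ g₂ e₂).1
    (natDegree_restr_le hf g₂ g₁)
  refine ⟨_, h1, ?_, ?_⟩
  · rw [h2, residualDisc, coeff_derivAlong (q := 2) hf, coeff_derivAlong (q := 2) hf]
    congr 1
    · simp
    · simp
    · simp
    · change polar f 3 g₂ g₁ = _
      rw [polar_swap hf le_rfl, polar_zero']
  · intro x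
    have hF : (restr f g₂ g₁).eval x = eval (x • g₁ + g₂) f := by
      rw [eval_restr, add_comm]
      simp
    rw [residualDisc, ← hF, ← eval_derivAlong (q := 2) hf, ← eval_derivAlong (q := 2) hf, conicDisc,
      conicDisc]
    simp [polar_one_add, polar_one_smul, mixed_add, mixed_smul]
    ring

end Discriminant

section Neighbors

variable {k : Type*} [Field k] {f : MvPolynomial (Fin 4) k} {e₁ e₂ : Fin 4 → k}
  {L : Submodule k (Fin 4 → k)}

lemma exists_line_of_residualDisc_eq_zero [IsAlgClosed k] (hf : IsSmoothSurface f 3)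
    (hL : IsLineOn f L) (h₁ : e₁ ∈ L) (h₂ : e₂ ∈ L) (hli : LinearIndependent k ![e₁, e₂])
    {g : Fin 4 → k} (hg : g ∉ L) (hdisc : residualDisc f e₁ e₂ g = 0) :
    ∃ M, IsLineOn f M ∧ M ≠ L ∧ L ⊓ M ≠ ⊥ ∧ g ∈ L ⊔ M := by
  have : Infinite k := IsAlgClosed.instInfinite
  obtain ⟨s₀, t₀, s₁, t₁, h0, h⟩ := exists_line_of_conicDisc_eq_zero hdisc
    (fun h' => polar_line_ne_zero hf hL h₁ h₂ hli hg h'.1 h'.2.1 h'.2.2)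
  set P := s₀ • e₁ + t₀ • e₂
  set Q := s₁ • e₁ + t₁ • e₂ + g
  have hP0 : P ≠ 0 := by
    intro hP
    have := LinearIndependent.pair_iff.mp hli _ _ hP
    tauto
  have hPL : P ∈ L := L.add_mem (L.smul_mem _ h₁) (L.smul_mem _ h₂)
  have hQL : s₁ • e₁ + t₁ • e₂ ∈ L := L.add_mem (L.smul_mem _ h₁) (L.smul_mem _ h₂)
  have hQ : Q ∉ L := fun hQ => hg ((L.add_mem_iff_right hQL).mp hQ)
  have hPQ := linearIndependent_of_notMem hPL hP0 hQ
  have hPM : P ∈ Submodule.span k {P, Q} := Submodule.subset_span (by simp)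
  have hQM : Q ∈ Submodule.span k {P, Q} := Submodule.subset_span (by simp)
  refine ⟨Submodule.span k {P, Q}, ⟨finrank_span_pair hPQ, ?_⟩, fun he => hQ (he ▸ hQM),
    inf_ne_bot_iff.mpr ⟨P, hP0, hPL, hPM⟩, ?_⟩
  · intro v hv
    obtain ⟨x, y, rfl⟩ := Submodule.mem_span_pair.mp hv
    rw [show x • P + y • Q = (x * s₀ + y * s₁) • e₁ + (x * t₀ + y * t₁) • e₂ + y • g by
      simp only [P, Q]; module, eval_plane hf.2.1 hL h₁ h₂]
    linear_combination y * h x y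
  · rw [Submodule.mem_sup]
    exact ⟨_, L.neg_mem hQL, Q, hQM, by simp only [Q]; module⟩

lemma residualDisc_eq_zero_of_line [Infinite k] (hf : f.IsHomogeneous 3)
    (hL : IsLineOn f L) (h₁ : e₁ ∈ L) (h₂ : e₂ ∈ L) (hli : LinearIndependent k ![e₁, e₂])
    {M : Submodule k (Fin 4 → k)} (hM : IsLineOn f M) (hLM : L ⊓ M ≠ ⊥) {g : Fin 4 → k} {s t : k}
    (hg : s • e₁ + t • e₂ + g ∈ M) : residualDisc f e₁ e₂ g = 0 := by
  obtain ⟨v, hv0, hvL, hvM⟩ := inf_ne_bot_iff.mp hLM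
  rw [eq_span_pair hL.1 hli h₁ h₂, Submodule.mem_span_pair] at hvL
  obtain ⟨s₁, t₁, rfl⟩ := hvL
  refine conicDisc_eq_zero_of_line (s₁ := s₁) (t₁ := t₁) (s₂ := s) (t₂ := t) ?_ fun x => ?_
  · by_contra! hcon
    exact hv0 (by simp [hcon.1, hcon.2])
  · have := hM.2 _ (M.add_mem (M.smul_mem x hvM) hg)
    rw [show x • (s₁ • e₁ + t₁ • e₂) + (s • e₁ + t • e₂ + g) =
      (x * s₁ + s) • e₁ + (x * t₁ + t) • e₂ + (1 : k) • g by module,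
      eval_plane hf hL h₁ h₂] at this
    linear_combination this

/-- Two lines in a plane meet. -/
lemma inf_ne_bot_of_le {M M' H : Submodule k (Fin 4 → k)} (hM : Module.finrank k M = 2)
    (hM' : Module.finrank k M' = 2) (hH : Module.finrank k H ≤ 3) (h : M ≤ H) (h' : M' ≤ H) :
    M ⊓ M' ≠ ⊥ := by
  intro hbot
  have h1 := Submodule.finrank_sup_add_finrank_inf_eq M M'
  have h2 := Submodule.finrank_mono (sup_le h h')
  rw [hbot, finrank_bot] at h1
  omega

lemma exists_notMem_sup [IsAlgClosed k]
    (hfin : Finite {W : Submodule k (Fin 4 → k) // IsLineOn f W})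
    (hL : IsLineOn f L) : ∃ g, ∀ M, IsLineOn f M → L ⊓ M ≠ ⊥ → g ∉ L ⊔ M := by
  classical
  have : Infinite k := IsAlgClosed.instInfinite
  have hfin' : {W : Submodule k (Fin 4 → k) | IsLineOn f W ∧ L ⊓ W ≠ ⊥}.Finite :=
    (Set.finite_coe_iff.mp hfin :
      Set.Finite {W : Submodule k (Fin 4 → k) | IsLineOn f W}).subset fun W hW => hW.1
  have htop : (⊤ : Submodule k (Fin 4 → k)) ∉ hfin'.toFinset.image (L ⊔ ·) := by
    intro h
    obtain ⟨M, hM, hMtop⟩ := Finset.mem_image.mp h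
    rw [Set.Finite.mem_toFinset] at hM
    have h1 := Submodule.finrank_sup_add_finrank_inf_eq L M
    have h2 : 0 < Module.finrank k (L ⊓ M : Submodule k (Fin 4 → k)) := by
      rw [Module.finrank_pos_iff, Submodule.nontrivial_iff_ne_bot]
      exact hM.2
    rw [hMtop, finrank_top, hL.1, hM.1.1, Module.finrank_fin_fun] at h1
    omega
  have := Subspace.biUnion_ne_univ_of_top_notMem htop
  obtain ⟨g, hg⟩ := (Set.ne_univ_iff_exists_notMem _).mp this
  refine ⟨g, fun M hM hLM hgM => hg ?_⟩
  simp only [Set.mem_iUnion]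
  exact ⟨L ⊔ M, Finset.mem_image_of_mem _ ((Set.Finite.mem_toFinset _).mpr ⟨hM, hLM⟩), hgM⟩

lemma eq_zero_of_combination_eq_zero {g₁ g₂ : Fin 4 → k}
    (hli : LinearIndependent k ![e₁, e₂, g₁, g₂])
    {s t x y : k} (h : s • e₁ + t • e₂ + x • g₁ + y • g₂ = 0) : y = 0 := by
  have := Fintype.linearIndependent_iff.mp hli ![s, t, x, y] (by simpa [Fin.sum_univ_four] using h)
  exact this 3

lemma smul_add_notMem_span {g₁ g₂ : Fin 4 → k} (hli : LinearIndependent k ![e₁, e₂, g₁, g₂])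
    (x : k) : x • g₁ + g₂ ∉ Submodule.span k {e₁, e₂} := by
  intro hx
  obtain ⟨s, t, hst⟩ := Submodule.mem_span_pair.mp hx
  have h0 : s • e₁ + t • e₂ + (-x) • g₁ + (-1 : k) • g₂ = 0 := by
    rw [hst]
    module
  exact one_ne_zero (neg_eq_zero.mp (eq_zero_of_combination_eq_zero hli h0))

open scoped Classical in
/-- A line on a smooth cubic surface meets at least one and at most ten others. -/
lemma lineGraph_neighbors [IsAlgClosed k] (hf : IsSmoothSurface f 3)
    [Fintype {W : Submodule k (Fin 4 → k) // IsLineOn f W}]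
    (L : {W : Submodule k (Fin 4 → k) // IsLineOn f W}) :
    (∃ M, (lineGraph f).Adj L M) ∧ (lineGraph f).degree L ≤ 10 := by
  have : Infinite k := IsAlgClosed.instInfinite
  have htri := isTritangent_lineGraph hf
  obtain ⟨L, hL⟩ := L
  obtain ⟨e₁, e₂, hli, hspan⟩ := exists_basis_of_finrank_eq_two hL.1
  have h₁ : e₁ ∈ L := hspan ▸ Submodule.subset_span (by simp)
  have h₂ : e₂ ∈ L := hspan ▸ Submodule.subset_span (by simp)
  obtain ⟨g₁, hg₁⟩ := exists_notMem_sup (f := f) inferInstance hL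
  have hg₁L : g₁ ∉ L := fun h => hg₁ L hL
    (inf_ne_bot_iff.mpr ⟨e₁, hli.ne_zero 0, h₁, h₁⟩) (Submodule.mem_sup_left h)
  obtain ⟨g₂, hdet⟩ := exists_det4_ne_zero_of_notMem hli (hspan ▸ hg₁L)
  obtain ⟨p, hdeg, hcoeff, heval⟩ := exists_residualDisc_polynomial hf.2.1 e₁ e₂ g₁ g₂
  have hlead : p.coeff 5 ≠ 0 := by
    rw [hcoeff]
    intro h0
    obtain ⟨M, hM, -, hLM, hgM⟩ := exists_line_of_residualDisc_eq_zero hf hL h₁ h₂ hli hg₁L h0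
    exact hg₁ M hM hLM hgM
  have hdeg' : p.natDegree = 5 := le_antisymm hdeg (Polynomial.le_natDegree_of_ne_zero hlead)
  have hp0 : p ≠ 0 := fun h0 => hlead (by simp [h0])
  have hnotMem : ∀ x : k, x • g₁ + g₂ ∉ L := fun x => by
    rw [hspan]
    exact smul_add_notMem_span (linearIndependent_of_det4 hdet) x
  constructor
  · obtain ⟨x, hx⟩ := exists_eval_eq_zero_of_natDegree_pos (p := p) (by omega)
    rw [heval] at hx
    obtain ⟨M, hM, hML, hLM, -⟩ :=
      exists_line_of_residualDisc_eq_zero hf hL h₁ h₂ hli (hnotMem x) hx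
    exact ⟨⟨M, hM⟩, fun h => hML (congrArg Subtype.val h).symm, hLM⟩
  have hslope : ∀ M, (lineGraph f).Adj ⟨L, hL⟩ M →
      ∃ x s t : k, s • e₁ + t • e₂ + (x • g₁ + g₂) ∈ M.1 := by
    intro M hadj
    obtain ⟨m, hmM, hmL⟩ : ∃ m ∈ M.1, m ∉ L := by
      by_contra! hcon
      exact hadj.1 (Subtype.ext
        (Submodule.eq_of_le_of_finrank_eq hcon (by rw [hL.1, M.2.1])).symm)
    obtain ⟨s, t, x, y, rfl⟩ := exists_coordinates hdet m
    have hstL : s • e₁ + t • e₂ ∈ L := L.add_mem (L.smul_mem _ h₁) (L.smul_mem _ h₂)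
    have hy : y ≠ 0 := by
      rintro rfl
      have hx : x ≠ 0 := by
        rintro rfl
        exact hmL (by simpa using hstL)
      refine hg₁ M.1 M.2 hadj.2 ?_
      have h3 : x⁻¹ • ((s • e₁ + t • e₂ + x • g₁ + (0 : k) • g₂) - (s • e₁ + t • e₂)) ∈ L ⊔ M.1 :=
        Submodule.smul_mem _ _ (Submodule.sub_mem _ (Submodule.mem_sup_right hmM)
          (Submodule.mem_sup_left hstL))
      rwa [show (s • e₁ + t • e₂ + x • g₁ + (0 : k) • g₂) - (s • e₁ + t • e₂) = x • g₁ by module,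
        inv_smul_smul₀ hx] at h3
    refine ⟨y⁻¹ * x, y⁻¹ * s, y⁻¹ * t, ?_⟩
    have h3 := M.1.smul_mem y⁻¹ hmM
    rw [show y⁻¹ • (s • e₁ + t • e₂ + x • g₁ + y • g₂) = (y⁻¹ * s) • e₁ + (y⁻¹ * t) • e₂ +
      ((y⁻¹ * x) • g₁ + y⁻¹ • y • g₂) by module, inv_smul_smul₀ hy] at h3
    exact h3
  let slope : {W : Submodule k (Fin 4 → k) // IsLineOn f W} → k := fun M =>
    if h : (lineGraph f).Adj ⟨L, hL⟩ M then (hslope M h).choose else 0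
  have hslope' : ∀ M, (lineGraph f).Adj ⟨L, hL⟩ M →
      ∃ s t : k, s • e₁ + t • e₂ + (slope M • g₁ + g₂) ∈ M.1 := by
    intro M h
    simp only [slope, dif_pos h]
    exact (hslope M h).choose_spec
  have hplane : ∀ M, (lineGraph f).Adj ⟨L, hL⟩ M →
      M.1 ≤ Submodule.span k (({e₁, e₂, slope M • g₁ + g₂} : Finset (Fin 4 → k)) : Set (Fin 4 → k)) := by
    intro M h
    set H := Submodule.span k
      (({e₁, e₂, slope M • g₁ + g₂} : Finset (Fin 4 → k)) : Set (Fin 4 → k))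
    have hLH : L ≤ H := by
      rw [hspan]
      exact Submodule.span_mono (by intro v; simp; tauto)
    obtain ⟨s, t, hst⟩ := hslope' M h
    obtain ⟨v, hv0, hvL, hvM⟩ := inf_ne_bot_iff.mp h.2
    have hstL : s • e₁ + t • e₂ ∈ L := L.add_mem (L.smul_mem _ h₁) (L.smul_mem _ h₂)
    have hli' := linearIndependent_of_notMem hvL hv0
      (fun h' => hnotMem (slope M) ((L.add_mem_iff_right hstL).mp h'))
    rw [eq_span_pair M.2.1 hli' hvM hst, Submodule.span_le]
    rintro w (rfl | rfl)
    · exact hLH hvL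
    · exact H.add_mem (hLH hstL) (Submodule.subset_span (by simp))
  rw [← SimpleGraph.card_neighborFinset_eq_degree]
  have hcard : p.roots.toFinset.card ≤ 5 :=
    (Multiset.toFinset_card_le _).trans ((Polynomial.card_roots' p).trans hdeg)
  refine (Finset.card_le_mul_card_image_of_maps_to (f := slope) (t := p.roots.toFinset) ?_ 2
    ?_).trans (by omega)
  · intro M hM
    rw [SimpleGraph.mem_neighborFinset] at hM
    obtain ⟨s, t, hst⟩ := hslope' M hM
    rw [Multiset.mem_toFinset, Polynomial.mem_roots hp0, Polynomial.IsRoot, heval]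
    exact residualDisc_eq_zero_of_line hf.2.1 hL h₁ h₂ hli M.2 hM.2 hst
  · intro x _
    by_contra! hcon
    obtain ⟨a, ha, b, hb, c, hc, hab, hac, hbc⟩ := Finset.two_lt_card.mp hcon
    simp only [Finset.mem_filter, SimpleGraph.mem_neighborFinset] at ha hb hc
    have hadj : ∀ M M', M ≠ M' → (lineGraph f).Adj ⟨L, hL⟩ M ∧ slope M = x →
        (lineGraph f).Adj ⟨L, hL⟩ M' ∧ slope M' = x → (lineGraph f).Adj M M' := by
      intro M M' hne hM hM'
      have h1 := hplane M hM.1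
      have h2 := hplane M' hM'.1
      rw [hM.2] at h1
      rw [hM'.2] at h2
      exact ⟨hne, inf_ne_bot_of_le M.2.1 M'.2.1
        ((finrank_span_finset_le_card _).trans Finset.card_le_three) h1 h2⟩
    exact hbc (htri.unique _ a c b ha.1 hc.1 (hadj a c hac ha hc) hb.1 (hadj a b hab ha hb))

end Neighbors

section FermatCubic

variable {k : Type*} [Field k]

/-- The Fermat cubic form. -/
noncomputable def fermatCubic (k : Type*) [Field k] : MvPolynomial (Fin 4) k :=
  ∑ i, MvPolynomial.X i ^ 3

lemma isLineOn_fermatCubic_iff {W : Submodule k (Fin 4 → k)} :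
    IsLineOn (fermatCubic k) W ↔ IsFermatLine 2 W := by
  simp [IsLineOn, IsFermatLine, fermatCubic, Fin.sum_univ_four]

lemma isSmoothSurface_fermatCubic (h3 : (3 : k) ≠ 0) : IsSmoothSurface (fermatCubic k) 3 := by
  refine ⟨fun h => ?_, IsHomogeneous.sum _ _ _ fun i _ => isHomogeneous_X_pow i 3,
    fun v hv h => hv ?_⟩
  · have := congrArg (eval ![1, 0, 0, 0]) h
    simp [fermatCubic, Fin.sum_univ_four] at this
  · ext i
    have := h.2 i
    simpa [fermatCubic, pderiv_X, Pi.single_apply, h3, apply_ite, Finset.sum_ite_eq] using this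

/-- The two spanning vectors of a line on the Fermat cubic in characteristic two. -/
def fermatCubicBasis (σ : Fin 3) (x y : k) : (Fin 4 → k) × (Fin 4 → k) :=
  ![(![1, x, 0, 0], ![0, 0, 1, y]), (![1, 0, x, 0], ![0, 1, 0, y]),
    (![1, 0, 0, x], ![0, 1, y, 0])] σ

lemma isFermatLine_fermatCubicBasis [CharP k 2] (σ : Fin 3) {x y : k} (hx : x ^ 3 = 1)
    (hy : y ^ 3 = 1) : IsFermatLine 2
      (Submodule.span k {(fermatCubicBasis σ x y).1, (fermatCubicBasis σ x y).2}) := by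
  have h2 : (2 : k) = 0 := CharTwo.two_eq_zero
  refine ⟨finrank_span_pair ?_, fun w hw => ?_⟩
  · refine LinearIndependent.pair_iff.mpr fun s t h => ?_
    have h0 := congrFun h 0
    have h1 := congrFun h 1
    have h2 := congrFun h 2
    fin_cases σ <;> simp [fermatCubicBasis] at h0 h1 h2 <;> simp_all
  · obtain ⟨s, t, rfl⟩ := Submodule.mem_span_pair.mp hw
    fin_cases σ <;> simp [fermatCubicBasis] <;>
      linear_combination s ^ 3 * hx + t ^ 3 * hy + (s ^ 3 + t ^ 3) * h2

lemma fermatCubicBasis_injective {σ τ : Fin 3} {x y x' y' : k} (hx : x ≠ 0) (hy : y ≠ 0)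
    (h : Submodule.span k {(fermatCubicBasis σ x y).1, (fermatCubicBasis σ x y).2} =
      Submodule.span k {(fermatCubicBasis τ x' y').1, (fermatCubicBasis τ x' y').2}) :
    σ = τ ∧ x = x' ∧ y = y' := by
  obtain ⟨s, t, hst⟩ := Submodule.mem_span_pair.mp
    (h ▸ Submodule.subset_span (by simp) : (fermatCubicBasis σ x y).1 ∈ _)
  obtain ⟨a, b, hab⟩ := Submodule.mem_span_pair.mp
    (h ▸ Submodule.subset_span (by simp) : (fermatCubicBasis σ x y).2 ∈ _)
  rw [funext_iff, Fin.forall_fin_succ, Fin.forall_fin_succ, Fin.forall_fin_two] at hst hab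
  clear h
  fin_cases σ <;> fin_cases τ <;> simp [fermatCubicBasis] at hst hab ⊢ <;> grind

open scoped Classical in
lemma finite_isFermatLine_two [IsAlgClosed k] [CharP k 2] :
    {W : Submodule k (Fin 4 → k) | IsFermatLine 2 W}.Finite := by
  have hT : {t : k | t ^ 4 = t}.Finite := by
    have hp : (Polynomial.X ^ 4 - Polynomial.X : Polynomial k) ≠ 0 := fun h => by
      simpa [Polynomial.coeff_X] using congrArg (Polynomial.coeff · 4) h
    refine (Polynomial.X ^ 4 - Polynomial.X : Polynomial k).roots.toFinset.finite_toSet.subset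
      fun t ht => ?_
    simpa [hp, sub_eq_zero] using ht
  have hF := Set.Finite.pi' fun _ : Fin 4 => hT
  refine ((hF.prod hF).image fun a => Submodule.span k {a.1, a.2}).subset fun W hW => ?_
  obtain ⟨i, j, u, v, hu, hv, hui, huj, hvi, hvj, hspan⟩ := exists_echelon_basis hW.1
  refine ⟨(u, v), ⟨fun l => ?_, fun l => ?_⟩, le_antisymm ?_ fun w hw => ?_⟩
  · have := hspan _ (hW.pow_mem (p := 2) (e := 1) rfl le_rfl hu)
    simpa [hui, huj] using congrFun this l
  · have := hspan _ (hW.pow_mem (p := 2) (e := 1) rfl le_rfl hv)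
    simpa [hvi, hvj] using congrFun this l
  · rw [Submodule.span_le]
    rintro _ (rfl | rfl) <;> assumption
  · exact Submodule.mem_span_pair.mpr ⟨_, _, (hspan w hw).symm⟩

lemma card_isFermatLine_two [IsAlgClosed k] [CharP k 2]
    [Fintype {W : Submodule k (Fin 4 → k) // IsLineOn (fermatCubic k) W}] :
    27 ≤ Fintype.card {W : Submodule k (Fin 4 → k) // IsLineOn (fermatCubic k) W} := by
  have h2 : (2 : k) = 0 := CharTwo.two_eq_zero
  obtain ⟨ω, hω⟩ := exists_quadratic_root (one_ne_zero (α := k)) 1 1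
  let z : Fin 3 → k := ![1, ω, ω ^ 2]
  have hz : ∀ i, z i ^ 3 = 1 := by
    intro i
    fin_cases i <;> simp [z] <;> grind
  have hz0 : ∀ i, z i ≠ 0 := fun i h => by simpa [h] using hz i
  have hinj : Function.Injective z := by
    intro i j hij
    fin_cases i <;> fin_cases j <;> simp [z] at hij ⊢ <;> grind
  have := Fintype.card_le_of_injective
    (fun a : Fin 3 × Fin 3 × Fin 3 =>
      (⟨_, isLineOn_fermatCubic_iff.mpr
        (isFermatLine_fermatCubicBasis a.1 (hz a.2.1) (hz a.2.2))⟩ :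
        {W : Submodule k (Fin 4 → k) // IsLineOn (fermatCubic k) W})) fun a b hab => by
      obtain ⟨h, hx, hy⟩ := fermatCubicBasis_injective (hz0 _) (hz0 _) (congrArg Subtype.val hab)
      exact Prod.ext h (Prod.ext (hinj hx) (hinj hy))
  simpa using this

end FermatCubic

open scoped Classical in
lemma exists_equiv_of_three {k : Type*} [Field k] [IsAlgClosed k] {f : MvPolynomial (Fin 4) k}
    (hf : IsSmoothSurface f 3)
    (hcount : {W : Submodule k (Fin 4 → k) | IsLineOn f W}.ncard = 27)
    (K : Type*) [Field K] [IsAlgClosed K] [CharP K 2] :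
    ∃ φ : {W : Submodule k (Fin 4 → k) // IsLineOn f W} ≃
        {W : Submodule K (Fin 4 → K) // IsFermatLine 2 W},
      ∀ W W', W ≠ W' → (W.1 ⊓ W'.1 ≠ ⊥ ↔ (φ W).1 ⊓ (φ W').1 ≠ ⊥) := by
  have h3 : (3 : K) ≠ 0 := by
    rw [show (3 : K) = 2 + 1 by norm_num, CharTwo.two_eq_zero, zero_add]
    exact one_ne_zero
  have : Fintype {W : Submodule k (Fin 4 → k) // IsLineOn f W} :=
    (Set.finite_of_ncard_pos
      (by omega : 0 < {W : Submodule k (Fin 4 → k) | IsLineOn f W}.ncard)).fintype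
  have : Fintype {W : Submodule K (Fin 4 → K) // IsLineOn (fermatCubic K) W} := by
    have h := finite_isFermatLine_two (k := K)
    simp only [← isLineOn_fermatCubic_iff] at h
    exact h.fintype
  have hf' := isSmoothSurface_fermatCubic h3
  have hcard : Fintype.card {W : Submodule k (Fin 4 → k) // IsLineOn f W} = 27 := by
    rw [← hcount, ← Nat.card_eq_fintype_card, ← Nat.card_coe_set_eq]
    rfl
  obtain ⟨φ, hφ⟩ := exists_equiv_of_isTritangent (isTritangent_lineGraph hf) hcard.ge
    (fun v => (lineGraph_neighbors hf v).2) (fun v => (lineGraph_neighbors hf v).1)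
    (isTritangent_lineGraph hf') card_isFermatLine_two
    (fun v => (lineGraph_neighbors hf' v).2) (fun v => (lineGraph_neighbors hf' v).1)
  refine ⟨φ.trans (Equiv.subtypeEquivRight fun _ => isLineOn_fermatCubic_iff),
    fun W W' hne => ?_⟩
  have hadj := hφ W W'
  exact ⟨fun h => (hadj.mp ⟨hne, h⟩).2, fun h => (hadj.mpr ⟨φ.injective.ne hne, h⟩).2⟩

end FermatLines

theorem lines_incidence_isomorphic_to_fermat {k : Type*} [Field k] [IsAlgClosed k]
    (d : ℕ) (hd : 3 ≤ d)
    (f : MvPolynomial (Fin 4) k) (hf : IsSmoothSurface f d)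
    (hcount : {W : Submodule k (Fin 4 → k) | IsLineOn f W}.ncard =
      d ^ 2 * (d ^ 2 - 3 * d + 3)) :
    ∃ (p e : ℕ) (hp : p.Prime), 1 ≤ e ∧ d = p ^ e + 1 ∧
      (letI : Fact p.Prime := ⟨hp⟩
       ∃ φ : {W : Submodule k (Fin 4 → k) // IsLineOn f W} ≃
          {W : Submodule (AlgebraicClosure (ZMod p)) (Fin 4 → AlgebraicClosure (ZMod p)) //
            Module.finrank (AlgebraicClosure (ZMod p)) W = 2 ∧
            ∀ v ∈ W, v 0 ^ (p ^ e + 1) + v 1 ^ (p ^ e + 1) +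
              v 2 ^ (p ^ e + 1) + v 3 ^ (p ^ e + 1) = 0},
        ∀ W W' : {W : Submodule k (Fin 4 → k) // IsLineOn f W}, W ≠ W' →
          ((W : Submodule k (Fin 4 → k)) ⊓ (W' : Submodule k (Fin 4 → k)) ≠ ⊥ ↔
            (φ W : Submodule (AlgebraicClosure (ZMod p)) (Fin 4 → AlgebraicClosure (ZMod p))) ⊓
              (φ W') ≠ ⊥)) := by
  rcases hd.eq_or_lt with rfl | hd
  · refine ⟨2, 1, Nat.prime_two, le_rfl, rfl, ?_⟩
    have : Fact (Nat.Prime 2) := ⟨Nat.prime_two⟩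
    exact FermatLines.exists_equiv_of_three hf hcount (AlgebraicClosure (ZMod 2))
  · obtain ⟨p, e, hp, he, hd', φ, hφ⟩ := FermatLines.exists_equiv_of_four_le hd hf hcount
    exact ⟨p, e, hp, he, hd', φ, fun W W' _ => hφ W W'⟩
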